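/- arXiv:1708.02847 — 7 statements merged into one kernel-verified Lean document; each statement's English description precedes it below -/
import Mathlib

section
/- Let (k,[·,·]_k) and (s,[·,·]_s) be Leibniz algebras over a field K of characteristic 0, and let ω: k⊗k → s, l: k → gl(s), r: k → gl(s) be linear maps. Define a bilinear bracket on the direct sum k⊕s by [x+α, y+β]_{(l,r,ω)} = [x,y]_k + ω(x,y) + l_x(β) + r_y(α) + [α,β]_s. Then (k⊕s, [·,·]_{(l,r,ω)}) is a Leibniz algebra if and only if for all x,y,z ∈ k and α,β ∈ s: (1) l_x[α,β]_s = [l_xα,β]_s + [α,l_xβ]_s; (2) r_x[α,β]_s = [α,r_xβ]_s − [β,r_xα]_s; (3) [l_xα + r_xα, β]_s = 0; (4) l_x∘l_y − l_y∘l_x − l_{[x,y]_k} = ad^L_{ω(x,y)}, where ad^L_γ(β) = [γ,β]_s; (5) l_x∘r_y − r_y∘l_x − r_{[x,y]_k} = ad^R_{ω(x,y)}, where ad^R_γ(α) = [α,γ]_s; (6) r_y(r_x(α) + l_x(α)) = 0; (7) l_xω(y,z) − l_yω(x,z) − r_zω(x,y) = ω([x,y]_k,z) − ω(x,[y,z]_k)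 + ω(y,[x,z]_k). -/
/-- The bracket on `k ⊕ s` built from a pair of Leibniz brackets, a cocycle `ω`
and maps `l, r : k → gl(s)`:
`[x+α, y+β] = [x,y]_k + ω(x,y) + l x β + r y α + [α,β]_s`. -/
def nonAbelianLeibnizBracket {K : Type*} [Field K]
    {k s : Type*} [AddCommGroup k] [Module K k] [AddCommGroup s] [Module K s]
    (bk : k →ₗ[K] k →ₗ[K] k) (bs : s →ₗ[K] s →ₗ[K] s)
    (ω : k →ₗ[K] k →ₗ[K] s) (l r : k →ₗ[K] Module.End K s) :
    k × s → k × s → k × s :=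
  fun a b => (bk a.1 b.1, ω a.1 b.1 + l a.1 b.2 + r b.1 a.2 + bs a.2 b.2)

/-- `(k ⊕ s, [·,·]_{(l,r,ω)})` is a Leibniz algebra iff the seven
compatibility conditions on `l`, `r`, `ω` hold. -/
theorem nonAbelianLeibnizBracket_leibniz_iff {K : Type*} [Field K] [CharZero K]
    {k s : Type*} [AddCommGroup k] [Module K k] [AddCommGroup s] [Module K s]
    (bk : k →ₗ[K] k →ₗ[K] k) (bs : s →ₗ[K] s →ₗ[K] s)
    (hk : ∀ x y z : k, bk x (bk y z) = bk (bk x y) z + bk y (bk x z))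
    (hs : ∀ x y z : s, bs x (bs y z) = bs (bs x y) z + bs y (bs x z))
    (ω : k →ₗ[K] k →ₗ[K] s) (l r : k →ₗ[K] Module.End K s) :
    (∀ a b c : k × s,
        nonAbelianLeibnizBracket bk bs ω l r a (nonAbelianLeibnizBracket bk bs ω l r b c)
          = nonAbelianLeibnizBracket bk bs ω l r (nonAbelianLeibnizBracket bk bs ω l r a b) c
            + nonAbelianLeibnizBracket bk bs ω l r b (nonAbelianLeibnizBracket bk bs ω l r a c))
    ↔ ((∀ (x : k) (α β : s), l x (bs α β) = bs (l x α) β + bs α (l x β)) ∧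
       (∀ (x : k) (α β : s), r x (bs α β) = bs α (r x β) - bs β (r x α)) ∧
       (∀ (x : k) (α β : s), bs (l x α + r x α) β = 0) ∧
       (∀ (x y : k) (β : s), l x (l y β) - l y (l x β) - l (bk x y) β = bs (ω x y) β) ∧
       (∀ (x y : k) (α : s), l x (r y α) - r y (l x α) - r (bk x y) α = bs α (ω x y)) ∧
       (∀ (x y : k) (α : s), r y (r x α + l x α) = 0) ∧
       (∀ x y z : k, l x (ω y z) - l y (ω x z) - r z (ω x y)
          = ω (bk x y) z - ω x (bk y z) + ω y (bk x z))) := by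
  constructor
  · intro h
    have key : ∀ (x y z : k) (α β γ : s), _ := fun x y z α β γ =>
      congrArg Prod.snd (h (x, α) (y, β) (z, γ))
    simp only [nonAbelianLeibnizBracket, Prod.snd_add] at key
    have h1 : ∀ (x : k) (α β : s), l x (bs α β) = bs (l x α) β + bs α (l x β) := by
      intro x α β
      simpa using key x 0 0 0 α β
    have h5 : ∀ (x y : k) (α : s),
        l x (r y α) - r y (l x α) - r (bk x y) α = bs α (ω x y) := by
      intro x y α
      have e := key x 0 y 0 α 0
      simp only [map_zero, LinearMap.zero_apply, zero_add, add_zero] at e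
      linear_combination (norm := module) e
    refine ⟨h1, ?_, ?_, ?_, h5, ?_, ?_⟩
    · intro x α β
      have e := key 0 0 x α β 0
      simp only [map_zero, LinearMap.zero_apply, zero_add, add_zero] at e
      linear_combination (norm := module) -e
    · intro x α β
      have e := key 0 x 0 α 0 β
      simp only [map_zero, LinearMap.zero_apply, zero_add, add_zero] at e
      simp only [map_add, LinearMap.add_apply]
      linear_combination (norm := module) -e - h1 x α β
    · intro x y β
      have e := key x y 0 0 0 β
      simp only [map_zero, LinearMap.zero_apply, zero_add, add_zero] at e
      linear_combination (norm := module) e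
    · intro x y α
      have e := key 0 x y α 0 0
      simp only [map_zero, LinearMap.zero_apply, zero_add, add_zero] at e
      simp only [map_add]
      linear_combination (norm := module) -e - h5 x y α
    · intro x y z
      have e := key x y z 0 0 0
      simp only [map_zero, LinearMap.zero_apply, add_zero] at e
      linear_combination (norm := module) e
  · rintro ⟨h1, h2, h3, h4, h5, h6, h7⟩ ⟨x, α⟩ ⟨y, β⟩ ⟨z, γ⟩
    have e3 := h3 y α γ
    have e6 := h6 y z α
    simp only [map_add, LinearMap.add_apply] at e3 e6
    refine Prod.ext (hk x y z) ?_
    simp only [nonAbelianLeibnizBracket, Prod.snd_add, map_add, LinearMap.add_apply]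
    linear_combination (norm := module) hs α β γ + h1 x β γ - h1 y α γ - e3 - h2 z α β
      + h4 x y γ + h5 x z β - h5 y z α - e6 + h7 x y z
end

section
/- Let g be a 3-Lie algebra over a field K of characteristic 0, V a K-vector space, and ρ: g×g → gl(V) a bilinear map with ρ(x,y) = −ρ(y,x). Then ρ is a representation of g on V (i.e. ρ(x1,x2)ρ(x3,x4) = ρ([x1,x2,x3]_g,x4) + ρ(x3,[x1,x2,x4]_g) + ρ(x3,x4)ρ(x1,x2) and ρ(x1,[x2,x3,x4]_g) = ρ(x3,x4)ρ(x1,x2) − ρ(x2,x4)ρ(x1,x3) + ρ(x2,x3)ρ(x1,x4) for all xi ∈ g) if and only if the bracket [x1+v1, x2+v2, x3+v3]_ρ = [x1,x2,x3]_g + ρ(x1,x2)v3 + ρ(x2,x3)v1 + ρ(x3,x1)v2 (xi ∈ g, vi ∈ V) defines a 3-Lie algebra structure on g⊕V. -/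
/-- The semidirect-product bracket on `g ⊕ V` built from a trilinear bracket on `g`
and a skew-symmetric bilinear map `ρ : g × g → gl(V)`. -/
def semidirectBracket {K : Type*} [Field K]
    {g V : Type*} [AddCommGroup g] [Module K g] [AddCommGroup V] [Module K V]
    (bg : g →ₗ[K] g →ₗ[K] g →ₗ[K] g) (ρ : g →ₗ[K] g →ₗ[K] Module.End K V) :
    g × V → g × V → g × V → g × V :=
  fun a b c => (bg a.1 b.1 c.1, ρ a.1 b.1 c.2 + ρ b.1 c.1 a.2 + ρ c.1 a.1 b.2)

/-- a skew-symmetric bilinear map `ρ : g × g → gl(V)` is a representation of the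
3-Lie algebra `g` on `V` iff the semidirect-product bracket makes `g ⊕ V` a 3-Lie algebra. -/
theorem representation_iff_semidirect_threeLie {K : Type*} [Field K] [CharZero K]
    {g V : Type*} [AddCommGroup g] [Module K g] [AddCommGroup V] [Module K V]
    (bg : g →ₗ[K] g →ₗ[K] g →ₗ[K] g)
    (hgalt : ∀ x y z : g, x = y ∨ y = z ∨ x = z → bg x y z = 0)
    (hgfi : ∀ x1 x2 x3 x4 x5 : g,
      bg x1 x2 (bg x3 x4 x5)
        = bg (bg x1 x2 x3) x4 x5 + bg x3 (bg x1 x2 x4) x5 + bg x3 x4 (bg x1 x2 x5))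
    (ρ : g →ₗ[K] g →ₗ[K] Module.End K V)
    (hρ : ∀ x y : g, ρ x y = - ρ y x) :
    ((∀ (x1 x2 x3 x4 : g) (v : V),
        ρ x1 x2 (ρ x3 x4 v)
          = ρ (bg x1 x2 x3) x4 v + ρ x3 (bg x1 x2 x4) v + ρ x3 x4 (ρ x1 x2 v)) ∧
     (∀ (x1 x2 x3 x4 : g) (v : V),
        ρ x1 (bg x2 x3 x4) v
          = ρ x3 x4 (ρ x1 x2 v) - ρ x2 x4 (ρ x1 x3 v) + ρ x2 x3 (ρ x1 x4 v)))
    ↔ ((∀ a b c : g × V, a = b ∨ b = c ∨ a = c → semidirectBracket bg ρ a b c = 0) ∧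
       (∀ a1 a2 a3 a4 a5 : g × V,
          semidirectBracket bg ρ a1 a2 (semidirectBracket bg ρ a3 a4 a5)
            = semidirectBracket bg ρ (semidirectBracket bg ρ a1 a2 a3) a4 a5
              + semidirectBracket bg ρ a3 (semidirectBracket bg ρ a1 a2 a4) a5
              + semidirectBracket bg ρ a3 a4 (semidirectBracket bg ρ a1 a2 a5))) := by
  have skew : ∀ (x y : g) (v : V), ρ x y v = -ρ y x v := fun x y v => by
    rw [hρ x y, LinearMap.neg_apply]
  have diag : ∀ (x : g) (v : V), ρ x x v = 0 := fun x v =>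
    haveI : IsAddTorsionFree V := .of_isTorsionFree K V
    self_eq_neg.mp (skew x x v)
  constructor
  · rintro ⟨comm, deriv⟩
    refine ⟨?_, ?_⟩
    · rintro ⟨x, u⟩ ⟨y, v⟩ ⟨z, w⟩ h
      refine Prod.ext (hgalt x y z ?_) ?_
      · rcases h with h | h | h
        · exact Or.inl (congrArg Prod.fst h)
        · exact Or.inr (Or.inl (congrArg Prod.fst h))
        · exact Or.inr (Or.inr (congrArg Prod.fst h))
      · rcases h with h | h | h
        · obtain ⟨rfl, rfl⟩ := Prod.mk.inj h
          simp [semidirectBracket, diag, skew z x]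
        · obtain ⟨rfl, rfl⟩ := Prod.mk.inj h
          simp [semidirectBracket, diag, skew y x]
        · obtain ⟨rfl, rfl⟩ := Prod.mk.inj h
          simp [semidirectBracket, diag, skew y x]
    · rintro ⟨x1, v1⟩ ⟨x2, v2⟩ ⟨x3, v3⟩ ⟨x4, v4⟩ ⟨x5, v5⟩
      refine Prod.ext (hgfi x1 x2 x3 x4 x5) ?_
      simp only [semidirectBracket, Prod.snd_add, map_add]
      rw [comm x1 x2 x3 x4 v5, comm x1 x2 x4 x5 v3, comm x1 x2 x5 x3 v4,
        deriv x2 x3 x4 x5 v1, skew (bg x3 x4 x5) x1 v2, deriv x1 x3 x4 x5 v2]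
      simp only [skew x3 x1 v2, skew x4 x1 v2, skew x5 x1 v2,
        skew x5 x3 (ρ x1 x2 v4), skew x5 x3 (ρ x2 x4 v1),
        skew x5 x3 (-ρ x1 x4 v2), map_neg]
      abel
  · rintro ⟨-, fi⟩
    refine ⟨fun x1 x2 x3 x4 v => ?_, fun x1 x2 x3 x4 v => ?_⟩
    · simpa [semidirectBracket] using
        congrArg Prod.snd (fi (x1, 0) (x2, 0) (x3, 0) (x4, 0) (0, v))
    · have h := congrArg Prod.snd (fi (0, v) (x1, 0) (x2, 0) (x3, 0) (x4, 0))
      simp only [semidirectBracket, Prod.snd_add, map_zero, LinearMap.zero_apply, zero_add,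
        add_zero] at h
      rw [h, skew x4 x2, sub_eq_add_neg]
end

section
/- For any 3-Lie algebra g over a field K of characteristic 0, the exterior square ∧²g equipped with the fundamental bracket [x1∧x2, y1∧y2]_F = [x1,x2,y1]_g ∧ y2 + y1 ∧ [x1,x2,y2]_g is a Leibniz algebra, i.e. [X,[Y,Z]_F]_F = [[X,Y]_F,Z]_F + [Y,[X,Z]_F]_F for all X,Y,Z ∈ ∧²g. -/
/-- The simple wedge `x ∧ y` in the second exterior power `⋀[K]^2 g`. -/
noncomputable def wedge2 (K : Type*) [Field K] {g : Type*} [AddCommGroup g] [Module K g]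
    (x y : g) : ⋀[K]^2 g :=
  ⟨ExteriorAlgebra.ιMulti K 2 ![x, y], ExteriorAlgebra.ιMulti_range K 2 (Set.mem_range_self _)⟩

namespace wedge2

variable {K : Type*} [Field K] {g : Type*} [AddCommGroup g] [Module K g]

theorem eq_ιMulti (x y : g) : wedge2 K x y = exteriorPower.ιMulti K 2 ![x, y] := rfl

theorem add_left (x x' y : g) : wedge2 K (x + x') y = wedge2 K x y + wedge2 K x' y := by
  have update_zero (z : g) : Function.update ![x, y] 0 z = ![z, y] := by
    ext i
    fin_cases i <;> rfl
  have h := (exteriorPower.ιMulti K 2).map_update_add ![x, y] 0 x x'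
  rwa [update_zero, update_zero, update_zero] at h

theorem add_right (x y y' : g) : wedge2 K x (y + y') = wedge2 K x y + wedge2 K x y' := by
  have update_one (z : g) : Function.update ![x, y] 1 z = ![x, z] := by
    ext i
    fin_cases i <;> rfl
  have h := (exteriorPower.ιMulti K 2).map_update_add ![x, y] 1 y y'
  rwa [update_one, update_one, update_one] at h

theorem span_range : Submodule.span K (Set.range fun p : g × g => wedge2 K p.1 p.2) = ⊤ := by
  rw [eq_top_iff, ← exteriorPower.ιMulti_span, Submodule.span_le]
  rintro _ ⟨v, rfl⟩
  refine Submodule.subset_span ⟨(v 0, v 1), ?_⟩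
  simp only [eq_ιMulti]
  congr 1
  ext i
  fin_cases i <;> rfl

/-- A property of the exterior square closed under linear combinations holds if it holds on
simple wedges. -/
theorem induction_on {p : ⋀[K]^2 g → Prop} (wedge : ∀ x y, p (wedge2 K x y)) (zero : p 0)
    (add : ∀ X Y, p X → p Y → p (X + Y)) (smul : ∀ (a : K) X, p X → p (a • X))
    (X : ⋀[K]^2 g) : p X := by
  have hX : X ∈ Submodule.span K (Set.range fun p : g × g => wedge2 K p.1 p.2) := by
    rw [span_range]
    trivial
  induction hX using Submodule.span_induction with
  | mem _ h => obtain ⟨q, rfl⟩ := h; exact wedge q.1 q.2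
  | zero => exact zero
  | add X Y _ _ hX hY => exact add X Y hX hY
  | smul a X _ hX => exact smul a X hX

end wedge2

/-- for a 3-Lie algebra `g`, the fundamental bracket
`[x1∧x2, y1∧y2]_F = [x1,x2,y1]∧y2 + y1∧[x1,x2,y2]` makes `⋀² g` a (left) Leibniz algebra. -/
theorem exteriorSquare_fundamental_bracket_leibniz {K : Type*} [Field K] [CharZero K]
    {g : Type*} [AddCommGroup g] [Module K g]
    (b : g →ₗ[K] g →ₗ[K] g →ₗ[K] g)
    (halt : ∀ x y z : g, x = y ∨ y = z ∨ x = z → b x y z = 0)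
    (hfi : ∀ x1 x2 x3 x4 x5 : g,
      b x1 x2 (b x3 x4 x5)
        = b (b x1 x2 x3) x4 x5 + b x3 (b x1 x2 x4) x5 + b x3 x4 (b x1 x2 x5))
    (F : ⋀[K]^2 g →ₗ[K] ⋀[K]^2 g →ₗ[K] ⋀[K]^2 g)
    (hF : ∀ x1 x2 y1 y2 : g,
      F (wedge2 K x1 x2) (wedge2 K y1 y2)
        = wedge2 K (b x1 x2 y1) y2 + wedge2 K y1 (b x1 x2 y2)) :
    ∀ X Y Z : ⋀[K]^2 g, F X (F Y Z) = F (F X Y) Z + F Y (F X Z) := by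
  intro X Y Z
  induction X using wedge2.induction_on with
  | zero => simp
  | add X X' h h' => simp only [map_add, LinearMap.add_apply, h, h']; abel
  | smul a X h => simp only [map_smul, LinearMap.smul_apply, h, smul_add]
  | wedge x1 x2 =>
  induction Y using wedge2.induction_on with
  | zero => simp
  | add Y Y' h h' => simp only [map_add, LinearMap.add_apply, h, h']; abel
  | smul a Y h => simp only [map_smul, LinearMap.smul_apply, h, smul_add]
  | wedge y1 y2 =>
  induction Z using wedge2.induction_on with
  | zero => simp
  | add Z Z' h h' => simp only [map_add, h, h']; abel
  | smul a Z h => simp only [map_smul, h, smul_add]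
  | wedge z1 z2 =>
  simp only [hF, map_add, LinearMap.add_apply, hfi x1 x2 y1 y2, wedge2.add_left,
    wedge2.add_right]
  abel
end

section
/- Let (g,[·,·,·]_g) and (h,[·,·,·]_h) be 3-Lie algebras over a field K of characteristic 0, and let ρ, ν, ω be as in the extension data. Then (g⊕h, [·,·,·]_{(ρ,ν,ω)}) is a 3-Lie algebra if and only if for all x1,…,x5 ∈ g and v1,…,v5 ∈ h the following eleven identities hold: (1) ω(x1,x2,[x3,x4,x5]_g) + ρ(x1,x2)ω(x3,x4,x5) − ω([x1,x2,x3]_g,x4,x5) − ρ(x4,x5)ω(x1,x2,x3) − ω(x3,[x1,x2,x4]_g,x5) + ρ(x3,x5)ω(x1,x2,x4) − ω(x3,x4,[x1,x2,x5]_g) − ρ(x3,x4)ω(x1,x2,x5) = 0; (2) ρ(x1,x2)(ρ(x3,x4)v5) − ρ([x1,x2,x3]_g,x4)v5 + ν(x4)(ω(x1,x2,x3),v5) − ρ(x3,[x1,x2,x4]_g)v5 − ν(x3)(ω(x1,x2,x4),v5) − ρ(x3,x4)(ρ(x1,x2)v5) = 0; (3) −ρ(x1,[x3,x4,x5]_g)v2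 + ν(x1)(v2,ω(x3,x4,x5)) + ρ(x4,x5)(ρ(x1,x3)v2) − ρ(x3,x5)(ρ(x1,x4)v2) + ρ(x3,x4)(ρ(x1,x5)v2) = 0; (4) ρ(x1,x2)(ν(x3)(v4,v5)) − ν([x1,x2,x3]_g)(v4,v5) − [ω(x1,x2,x3),v4,v5]_h − ν(x3)(ρ(x1,x2)v4,v5) − ν(x3)(v4,ρ(x1,x2)v5) = 0; (5) ν(x1)(v2,ρ(x3,x4)v5) − ν(x4)(ρ(x1,x3)v2,v5) + ν(x3)(ρ(x1,x4)v2,v5) − ρ(x3,x4)(ν(x1)(v2,v5)) = 0; (6) ν([x3,x4,x5]_g)(v1,v2) + [v1,v2,ω(x3,x4,x5)]_h − ρ(x4,x5)(ν(x3)(v1,v2)) + ρ(x3,x5)(ν(x4)(v1,v2)) − ρ(x3,x4)(ν(x5)(v1,v2)) = 0; (7) ρ(x1,x2)[v3,v4,v5]_h − [ρ(x1,x2)v3,v4,v5]_h − [v3,ρ(x1,x2)v4,v5]_h − [v3,v4,ρ(x1,x2)v5]_h = 0; (8) ν(x1)(v2,ν(x3)(v4,v5)) + [ρ(x1,x3)v2,v4,v5]_h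 − ν(x3)(ν(x1)(v2,v4),v5) − ν(x3)(v4,ν(x1)(v2,v5)) = 0; (9) [v1,v2,ρ(x3,x4)v5]_h + ν(x4)(ν(x3)(v1,v2),v5) − ν(x3)(ν(x4)(v1,v2),v5) − ρ(x3,x4)[v1,v2,v5]_h = 0; (10) ν(x1)(v2,[v3,v4,v5]_h) − [ν(x1)(v2,v3),v4,v5]_h − [v3,ν(x1)(v2,v4),v5]_h − [v3,v4,ν(x1)(v2,v5)]_h = 0; (11) [v1,v2,ν(x3)(v4,v5)]_h − [ν(x3)(v1,v2),v4,v5]_h − ν(x3)([v1,v2,v4]_h,v5) − ν(x3)(v4,[v1,v2,v5]_h) = 0. -/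
/-- The bracket `[·,·,·]_{(ρ,ν,ω)}` on `g ⊕ h` built from extension data. -/
def extBracket {K : Type*} [Field K]
    {g h : Type*} [AddCommGroup g] [Module K g] [AddCommGroup h] [Module K h]
    (bg : g →ₗ[K] g →ₗ[K] g →ₗ[K] g) (bh : h →ₗ[K] h →ₗ[K] h →ₗ[K] h)
    (ρ : g →ₗ[K] g →ₗ[K] Module.End K h)
    (ν : g →ₗ[K] h →ₗ[K] h →ₗ[K] h)
    (ω : g →ₗ[K] g →ₗ[K] g →ₗ[K] h) :
    g × h → g × h → g × h → g × h :=
  fun a b c =>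
    (bg a.1 b.1 c.1,
      ω a.1 b.1 c.1 + ρ a.1 b.1 c.2 + ρ b.1 c.1 a.2 + ρ c.1 a.1 b.2
        + ν a.1 b.2 c.2 + ν b.1 c.2 a.2 + ν c.1 a.2 b.2 + bh a.2 b.2 c.2)

section FundamentalIdentity

variable {M : Type*} [AddCommGroup M]

/-- The failure of a ternary operation to satisfy the fundamental identity. -/
def fundamentalDefect (T : M → M → M → M) (a b c d e : M) : M :=
  T a b (T c d e) - (T (T a b c) d e + T c (T a b d) e + T c d (T a b e))

theorem fundamentalDefect_eq_zero_iff {T : M → M → M → M} {a b c d e : M} :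
    fundamentalDefect T a b c d e = 0 ↔
      T a b (T c d e) = T (T a b c) d e + T c (T a b d) e + T c d (T a b e) :=
  sub_eq_zero

theorem forall_of_sorted_pair {g h : Type*} [AddCommGroup g] [AddCommGroup h]
    {Q : g × h → g × h → Prop} (swap : ∀ a b, Q a b → Q b a)
    (add_last : ∀ a b b', Q a b → Q a b' → Q a (b + b'))
    (hgg : ∀ x y, Q (x, 0) (y, 0)) (hgh : ∀ x v, Q (x, 0) (0, v))
    (hhh : ∀ u v, Q (0, u) (0, v)) (a b : g × h) : Q a b := by
  have split (a) (hg : ∀ x, Q a (x, 0)) (hh : ∀ v, Q a (0, v)) (b) : Q a b := by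
    simpa using add_last a _ _ (hg b.1) (hh b.2)
  exact split a (fun y => swap _ _ (split _ (fun _ => hgg _ _) (fun _ => hgh _ _) a))
    (fun v => swap _ _ (split _ (fun _ => swap _ _ (hgh _ _)) (fun _ => hhh _ _) a)) b

theorem forall_of_sorted_triple {g h : Type*} [AddCommGroup g] [AddCommGroup h]
    {Q : g × h → g × h → g × h → Prop} (swap_left : ∀ a b c, Q a b c → Q b a c)
    (swap_right : ∀ a b c, Q a b c → Q a c b)
    (add_last : ∀ a b c c', Q a b c → Q a b c' → Q a b (c + c'))
    (hggg : ∀ x y z, Q (x, 0) (y, 0) (z, 0)) (hggh : ∀ x y v, Q (x, 0) (y, 0) (0, v))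
    (hghh : ∀ x u v, Q (x, 0) (0, u) (0, v)) (hhhh : ∀ u v w, Q (0, u) (0, v) (0, w))
    (a b c : g × h) : Q a b c := by
  have hg (x : g) : ∀ b c, Q (x, 0) b c :=
    forall_of_sorted_pair (swap_right _) (add_last _) (hggg x) (hggh x) (hghh x)
  have hh (v : h) : ∀ b c, Q (0, v) b c :=
    forall_of_sorted_pair (swap_right _) (add_last _)
      (fun x y => swap_left _ _ _ (hg x _ _)) (fun x u => swap_left _ _ _ (hg x _ _)) (hhhh v)
  have rotate (a b c) (H : Q a b c) : Q b c a := swap_right _ _ _ (swap_left _ _ _ H)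
  simpa using rotate _ _ _ (rotate _ _ _
    (add_last _ _ _ _ (rotate _ _ _ (hg a.1 b c)) (rotate _ _ _ (hh a.2 b c))))

variable {T : M → M → M → M}

theorem fundamentalDefect_swap_outer (swap_left : ∀ a b c, T b a c = -T a b c)
    (neg_left : ∀ a b c, T (-a) b c = -T a b c) (neg_mid : ∀ a b c, T a (-b) c = -T a b c)
    (neg_right : ∀ a b c, T a b (-c) = -T a b c) (a b c d e : M) :
    fundamentalDefect T b a c d e = -fundamentalDefect T a b c d e := by
  simp only [fundamentalDefect, swap_left a b, neg_left, neg_mid, neg_right]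
  abel

theorem fundamentalDefect_swap_inner_left (swap_left : ∀ a b c, T b a c = -T a b c)
    (neg_right : ∀ a b c, T a b (-c) = -T a b c) (a b c d e : M) :
    fundamentalDefect T a b d c e = -fundamentalDefect T a b c d e := by
  simp only [fundamentalDefect, swap_left c d, swap_left c (T a b d),
    swap_left (T a b c) d, neg_right]
  abel

theorem fundamentalDefect_swap_inner_right (swap_right : ∀ a b c, T a c b = -T a b c)
    (neg_right : ∀ a b c, T a b (-c) = -T a b c) (a b c d e : M) :
    fundamentalDefect T a b c e d = -fundamentalDefect T a b c d e := by
  simp only [fundamentalDefect, swap_right _ d e, swap_right _ d (T a b e),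
    swap_right _ (T a b d) e, neg_right]
  abel

theorem fundamentalDefect_add_second
    (add_left : ∀ a a' b c, T (a + a') b c = T a b c + T a' b c)
    (add_mid : ∀ a b b' c, T a (b + b') c = T a b c + T a b' c)
    (add_right : ∀ a b c c', T a b (c + c') = T a b c + T a b c') (a b b' c d e : M) :
    fundamentalDefect T a (b + b') c d e
      = fundamentalDefect T a b c d e + fundamentalDefect T a b' c d e := by
  simp only [fundamentalDefect, add_left, add_mid, add_right]
  abel

theorem fundamentalDefect_add_fifth
    (add_right : ∀ a b c c', T a b (c + c') = T a b c + T a b c') (a b c d e e' : M) :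
    fundamentalDefect T a b c d (e + e')
      = fundamentalDefect T a b c d e + fundamentalDefect T a b c d e' := by
  simp only [fundamentalDefect, add_right]
  abel

end FundamentalIdentity

section Trilinear

variable {K M N : Type*} [Field K] [AddCommGroup M] [Module K M] [AddCommGroup N] [Module K N]
  {f : M →ₗ[K] M →ₗ[K] M →ₗ[K] N}

theorem trilinear_swap_left (hf : ∀ x y z, x = y ∨ y = z ∨ x = z → f x y z = 0) (x y z : M) :
    f y x z = -f x y z := by
  have key := hf (x + y) (x + y) z (Or.inl rfl)
  simp only [map_add, LinearMap.add_apply, hf x x z (Or.inl rfl), hf y y z (Or.inl rfl),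
    zero_add, add_zero] at key
  exact eq_neg_of_add_eq_zero_left key

theorem trilinear_swap_right (hf : ∀ x y z, x = y ∨ y = z ∨ x = z → f x y z = 0) (x y z : M) :
    f x z y = -f x y z := by
  have key := hf x (y + z) (y + z) (Or.inr (Or.inl rfl))
  simp only [map_add, LinearMap.add_apply, hf x y y (Or.inr (Or.inl rfl)),
    hf x z z (Or.inr (Or.inl rfl)), zero_add, add_zero] at key
  exact eq_neg_of_add_eq_zero_left key

end Trilinear

section ExtBracket

variable {K : Type*} [Field K]
  {g h : Type*} [AddCommGroup g] [Module K g] [AddCommGroup h] [Module K h]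
  {bg : g →ₗ[K] g →ₗ[K] g →ₗ[K] g} {bh : h →ₗ[K] h →ₗ[K] h →ₗ[K] h}
  {ρ : g →ₗ[K] g →ₗ[K] Module.End K h} {ν : g →ₗ[K] h →ₗ[K] h →ₗ[K] h}
  {ω : g →ₗ[K] g →ₗ[K] g →ₗ[K] h}

theorem extBracket_add_left (a a' b c : g × h) :
    extBracket bg bh ρ ν ω (a + a') b c
      = extBracket bg bh ρ ν ω a b c + extBracket bg bh ρ ν ω a' b c := by
  ext <;> simp [extBracket]
  abel

theorem extBracket_neg_left (a b c : g × h) :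
    extBracket bg bh ρ ν ω (-a) b c = -extBracket bg bh ρ ν ω a b c := by
  ext <;> simp [extBracket]
  abel

theorem extBracket_add_mid (a b b' c : g × h) :
    extBracket bg bh ρ ν ω a (b + b') c
      = extBracket bg bh ρ ν ω a b c + extBracket bg bh ρ ν ω a b' c := by
  ext <;> simp [extBracket]
  abel

theorem extBracket_neg_mid (a b c : g × h) :
    extBracket bg bh ρ ν ω a (-b) c = -extBracket bg bh ρ ν ω a b c := by
  ext <;> simp [extBracket]
  abel

theorem extBracket_add_right (a b c c' : g × h) :
    extBracket bg bh ρ ν ω a b (c + c')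
      = extBracket bg bh ρ ν ω a b c + extBracket bg bh ρ ν ω a b c' := by
  ext <;> simp [extBracket]
  abel

theorem extBracket_neg_right (a b c : g × h) :
    extBracket bg bh ρ ν ω a b (-c) = -extBracket bg bh ρ ν ω a b c := by
  ext <;> simp [extBracket]
  abel

theorem extBracket_swap_left
    (hgalt : ∀ x y z : g, x = y ∨ y = z ∨ x = z → bg x y z = 0)
    (hhalt : ∀ u v w : h, u = v ∨ v = w ∨ u = w → bh u v w = 0)
    (hρ : ∀ x y : g, ρ x y = -ρ y x) (hν : ∀ (x : g) (u v : h), ν x u v = -ν x v u)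
    (hω : ∀ x y z : g, x = y ∨ y = z ∨ x = z → ω x y z = 0) (a b c : g × h) :
    extBracket bg bh ρ ν ω b a c = -extBracket bg bh ρ ν ω a b c := by
  ext
  · exact trilinear_swap_left hgalt _ _ _
  · simp only [extBracket, Prod.snd_neg, trilinear_swap_left hω a.1 b.1,
      trilinear_swap_left hhalt a.2 b.2, hρ b.1 a.1, hρ a.1 c.1, hρ c.1 b.1,
      hν b.1 a.2 c.2, hν a.1 c.2 b.2, hν c.1 b.2 a.2, LinearMap.neg_apply]
    abel

theorem extBracket_swap_right
    (hgalt : ∀ x y z : g, x = y ∨ y = z ∨ x = z → bg x y z = 0)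
    (hhalt : ∀ u v w : h, u = v ∨ v = w ∨ u = w → bh u v w = 0)
    (hρ : ∀ x y : g, ρ x y = -ρ y x) (hν : ∀ (x : g) (u v : h), ν x u v = -ν x v u)
    (hω : ∀ x y z : g, x = y ∨ y = z ∨ x = z → ω x y z = 0) (a b c : g × h) :
    extBracket bg bh ρ ν ω a c b = -extBracket bg bh ρ ν ω a b c := by
  ext
  · exact trilinear_swap_right hgalt _ _ _
  · simp only [extBracket, Prod.snd_neg, trilinear_swap_right hω a.1 b.1,
      trilinear_swap_right hhalt a.2 b.2, hρ b.1 a.1, hρ a.1 c.1, hρ c.1 b.1,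
      hν b.1 a.2 c.2, hν a.1 c.2 b.2, hν c.1 b.2 a.2, LinearMap.neg_apply]
    abel

theorem extBracket_alternating [CharZero K]
    (hgalt : ∀ x y z : g, x = y ∨ y = z ∨ x = z → bg x y z = 0)
    (hhalt : ∀ u v w : h, u = v ∨ v = w ∨ u = w → bh u v w = 0)
    (hρ : ∀ x y : g, ρ x y = -ρ y x) (hν : ∀ (x : g) (u v : h), ν x u v = -ν x v u)
    (hω : ∀ x y z : g, x = y ∨ y = z ∨ x = z → ω x y z = 0) (a b c : g × h)
    (habc : a = b ∨ b = c ∨ a = c) : extBracket bg bh ρ ν ω a b c = 0 := by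
  have skew_left := extBracket_swap_left hgalt hhalt hρ hν hω
  have skew_right := extBracket_swap_right hgalt hhalt hρ hν hω
  have eq_zero {m : g × h} (hm : m = -m) : m = 0 := by
    have key : (2 : K) • m = 0 := by rw [two_smul, ← eq_neg_iff_add_eq_zero, ← hm]
    exact (smul_eq_zero.mp key).resolve_left two_ne_zero
  rcases habc with rfl | rfl | rfl
  · exact eq_zero (skew_left _ _ _)
  · exact eq_zero (skew_right _ _ _)
  · rw [skew_right, neg_eq_zero]
    exact eq_zero (skew_left _ _ _)

theorem fundamentalDefect_extBracket_ggggg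
    (hgfi : ∀ x1 x2 x3 x4 x5 : g,
      bg x1 x2 (bg x3 x4 x5)
        = bg (bg x1 x2 x3) x4 x5 + bg x3 (bg x1 x2 x4) x5 + bg x3 x4 (bg x1 x2 x5))
    (hρ : ∀ x y : g, ρ x y = -ρ y x)
    (x1 x2 x3 x4 x5 : g) :
    fundamentalDefect (extBracket bg bh ρ ν ω) (x1, 0) (x2, 0) (x3, 0) (x4, 0) (x5, 0) = (0,
      ω x1 x2 (bg x3 x4 x5) + ρ x1 x2 (ω x3 x4 x5) - ω (bg x1 x2 x3) x4 x5
        - ρ x4 x5 (ω x1 x2 x3) - ω x3 (bg x1 x2 x4) x5 + ρ x3 x5 (ω x1 x2 x4)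
        - ω x3 x4 (bg x1 x2 x5) - ρ x3 x4 (ω x1 x2 x5)) := by
  ext
  · simp [fundamentalDefect, extBracket, hgfi x1 x2 x3]
  · simp [fundamentalDefect, extBracket, hρ x5 x3]
    abel

theorem fundamentalDefect_extBracket_ggggh
    (hν : ∀ (x : g) (u v : h), ν x u v = -ν x v u)
    (x1 x2 x3 x4 : g) (v5 : h) :
    fundamentalDefect (extBracket bg bh ρ ν ω) (x1, 0) (x2, 0) (x3, 0) (x4, 0) (0, v5) = (0,
      ρ x1 x2 (ρ x3 x4 v5) - ρ (bg x1 x2 x3) x4 v5 + ν x4 (ω x1 x2 x3) v5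
        - ρ x3 (bg x1 x2 x4) v5 - ν x3 (ω x1 x2 x4) v5 - ρ x3 x4 (ρ x1 x2 v5)) := by
  ext
  · simp [fundamentalDefect, extBracket]
  · simp [fundamentalDefect, extBracket, hν x4 v5]
    abel

theorem fundamentalDefect_extBracket_ghggg
    (hρ : ∀ x y : g, ρ x y = -ρ y x)
    (x1 x3 x4 x5 : g) (v2 : h) :
    fundamentalDefect (extBracket bg bh ρ ν ω) (x1, 0) (0, v2) (x3, 0) (x4, 0) (x5, 0) = (0,
      - ρ x1 (bg x3 x4 x5) v2 + ν x1 v2 (ω x3 x4 x5) + ρ x4 x5 (ρ x1 x3 v2)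
        - ρ x3 x5 (ρ x1 x4 v2) + ρ x3 x4 (ρ x1 x5 v2)) := by
  ext
  · simp [fundamentalDefect, extBracket]
  · simp [fundamentalDefect, extBracket, hρ (bg x3 x4 x5) x1, hρ x3 x1, hρ x4 x1,
      hρ x5 x1, hρ x5 x3]
    abel

theorem fundamentalDefect_extBracket_ggghh
    (x1 x2 x3 : g) (v4 v5 : h) :
    fundamentalDefect (extBracket bg bh ρ ν ω) (x1, 0) (x2, 0) (x3, 0) (0, v4) (0, v5) = (0,
      ρ x1 x2 (ν x3 v4 v5) - ν (bg x1 x2 x3) v4 v5 - bh (ω x1 x2 x3) v4 v5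
        - ν x3 (ρ x1 x2 v4) v5 - ν x3 v4 (ρ x1 x2 v5)) := by
  ext
  · simp [fundamentalDefect, extBracket]
  · simp [fundamentalDefect, extBracket]
    abel

theorem fundamentalDefect_extBracket_ghggh
    (hρ : ∀ x y : g, ρ x y = -ρ y x)
    (hν : ∀ (x : g) (u v : h), ν x u v = -ν x v u)
    (x1 x3 x4 : g) (v2 v5 : h) :
    fundamentalDefect (extBracket bg bh ρ ν ω) (x1, 0) (0, v2) (x3, 0) (x4, 0) (0, v5) = (0,
      ν x1 v2 (ρ x3 x4 v5) - ν x4 (ρ x1 x3 v2) v5 + ν x3 (ρ x1 x4 v2) v5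
        - ρ x3 x4 (ν x1 v2 v5)) := by
  ext
  · simp [fundamentalDefect, extBracket]
  · simp [fundamentalDefect, extBracket, hρ x3 x1, hρ x4 x1, hν x4 v5]
    abel

theorem fundamentalDefect_extBracket_hhggg
    (hρ : ∀ x y : g, ρ x y = -ρ y x)
    (x3 x4 x5 : g) (v1 v2 : h) :
    fundamentalDefect (extBracket bg bh ρ ν ω) (0, v1) (0, v2) (x3, 0) (x4, 0) (x5, 0) = (0,
      ν (bg x3 x4 x5) v1 v2 + bh v1 v2 (ω x3 x4 x5) - ρ x4 x5 (ν x3 v1 v2)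
        + ρ x3 x5 (ν x4 v1 v2) - ρ x3 x4 (ν x5 v1 v2)) := by
  ext
  · simp [fundamentalDefect, extBracket]
  · simp [fundamentalDefect, extBracket, hρ x5 x3]
    abel

theorem fundamentalDefect_extBracket_gghhh
    (x1 x2 : g) (v3 v4 v5 : h) :
    fundamentalDefect (extBracket bg bh ρ ν ω) (x1, 0) (x2, 0) (0, v3) (0, v4) (0, v5) = (0,
      ρ x1 x2 (bh v3 v4 v5) - bh (ρ x1 x2 v3) v4 v5 - bh v3 (ρ x1 x2 v4) v5
        - bh v3 v4 (ρ x1 x2 v5)) := by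
  ext
  · simp [fundamentalDefect, extBracket]
  · simp [fundamentalDefect, extBracket]
    abel

theorem fundamentalDefect_extBracket_ghghh
    (hρ : ∀ x y : g, ρ x y = -ρ y x)
    (x1 x3 : g) (v2 v4 v5 : h) :
    fundamentalDefect (extBracket bg bh ρ ν ω) (x1, 0) (0, v2) (x3, 0) (0, v4) (0, v5) = (0,
      ν x1 v2 (ν x3 v4 v5) + bh (ρ x1 x3 v2) v4 v5 - ν x3 (ν x1 v2 v4) v5
        - ν x3 v4 (ν x1 v2 v5)) := by
  ext
  · simp [fundamentalDefect, extBracket]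
  · simp [fundamentalDefect, extBracket, hρ x3 x1]
    abel

theorem fundamentalDefect_extBracket_hhggh
    (hν : ∀ (x : g) (u v : h), ν x u v = -ν x v u)
    (x3 x4 : g) (v1 v2 v5 : h) :
    fundamentalDefect (extBracket bg bh ρ ν ω) (0, v1) (0, v2) (x3, 0) (x4, 0) (0, v5) = (0,
      bh v1 v2 (ρ x3 x4 v5) + ν x4 (ν x3 v1 v2) v5 - ν x3 (ν x4 v1 v2) v5
        - ρ x3 x4 (bh v1 v2 v5)) := by
  ext
  · simp [fundamentalDefect, extBracket]
  · simp [fundamentalDefect, extBracket, hν x4 v5]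
    abel

theorem fundamentalDefect_extBracket_ghhhh
    (x1 : g) (v2 v3 v4 v5 : h) :
    fundamentalDefect (extBracket bg bh ρ ν ω) (x1, 0) (0, v2) (0, v3) (0, v4) (0, v5) = (0,
      ν x1 v2 (bh v3 v4 v5) - bh (ν x1 v2 v3) v4 v5 - bh v3 (ν x1 v2 v4) v5
        - bh v3 v4 (ν x1 v2 v5)) := by
  ext
  · simp [fundamentalDefect, extBracket]
  · simp [fundamentalDefect, extBracket]
    abel

theorem fundamentalDefect_extBracket_hhghh
    (x3 : g) (v1 v2 v4 v5 : h) :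
    fundamentalDefect (extBracket bg bh ρ ν ω) (0, v1) (0, v2) (x3, 0) (0, v4) (0, v5) = (0,
      bh v1 v2 (ν x3 v4 v5) - bh (ν x3 v1 v2) v4 v5 - ν x3 (bh v1 v2 v4) v5
        - ν x3 v4 (bh v1 v2 v5)) := by
  ext
  · simp [fundamentalDefect, extBracket]
  · simp [fundamentalDefect, extBracket]
    abel

theorem fundamentalDefect_extBracket_hhhhh
    (hhfi : ∀ v1 v2 v3 v4 v5 : h,
      bh v1 v2 (bh v3 v4 v5)
        = bh (bh v1 v2 v3) v4 v5 + bh v3 (bh v1 v2 v4) v5 + bh v3 v4 (bh v1 v2 v5))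
    (v1 v2 v3 v4 v5 : h) :
    fundamentalDefect (extBracket bg bh ρ ν ω) (0, v1) (0, v2) (0, v3) (0, v4) (0, v5) = 0 := by
  ext <;> simp [fundamentalDefect, extBracket, hhfi v1 v2 v3]

end ExtBracket

/-- `(g ⊕ h, [·,·,·]_{(ρ,ν,ω)})` is a 3-Lie algebra iff the eleven
compatibility identities on `ρ, ν, ω` hold. -/
theorem extBracket_threeLie_iff {K : Type*} [Field K] [CharZero K]
    {g h : Type*} [AddCommGroup g] [Module K g] [AddCommGroup h] [Module K h]
    (bg : g →ₗ[K] g →ₗ[K] g →ₗ[K] g) (bh : h →ₗ[K] h →ₗ[K] h →ₗ[K] h)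
    (hgalt : ∀ x y z : g, x = y ∨ y = z ∨ x = z → bg x y z = 0)
    (hgfi : ∀ x1 x2 x3 x4 x5 : g,
      bg x1 x2 (bg x3 x4 x5)
        = bg (bg x1 x2 x3) x4 x5 + bg x3 (bg x1 x2 x4) x5 + bg x3 x4 (bg x1 x2 x5))
    (hhalt : ∀ u v w : h, u = v ∨ v = w ∨ u = w → bh u v w = 0)
    (hhfi : ∀ v1 v2 v3 v4 v5 : h,
      bh v1 v2 (bh v3 v4 v5)
        = bh (bh v1 v2 v3) v4 v5 + bh v3 (bh v1 v2 v4) v5 + bh v3 v4 (bh v1 v2 v5))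
    (ρ : g →ₗ[K] g →ₗ[K] Module.End K h) (hρ : ∀ x y : g, ρ x y = - ρ y x)
    (ν : g →ₗ[K] h →ₗ[K] h →ₗ[K] h) (hν : ∀ (x : g) (u v : h), ν x u v = - ν x v u)
    (ω : g →ₗ[K] g →ₗ[K] g →ₗ[K] h)
    (hω : ∀ x y z : g, x = y ∨ y = z ∨ x = z → ω x y z = 0) :
    ((∀ a b c : g × h, a = b ∨ b = c ∨ a = c → extBracket bg bh ρ ν ω a b c = 0) ∧
     (∀ a1 a2 a3 a4 a5 : g × h,
        extBracket bg bh ρ ν ω a1 a2 (extBracket bg bh ρ ν ω a3 a4 a5)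
          = extBracket bg bh ρ ν ω (extBracket bg bh ρ ν ω a1 a2 a3) a4 a5
            + extBracket bg bh ρ ν ω a3 (extBracket bg bh ρ ν ω a1 a2 a4) a5
            + extBracket bg bh ρ ν ω a3 a4 (extBracket bg bh ρ ν ω a1 a2 a5)))
    ↔ ((∀ x1 x2 x3 x4 x5 : g,
          ω x1 x2 (bg x3 x4 x5) + ρ x1 x2 (ω x3 x4 x5) - ω (bg x1 x2 x3) x4 x5
            - ρ x4 x5 (ω x1 x2 x3) - ω x3 (bg x1 x2 x4) x5 + ρ x3 x5 (ω x1 x2 x4)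
            - ω x3 x4 (bg x1 x2 x5) - ρ x3 x4 (ω x1 x2 x5) = 0) ∧
       (∀ (x1 x2 x3 x4 : g) (v5 : h),
          ρ x1 x2 (ρ x3 x4 v5) - ρ (bg x1 x2 x3) x4 v5 + ν x4 (ω x1 x2 x3) v5
            - ρ x3 (bg x1 x2 x4) v5 - ν x3 (ω x1 x2 x4) v5 - ρ x3 x4 (ρ x1 x2 v5) = 0) ∧
       (∀ (x1 x3 x4 x5 : g) (v2 : h),
          - ρ x1 (bg x3 x4 x5) v2 + ν x1 v2 (ω x3 x4 x5) + ρ x4 x5 (ρ x1 x3 v2)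
            - ρ x3 x5 (ρ x1 x4 v2) + ρ x3 x4 (ρ x1 x5 v2) = 0) ∧
       (∀ (x1 x2 x3 : g) (v4 v5 : h),
          ρ x1 x2 (ν x3 v4 v5) - ν (bg x1 x2 x3) v4 v5 - bh (ω x1 x2 x3) v4 v5
            - ν x3 (ρ x1 x2 v4) v5 - ν x3 v4 (ρ x1 x2 v5) = 0) ∧
       (∀ (x1 x3 x4 : g) (v2 v5 : h),
          ν x1 v2 (ρ x3 x4 v5) - ν x4 (ρ x1 x3 v2) v5 + ν x3 (ρ x1 x4 v2) v5
            - ρ x3 x4 (ν x1 v2 v5) = 0) ∧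
       (∀ (x3 x4 x5 : g) (v1 v2 : h),
          ν (bg x3 x4 x5) v1 v2 + bh v1 v2 (ω x3 x4 x5) - ρ x4 x5 (ν x3 v1 v2)
            + ρ x3 x5 (ν x4 v1 v2) - ρ x3 x4 (ν x5 v1 v2) = 0) ∧
       (∀ (x1 x2 : g) (v3 v4 v5 : h),
          ρ x1 x2 (bh v3 v4 v5) - bh (ρ x1 x2 v3) v4 v5 - bh v3 (ρ x1 x2 v4) v5
            - bh v3 v4 (ρ x1 x2 v5) = 0) ∧
       (∀ (x1 x3 : g) (v2 v4 v5 : h),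
          ν x1 v2 (ν x3 v4 v5) + bh (ρ x1 x3 v2) v4 v5 - ν x3 (ν x1 v2 v4) v5
            - ν x3 v4 (ν x1 v2 v5) = 0) ∧
       (∀ (x3 x4 : g) (v1 v2 v5 : h),
          bh v1 v2 (ρ x3 x4 v5) + ν x4 (ν x3 v1 v2) v5 - ν x3 (ν x4 v1 v2) v5
            - ρ x3 x4 (bh v1 v2 v5) = 0) ∧
       (∀ (x1 : g) (v2 v3 v4 v5 : h),
          ν x1 v2 (bh v3 v4 v5) - bh (ν x1 v2 v3) v4 v5 - bh v3 (ν x1 v2 v4) v5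
            - bh v3 v4 (ν x1 v2 v5) = 0) ∧
       (∀ (x3 : g) (v1 v2 v4 v5 : h),
          bh v1 v2 (ν x3 v4 v5) - bh (ν x3 v1 v2) v4 v5 - ν x3 (bh v1 v2 v4) v5
            - ν x3 v4 (bh v1 v2 v5) = 0)) := by
  simp only [← fundamentalDefect_eq_zero_iff]
  constructor
  · rintro ⟨-, H⟩
    have snd_eq_zero {a b c d e : g × h} {w : h}
        (hw : fundamentalDefect (extBracket bg bh ρ ν ω) a b c d e = (0, w)) : w = 0 :=
      congrArg Prod.snd (hw.symm.trans (H a b c d e))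
    exact ⟨fun x1 x2 x3 x4 x5 =>
        snd_eq_zero (fundamentalDefect_extBracket_ggggg hgfi hρ x1 x2 x3 x4 x5),
      fun x1 x2 x3 x4 v5 =>
        snd_eq_zero (fundamentalDefect_extBracket_ggggh hν x1 x2 x3 x4 v5),
      fun x1 x3 x4 x5 v2 =>
        snd_eq_zero (fundamentalDefect_extBracket_ghggg hρ x1 x3 x4 x5 v2),
      fun x1 x2 x3 v4 v5 =>
        snd_eq_zero (fundamentalDefect_extBracket_ggghh x1 x2 x3 v4 v5),
      fun x1 x3 x4 v2 v5 =>
        snd_eq_zero (fundamentalDefect_extBracket_ghggh hρ hν x1 x3 x4 v2 v5),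
      fun x3 x4 x5 v1 v2 =>
        snd_eq_zero (fundamentalDefect_extBracket_hhggg hρ x3 x4 x5 v1 v2),
      fun x1 x2 v3 v4 v5 =>
        snd_eq_zero (fundamentalDefect_extBracket_gghhh x1 x2 v3 v4 v5),
      fun x1 x3 v2 v4 v5 =>
        snd_eq_zero (fundamentalDefect_extBracket_ghghh hρ x1 x3 v2 v4 v5),
      fun x3 x4 v1 v2 v5 =>
        snd_eq_zero (fundamentalDefect_extBracket_hhggh hν x3 x4 v1 v2 v5),
      fun x1 v2 v3 v4 v5 =>
        snd_eq_zero (fundamentalDefect_extBracket_ghhhh x1 v2 v3 v4 v5),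
      fun x3 v1 v2 v4 v5 =>
        snd_eq_zero (fundamentalDefect_extBracket_hhghh x3 v1 v2 v4 v5)⟩
  · rintro ⟨hggggg, hggggh, hghggg, hggghh, hghggh, hhhggg, hgghhh, hghghh, hhhggh, hghhhh, hhhghh⟩
    refine ⟨extBracket_alternating hgalt hhalt hρ hν hω, ?_⟩
    have skew_left := extBracket_swap_left hgalt hhalt hρ hν hω
    have skew_right := extBracket_swap_right hgalt hhalt hρ hν hω
    have triple (a b : g × h) := forall_of_sorted_triple
      (Q := fun c d e => fundamentalDefect (extBracket bg bh ρ ν ω) a b c d e = 0)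
      (fun c d e H => by
        rw [fundamentalDefect_swap_inner_left skew_left extBracket_neg_right, H, neg_zero])
      (fun c d e H => by
        rw [fundamentalDefect_swap_inner_right skew_right extBracket_neg_right, H, neg_zero])
      (fun c d e e' H H' => by
        rw [fundamentalDefect_add_fifth extBracket_add_right, H, H', add_zero])
    refine forall_of_sorted_pair
      (Q := fun a b => ∀ c d e, fundamentalDefect (extBracket bg bh ρ ν ω) a b c d e = 0)
      (fun a b H c d e => by
        rw [fundamentalDefect_swap_outer skew_left extBracket_neg_left extBracket_neg_mid
          extBracket_neg_right, H, neg_zero])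
      (fun a b b' H H' c d e => by
        rw [fundamentalDefect_add_second extBracket_add_left extBracket_add_mid
          extBracket_add_right, H, H', add_zero])
      ?_ ?_ ?_
    · refine fun x1 x2 => triple _ _ ?_ ?_ ?_ ?_
      · exact fun x3 x4 x5 => by
          rw [fundamentalDefect_extBracket_ggggg hgfi hρ, hggggg, Prod.mk_zero_zero]
      · exact fun x3 x4 v5 => by
          rw [fundamentalDefect_extBracket_ggggh hν, hggggh, Prod.mk_zero_zero]
      · exact fun x3 v4 v5 => by
          rw [fundamentalDefect_extBracket_ggghh, hggghh, Prod.mk_zero_zero]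
      · exact fun v3 v4 v5 => by
          rw [fundamentalDefect_extBracket_gghhh, hgghhh, Prod.mk_zero_zero]
    · refine fun x1 v2 => triple _ _ ?_ ?_ ?_ ?_
      · exact fun x3 x4 x5 => by
          rw [fundamentalDefect_extBracket_ghggg hρ, hghggg, Prod.mk_zero_zero]
      · exact fun x3 x4 v5 => by
          rw [fundamentalDefect_extBracket_ghggh hρ hν, hghggh, Prod.mk_zero_zero]
      · exact fun x3 v4 v5 => by
          rw [fundamentalDefect_extBracket_ghghh hρ, hghghh, Prod.mk_zero_zero]
      · exact fun v3 v4 v5 => by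
          rw [fundamentalDefect_extBracket_ghhhh, hghhhh, Prod.mk_zero_zero]
    · refine fun v1 v2 => triple _ _ ?_ ?_ ?_ ?_
      · exact fun x3 x4 x5 => by
          rw [fundamentalDefect_extBracket_hhggg hρ, hhhggg, Prod.mk_zero_zero]
      · exact fun x3 x4 v5 => by
          rw [fundamentalDefect_extBracket_hhggh hν, hhhggh, Prod.mk_zero_zero]
      · exact fun x3 v4 v5 => by
          rw [fundamentalDefect_extBracket_hhghh, hhhghh, Prod.mk_zero_zero]
      · exact fundamentalDefect_extBracket_hhhhh hhfi v1 v2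
end

section
/- Let (g⊕h, [·,·,·]_{(ρ¹,ν¹,ω¹)}) and (g⊕h, [·,·,·]_{(ρ²,ν²,ω²)}) be two non-abelian extensions of the 3-Lie algebra g by the 3-Lie algebra h (i.e. both brackets define 3-Lie algebra structures on g⊕h). The two extensions are isomorphic — i.e. there exists a linear map θ: g⊕h → g⊕h that is a 3-Lie algebra morphism from [·,·,·]_{(ρ²,ν²,ω²)} to [·,·,·]_{(ρ¹,ν¹,ω¹)}, satisfies θ(v) = v for all v ∈ h, and pr_g∘θ = pr_g (pr_g the projection onto g) — if and only if there is a linear map ξ: g → h such that for all x1,x2,x3 ∈ g and v2,v3 ∈ h: (i) ν²(x1)(v2,v3) − ν¹(x1)(v2,v3) = −[ξ(x1),v2,v3]_h; (ii) ρ²(x1,x2)v3 − ρ¹(x1,x2)v3 = −ν¹(x1)(ξ(x2),v3) − ν¹(x2)(v3,ξ(x1)) + [ξ(x1),ξ(x2),v3]_h; (iii) ω²(x1,x2,x3) − ω¹(x1,x2,x3) = −ρ¹(x1,x2)ξ(x3) − ρ¹(x2,x3)ξ(x1) − ρ¹(x3,x1)ξ(x2) + ν¹(x1)(ξ(x2),ξ(x3))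 + ν¹(x2)(ξ(x3),ξ(x1)) + ν¹(x3)(ξ(x1),ξ(x2)) − [ξ(x1),ξ(x2),ξ(x3)]_h + ξ([x1,x2,x3]_g). -/
/-- A trilinear map vanishing whenever two arguments agree is invariant under cyclic shifts. -/
theorem trilinear_cyclic_of_alternating {K M N : Type*} [Field K]
    [AddCommGroup M] [Module K M] [AddCommGroup N] [Module K N]
    (f : M →ₗ[K] M →ₗ[K] M →ₗ[K] N)
    (hf : ∀ u v w : M, u = v ∨ v = w ∨ u = w → f u v w = 0) (u v w : M) :
    f u v w = f v w u := by
  have swap_left : f u v w + f v u w = 0 := by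
    have key := hf (u + v) (u + v) w (Or.inl rfl)
    simpa [hf u u w, hf v v w, add_comm] using key
  have swap_right : f v u w + f v w u = 0 := by
    have key := hf v (u + w) (u + w) (Or.inr (Or.inl rfl))
    simpa [hf v u u, hf v w w, add_comm] using key
  rw [eq_neg_of_add_eq_zero_left swap_left, eq_neg_of_add_eq_zero_left swap_right, neg_neg]

/-- two non-abelian extensions `(g⊕h, [·,·,·]_{(ρ¹,ν¹,ω¹)})` and
`(g⊕h, [·,·,·]_{(ρ²,ν²,ω²)})` are isomorphic iff there is a linear map `ξ : g → h`
satisfying the three compatibility equations. -/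
theorem extensions_isomorphic_iff {K : Type*} [Field K] [CharZero K]
    {g h : Type*} [AddCommGroup g] [Module K g] [AddCommGroup h] [Module K h]
    (bg : g →ₗ[K] g →ₗ[K] g →ₗ[K] g) (bh : h →ₗ[K] h →ₗ[K] h →ₗ[K] h)
    (hgalt : ∀ x y z : g, x = y ∨ y = z ∨ x = z → bg x y z = 0)
    (hgfi : ∀ x1 x2 x3 x4 x5 : g,
      bg x1 x2 (bg x3 x4 x5)
        = bg (bg x1 x2 x3) x4 x5 + bg x3 (bg x1 x2 x4) x5 + bg x3 x4 (bg x1 x2 x5))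
    (hhalt : ∀ u v w : h, u = v ∨ v = w ∨ u = w → bh u v w = 0)
    (hhfi : ∀ v1 v2 v3 v4 v5 : h,
      bh v1 v2 (bh v3 v4 v5)
        = bh (bh v1 v2 v3) v4 v5 + bh v3 (bh v1 v2 v4) v5 + bh v3 v4 (bh v1 v2 v5))
    (ρ1 ρ2 : g →ₗ[K] g →ₗ[K] Module.End K h)
    (hρ1 : ∀ x y : g, ρ1 x y = - ρ1 y x) (hρ2 : ∀ x y : g, ρ2 x y = - ρ2 y x)
    (ν1 ν2 : g →ₗ[K] h →ₗ[K] h →ₗ[K] h)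
    (hν1 : ∀ (x : g) (u v : h), ν1 x u v = - ν1 x v u)
    (hν2 : ∀ (x : g) (u v : h), ν2 x u v = - ν2 x v u)
    (ω1 ω2 : g →ₗ[K] g →ₗ[K] g →ₗ[K] h)
    (hω1 : ∀ x y z : g, x = y ∨ y = z ∨ x = z → ω1 x y z = 0)
    (hω2 : ∀ x y z : g, x = y ∨ y = z ∨ x = z → ω2 x y z = 0)
    -- both brackets define 3-Lie algebra structures on g ⊕ h:
    (hfi1 : ∀ a1 a2 a3 a4 a5 : g × h,
      extBracket bg bh ρ1 ν1 ω1 a1 a2 (extBracket bg bh ρ1 ν1 ω1 a3 a4 a5)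
        = extBracket bg bh ρ1 ν1 ω1 (extBracket bg bh ρ1 ν1 ω1 a1 a2 a3) a4 a5
          + extBracket bg bh ρ1 ν1 ω1 a3 (extBracket bg bh ρ1 ν1 ω1 a1 a2 a4) a5
          + extBracket bg bh ρ1 ν1 ω1 a3 a4 (extBracket bg bh ρ1 ν1 ω1 a1 a2 a5))
    (hfi2 : ∀ a1 a2 a3 a4 a5 : g × h,
      extBracket bg bh ρ2 ν2 ω2 a1 a2 (extBracket bg bh ρ2 ν2 ω2 a3 a4 a5)
        = extBracket bg bh ρ2 ν2 ω2 (extBracket bg bh ρ2 ν2 ω2 a1 a2 a3) a4 a5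
          + extBracket bg bh ρ2 ν2 ω2 a3 (extBracket bg bh ρ2 ν2 ω2 a1 a2 a4) a5
          + extBracket bg bh ρ2 ν2 ω2 a3 a4 (extBracket bg bh ρ2 ν2 ω2 a1 a2 a5)) :
    (∃ θ : (g × h) →ₗ[K] (g × h),
        (∀ a b c : g × h,
          θ (extBracket bg bh ρ2 ν2 ω2 a b c)
            = extBracket bg bh ρ1 ν1 ω1 (θ a) (θ b) (θ c)) ∧
        (∀ v : h, θ (0, v) = (0, v)) ∧
        (∀ e : g × h, (θ e).1 = e.1))
    ↔ (∃ ξ : g →ₗ[K] h,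
        (∀ (x1 : g) (v2 v3 : h),
          ν2 x1 v2 v3 - ν1 x1 v2 v3 = - bh (ξ x1) v2 v3) ∧
        (∀ (x1 x2 : g) (v3 : h),
          ρ2 x1 x2 v3 - ρ1 x1 x2 v3
            = - ν1 x1 (ξ x2) v3 - ν1 x2 v3 (ξ x1) + bh (ξ x1) (ξ x2) v3) ∧
        (∀ x1 x2 x3 : g,
          ω2 x1 x2 x3 - ω1 x1 x2 x3
            = - ρ1 x1 x2 (ξ x3) - ρ1 x2 x3 (ξ x1) - ρ1 x3 x1 (ξ x2)
              + ν1 x1 (ξ x2) (ξ x3) + ν1 x2 (ξ x3) (ξ x1) + ν1 x3 (ξ x1) (ξ x2)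
              - bh (ξ x1) (ξ x2) (ξ x3) + ξ (bg x1 x2 x3))) := by
  have cyc := trilinear_cyclic_of_alternating bh hhalt
  constructor
  · rintro ⟨θ, hθ, hθh, hθg⟩
    have split (x : g) (v : h) : θ (x, v) = (x, v + (θ (x, 0)).2) := by
      have hsum : ((x, v) : g × h) = (0, v) + (x, 0) := by simp
      rw [hsum, map_add, hθh]
      ext <;> simp [hθg]
    let η : g →ₗ[K] h := LinearMap.snd K g h ∘ₗ θ ∘ₗ LinearMap.inl K g h
    have hη (x : g) (v : h) : θ (x, v) = (x, v + η x) := split x v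
    clear_value η
    refine ⟨-η, fun x1 v2 v3 => ?_, fun x1 x2 v3 => ?_, fun x1 x2 x3 => ?_⟩
    · have key := congrArg Prod.snd (hθ (x1, 0) (0, v2) (0, v3))
      simp [extBracket, hη] at key
      simp [key]
    · have key := congrArg Prod.snd (hθ (x1, 0) (x2, 0) (0, v3))
      simp [extBracket, hη] at key
      simp [key]
      abel
    · have key := congrArg Prod.snd (hθ (x1, 0) (x2, 0) (x3, 0))
      simp [extBracket, hη] at key
      simp [eq_sub_of_add_eq key]
      abel
  · rintro ⟨ξ, hν, hρ, hω⟩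
    refine ⟨LinearMap.id - LinearMap.inr K g h ∘ₗ ξ ∘ₗ LinearMap.fst K g h, ?_, ?_, ?_⟩
    · rintro ⟨x1, v1⟩ ⟨x2, v2⟩ ⟨x3, v3⟩
      ext
      · simp [extBracket]
      · simp only [sub_eq_iff_eq_add] at hν hρ hω
        simp [extBracket, hν, hρ, hω]
        rw [cyc (ξ x3) v1 v2, ← cyc v1 (ξ x2) v3, ← cyc v1 (ξ x2) (ξ x3), cyc (ξ x3) (ξ x1) v2]
        abel
    · simp
    · simp
end

section
/- Let g be a vector space over a field K of characteristic 0. For α ∈ C^p(g,g) and β ∈ C^q(g,g), the element ⟦α,β⟧ = α∘β − (−1)^{pq} β∘α lies in C^{p+q}(g,g), the bracket is graded skew-symmetric, ⟦α,β⟧ = −(−1)^{pq}⟦β,α⟧, and it satisfies the graded Jacobi identity ⟦α,⟦β,γ⟧⟧ = ⟦⟦α,β⟧,γ⟧ + (−1)^{pq}⟦β,⟦α,γ⟧⟧ for all α ∈ C^p(g,g), β ∈ C^q(g,g), γ ∈ C^r(g,g); hence (⊕_p C^p(g,g), ⟦·,·⟧) is a graded Lie algebra. -/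
/-- A `p`-cochain on `g`: a map taking `p` "wedge" arguments, each represented by a pair
`(xs i, ys i)` standing for `xs i ∧ ys i ∈ ⋀²g`, and one extra argument in `g`. -/
abbrev Cochain (g : Type*) (p : ℕ) : Type _ := (Fin p → g) → (Fin p → g) → g → g

/-- Membership in `C^p(g,g)`: multilinearity in all `2p+1` slots, antisymmetry in each
wedge pair (so that the map factors through `(⋀²g)^{⊗p} ⊗ g`), and being alternating in
the last three arguments. -/
def IsCochain (K : Type*) [Field K] {g : Type*} [AddCommGroup g] [Module K g]
    (p : ℕ) (f : Cochain g p) : Prop :=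
  (∀ (xs ys : Fin p → g) (z : g) (i : Fin p) (u v : g),
      f (Function.update xs i (u + v)) ys z
        = f (Function.update xs i u) ys z + f (Function.update xs i v) ys z) ∧
  (∀ (xs ys : Fin p → g) (z : g) (i : Fin p) (a : K) (u : g),
      f (Function.update xs i (a • u)) ys z = a • f (Function.update xs i u) ys z) ∧
  (∀ (xs ys : Fin p → g) (z : g) (i : Fin p) (u v : g),
      f xs (Function.update ys i (u + v)) z
        = f xs (Function.update ys i u) z + f xs (Function.update ys i v) z) ∧
  (∀ (xs ys : Fin p → g) (z : g) (i : Fin p) (a : K) (u : g),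
      f xs (Function.update ys i (a • u)) z = a • f xs (Function.update ys i u) z) ∧
  (∀ (xs ys : Fin p → g) (u v : g), f xs ys (u + v) = f xs ys u + f xs ys v) ∧
  (∀ (xs ys : Fin p → g) (a : K) (u : g), f xs ys (a • u) = a • f xs ys u) ∧
  (∀ (xs ys : Fin p → g) (z : g) (i : Fin p), xs i = ys i → f xs ys z = 0) ∧
  (∀ (xs ys : Fin p → g) (z : g) (i : Fin p), (i : ℕ) + 1 = p →
      (xs i = z ∨ ys i = z) → f xs ys z = 0)

open Classical in
/-- The `(k, m-k)`-unshuffles of the first `m` indices of `Fin n`, extended by the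
identity elsewhere. -/
noncomputable def unshuffles (n k m : ℕ) : Finset (Equiv.Perm (Fin n)) :=
  Finset.univ.filter fun σ =>
    (∀ i : Fin n, m ≤ (i : ℕ) → σ i = i) ∧
    (∀ i j : Fin n, (i : ℕ) < (j : ℕ) → (j : ℕ) < k → σ i < σ j) ∧
    (∀ i j : Fin n, k ≤ (i : ℕ) → (i : ℕ) < (j : ℕ) → (j : ℕ) < m → σ i < σ j)

/-- The circle product `α ∘ β` of cochains (Rothstein/Nijenhuis-Richardson-type product
for 3-Lie algebra cochains). -/
noncomputable def circProd {g : Type*} [AddCommGroup g] (p q : ℕ)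
    (α : Cochain g p) (β : Cochain g q) : Cochain g (p + q) :=
  fun xs ys z =>
    (∑ k : Fin p, ((-1 : ℤ) ^ ((k : ℕ) * q)) •
      ∑ σ ∈ unshuffles (p + q) (k : ℕ) ((k : ℕ) + q),
        (Equiv.Perm.sign σ : ℤ) •
          (α (fun i : Fin p =>
                if (i : ℕ) < (k : ℕ) then xs (σ (Fin.castLE (Nat.le_add_right p q) i))
                else if (i : ℕ) = (k : ℕ) then
                  β (fun j : Fin q => xs (σ ⟨(k : ℕ) + (j : ℕ),
                        by have := k.isLt; have := j.isLt; omega⟩))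
                    (fun j : Fin q => ys (σ ⟨(k : ℕ) + (j : ℕ),
                        by have := k.isLt; have := j.isLt; omega⟩))
                    (xs ⟨(k : ℕ) + q, by have := k.isLt; omega⟩)
                else xs ⟨(i : ℕ) + q, by have := i.isLt; omega⟩)
             (fun i : Fin p =>
                if (i : ℕ) < (k : ℕ) then ys (σ (Fin.castLE (Nat.le_add_right p q) i))
                else if (i : ℕ) = (k : ℕ) then ys ⟨(k : ℕ) + q, by have := k.isLt; omega⟩
                else ys ⟨(i : ℕ) + q, by have := i.isLt; omega⟩)
             z
           +
           α (fun i : Fin p =>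
                if (i : ℕ) < (k : ℕ) then xs (σ (Fin.castLE (Nat.le_add_right p q) i))
                else if (i : ℕ) = (k : ℕ) then xs ⟨(k : ℕ) + q, by have := k.isLt; omega⟩
                else xs ⟨(i : ℕ) + q, by have := i.isLt; omega⟩)
             (fun i : Fin p =>
                if (i : ℕ) < (k : ℕ) then ys (σ (Fin.castLE (Nat.le_add_right p q) i))
                else if (i : ℕ) = (k : ℕ) then
                  β (fun j : Fin q => xs (σ ⟨(k : ℕ) + (j : ℕ),
                        by have := k.isLt; have := j.isLt; omega⟩))
                    (fun j : Fin q => ys (σ ⟨(k : ℕ) + (j : ℕ),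
                        by have := k.isLt; have := j.isLt; omega⟩))
                    (ys ⟨(k : ℕ) + q, by have := k.isLt; omega⟩)
                else ys ⟨(i : ℕ) + q, by have := i.isLt; omega⟩)
             z))
    +
    ((-1 : ℤ) ^ (p * q)) •
      ∑ σ ∈ unshuffles (p + q) p (p + q),
        (Equiv.Perm.sign σ : ℤ) •
          α (fun i : Fin p => xs (σ (Fin.castLE (Nat.le_add_right p q) i)))
            (fun i : Fin p => ys (σ (Fin.castLE (Nat.le_add_right p q) i)))
            (β (fun j : Fin q => xs (σ ⟨p + (j : ℕ), by have := j.isLt; omega⟩))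
               (fun j : Fin q => ys (σ ⟨p + (j : ℕ), by have := j.isLt; omega⟩)) z)

/-- The graded commutator bracket `⟦α, β⟧ = α∘β - (-1)^{pq} β∘α` on cochains. -/
noncomputable def nrBracket {g : Type*} [AddCommGroup g] (p q : ℕ)
    (α : Cochain g p) (β : Cochain g q) : Cochain g (p + q) :=
  fun xs ys z =>
    circProd p q α β xs ys z
      - ((-1 : ℤ) ^ (p * q)) •
          circProd q p β α (fun i => xs (Fin.cast (Nat.add_comm q p) i))
            (fun i => ys (Fin.cast (Nat.add_comm q p) i)) z

/-- Cochains of all degrees at once: functions of a word of pairs `x ∧ y` and a last argument. -/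
abbrev WordCochain (g : Type*) : Type _ := List (g × g) → g → g

namespace WordCochain

variable {g : Type*} [AddCommGroup g]

/-- Insertion of a pair as the first argument. -/
def contract (X : g × g) (a : WordCochain g) : WordCochain g := fun W => a (X :: W)

/-- The grading automorphism, acting by `(-1) ^ p` in degree `p`. -/
def parity (a : WordCochain g) : WordCochain g := fun W z => (-1 : ℤ) ^ W.length • a W z

/-- The circle product, by recursion on the word. -/
def circWord : List (g × g) → WordCochain g → WordCochain g → g → g
  | [], a, b, z => a [] (b [] z)
  | X :: W, a, b, z =>
    circWord W a (contract X b) z + circWord W (contract X a) (parity b) z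
      + (a ((b [] X.1, X.2) :: W) z + a ((X.1, b [] X.2) :: W) z)

/-- The circle product of word cochains. -/
def circ (a b : WordCochain g) : WordCochain g := fun W z => circWord W a b z

lemma circ_nil (a b : WordCochain g) (z : g) : circ a b [] z = a [] (b [] z) := rfl

lemma circ_cons (a b : WordCochain g) (X : g × g) (W : List (g × g)) (z : g) :
    circ a b (X :: W) z = circ a (contract X b) W z + circ (contract X a) (parity b) W z
      + (a ((b [] X.1, X.2) :: W) z + a ((X.1, b [] X.2) :: W) z) := rfl

lemma contract_circ (a b : WordCochain g) (X : g × g) :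
    contract X (circ a b) = circ a (contract X b) + circ (contract X a) (parity b)
      + (contract (b [] X.1, X.2) a + contract (X.1, b [] X.2) a) := rfl

lemma parity_nil (a : WordCochain g) (z : g) : parity a [] z = a [] z := by simp [parity]

lemma contract_parity (X : g × g) (a : WordCochain g) :
    contract X (parity a) = -parity (contract X a) := by
  funext W z
  simp [contract, parity, pow_succ]

lemma parity_add (a b : WordCochain g) : parity (a + b) = parity a + parity b := by
  funext W z
  simp [parity]

lemma circ_add_left (a a' b : WordCochain g) : circ (a + a') b = circ a b + circ a' b := by
  funext W z
  induction W generalizing a a' b with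
  | nil => rfl
  | cons X W ih =>
    have h : contract X (a + a') = contract X a + contract X a' := rfl
    simp only [circ_cons, h, ih, Pi.add_apply]
    abel

/-- `a ↦ circ a b` as an additive map. -/
def circLeftHom (b : WordCochain g) : WordCochain g →+ WordCochain g :=
  AddMonoidHom.mk' (fun a => circ a b) fun a a' => circ_add_left a a' b

lemma circ_zsmul_left (n : ℤ) (a b : WordCochain g) : circ (n • a) b = n • circ a b :=
  map_zsmul (circLeftHom b) n a

lemma circ_sub_left (a a' b : WordCochain g) : circ (a - a') b = circ a b - circ a' b :=
  map_sub (circLeftHom b) a a'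

lemma circ_zero_left (b : WordCochain g) : circ 0 b = 0 := map_zero (circLeftHom b)

variable {K : Type*} [Field K] [Module K g]

lemma parity_smul (t : K) (a : WordCochain g) : parity (t • a) = t • parity a := by
  funext W z
  exact smul_comm _ t _

lemma circ_smul_left (t : K) (a b : WordCochain g) : circ (t • a) b = t • circ a b := by
  funext W z
  induction W generalizing a b with
  | nil => rfl
  | cons X W ih =>
    have h : contract X (t • a) = t • contract X a := rfl
    simp only [circ_cons, h, ih, Pi.smul_apply, smul_add]

variable (K) in
/-- Linearity in every argument. -/
structure IsMultilinear (a : WordCochain g) : Prop where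
  fst (U V : List (g × g)) (y z : g) : IsLinearMap K fun x => a (U ++ (x, y) :: V) z
  snd (U V : List (g × g)) (x z : g) : IsLinearMap K fun y => a (U ++ (x, y) :: V) z
  last (W : List (g × g)) : IsLinearMap K fun z => a W z

lemma IsMultilinear.contract {a : WordCochain g} (ha : IsMultilinear K a) (X : g × g) :
    IsMultilinear K (contract X a) where
  fst U V := ha.fst (X :: U) V
  snd U V := ha.snd (X :: U) V
  last W := ha.last (X :: W)

lemma _root_.IsLinearMap.const_zsmul {f : g → g} (hf : IsLinearMap K f) (n : ℤ) :
    IsLinearMap K fun x => n • f x where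
  map_add x y := by simp [hf.map_add]
  map_smul t x := by rw [hf.map_smul, smul_comm]

lemma _root_.IsLinearMap.fun_add {f h : g → g} (hf : IsLinearMap K f) (hh : IsLinearMap K h) :
    IsLinearMap K fun x => f x + h x where
  map_add x y := by simp only [hf.map_add, hh.map_add]; abel
  map_smul t x := by simp [hf.map_smul, hh.map_smul]

lemma _root_.IsLinearMap.fun_comp {f h : g → g} (hf : IsLinearMap K f) (hh : IsLinearMap K h) :
    IsLinearMap K fun x => f (h x) where
  map_add x y := by simp [hf.map_add, hh.map_add]
  map_smul t x := by simp [hf.map_smul, hh.map_smul]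

lemma IsMultilinear.parity {a : WordCochain g} (ha : IsMultilinear K a) :
    IsMultilinear K (parity a) where
  fst U V y z := by
    simpa [WordCochain.parity] using (ha.fst U V y z).const_zsmul ((-1) ^ (U ++ (y, y) :: V).length)
  snd U V x z := by
    simpa [WordCochain.parity] using (ha.snd U V x z).const_zsmul ((-1) ^ (U ++ (x, x) :: V).length)
  last W := (ha.last W).const_zsmul _

lemma circ_add_right {a : WordCochain g} (ha : IsMultilinear K a) (b b' : WordCochain g) :
    circ a (b + b') = circ a b + circ a b' := by
  funext W z
  induction W generalizing a b b' with
  | nil => exact (ha.last []).map_add _ _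
  | cons X W ih =>
    have h : contract X (b + b') = contract X b + contract X b' := rfl
    have h1 := (ha.fst [] W X.2 z).map_add (b [] X.1) (b' [] X.1)
    have h2 := (ha.snd [] W X.1 z).map_add (b [] X.2) (b' [] X.2)
    simp only [List.nil_append] at h1 h2
    simp only [circ_cons, h, ih ha, ih (ha.contract X), parity_add, Pi.add_apply, h1, h2]
    abel

lemma circ_smul_right {a : WordCochain g} (ha : IsMultilinear K a) (t : K) (b : WordCochain g) :
    circ a (t • b) = t • circ a b := by
  funext W z
  induction W generalizing a b with
  | nil => exact (ha.last []).map_smul _ _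
  | cons X W ih =>
    have h : contract X (t • b) = t • contract X b := rfl
    have h1 := (ha.fst [] W X.2 z).map_smul t (b [] X.1)
    have h2 := (ha.snd [] W X.1 z).map_smul t (b [] X.2)
    simp only [List.nil_append] at h1 h2
    simp only [circ_cons, h, ih ha, ih (ha.contract X), parity_smul, Pi.smul_apply, h1, h2, smul_add]

/-- `b ↦ circ a b` as an additive map, for multilinear `a`. -/
def circRightHom {a : WordCochain g} (ha : IsMultilinear K a) : WordCochain g →+ WordCochain g :=
  AddMonoidHom.mk' (fun b => circ a b) (circ_add_right ha)

lemma circ_zsmul_right {a : WordCochain g} (ha : IsMultilinear K a) (n : ℤ) (b : WordCochain g) :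
    circ a (n • b) = n • circ a b := map_zsmul (circRightHom ha) n b

lemma circ_sub_right {a : WordCochain g} (ha : IsMultilinear K a) (b b' : WordCochain g) :
    circ a (b - b') = circ a b - circ a b' := map_sub (circRightHom ha) b b'

lemma circ_neg_right {a : WordCochain g} (ha : IsMultilinear K a) (b : WordCochain g) :
    circ a (-b) = -circ a b := map_neg (circRightHom ha) b

lemma circ_zero_right {a : WordCochain g} (ha : IsMultilinear K a) : circ a 0 = 0 :=
  map_zero (circRightHom ha)

lemma parity_circ {a : WordCochain g} (ha : IsMultilinear K a) (b : WordCochain g) :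
    parity (circ a b) = circ (parity a) (parity b) := by
  funext W z
  induction W generalizing a b with
  | nil => simp [circ_nil, parity]
  | cons X W ih =>
    have h1 := ih ha (contract X b)
    have h2 := ih (ha.contract X) (parity b)
    have h3 : circ (contract X (parity a)) (parity (parity b))
        = -circ (parity (contract X a)) (parity (parity b)) := by
      rw [contract_parity, ← neg_one_zsmul, circ_zsmul_left, neg_one_zsmul]
    rw [circ_cons, contract_parity, circ_neg_right ha.parity, h3, Pi.neg_apply, Pi.neg_apply,
      Pi.neg_apply, Pi.neg_apply, ← h1, ← h2, parity_nil, parity_nil]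
    simp only [parity, circ_cons, List.length_cons, pow_succ, smul_add]
    simp only [mul_neg, mul_one, neg_smul]

lemma isMultilinear_circ {a b : WordCochain g} (ha : IsMultilinear K a)
    (hb : IsMultilinear K b) : IsMultilinear K (circ a b) where
  fst U V y z := by
    induction U generalizing a b with
    | nil =>
      refine .fun_add (.fun_add ?_ ?_) (.fun_add ?_ ?_)
      · have h (x x') : contract (x + x', y) b = contract (x, y) b + contract (x', y) b := by
          funext W w
          exact (hb.fst [] W y w).map_add x x'
        have h' (t : K) (x) : contract (t • x, y) b = t • contract (x, y) b := by
          funext W w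
          exact (hb.fst [] W y w).map_smul t x
        constructor
        · intro x x'
          change circ _ _ V z = circ _ _ V z + circ _ _ V z
          rw [h, circ_add_right ha]; rfl
        · intro t x
          change circ _ _ V z = t • circ _ _ V z
          rw [h', circ_smul_right ha]; rfl
      · have h (x x') : contract (x + x', y) a = contract (x, y) a + contract (x', y) a := by
          funext W w
          exact (ha.fst [] W y w).map_add x x'
        have h' (t : K) (x) : contract (t • x, y) a = t • contract (x, y) a := by
          funext W w
          exact (ha.fst [] W y w).map_smul t x
        constructor
        · intro x x'
          change circ _ _ V z = circ _ _ V z + circ _ _ V z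
          rw [h, circ_add_left]; rfl
        · intro t x
          change circ _ _ V z = t • circ _ _ V z
          rw [h', circ_smul_left]; rfl
      · exact (ha.fst [] V y z).fun_comp (hb.last [])
      · exact ha.fst [] V (b [] y) z
    | cons X U ih =>
      exact .fun_add (.fun_add (ih ha (hb.contract X)) (ih (ha.contract X) hb.parity))
        (.fun_add (ha.fst (_ :: U) V y z) (ha.fst (_ :: U) V y z))
  snd U V x z := by
    induction U generalizing a b with
    | nil =>
      refine .fun_add (.fun_add ?_ ?_) (.fun_add ?_ ?_)
      · have h (y y') : contract (x, y + y') b = contract (x, y) b + contract (x, y') b := by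
          funext W w
          exact (hb.snd [] W x w).map_add y y'
        have h' (t : K) (y) : contract (x, t • y) b = t • contract (x, y) b := by
          funext W w
          exact (hb.snd [] W x w).map_smul t y
        constructor
        · intro y y'
          change circ _ _ V z = circ _ _ V z + circ _ _ V z
          rw [h, circ_add_right ha]; rfl
        · intro t y
          change circ _ _ V z = t • circ _ _ V z
          rw [h', circ_smul_right ha]; rfl
      · have h (y y') : contract (x, y + y') a = contract (x, y) a + contract (x, y') a := by
          funext W w
          exact (ha.snd [] W x w).map_add y y'
        have h' (t : K) (y) : contract (x, t • y) a = t • contract (x, y) a := by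
          funext W w
          exact (ha.snd [] W x w).map_smul t y
        constructor
        · intro y y'
          change circ _ _ V z = circ _ _ V z + circ _ _ V z
          rw [h, circ_add_left]; rfl
        · intro t y
          change circ _ _ V z = t • circ _ _ V z
          rw [h', circ_smul_left]; rfl
      · exact ha.snd [] V (b [] x) z
      · exact (ha.snd [] V x z).fun_comp (hb.last [])
    | cons X U ih =>
      exact .fun_add (.fun_add (ih ha (hb.contract X)) (ih (ha.contract X) hb.parity))
        (.fun_add (ha.snd (_ :: U) V x z) (ha.snd (_ :: U) V x z))
  last W := by
    induction W generalizing a b with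
    | nil => exact (ha.last []).fun_comp (hb.last [])
    | cons X W ih =>
      exact .fun_add (.fun_add (ih ha (hb.contract X)) (ih (ha.contract X) hb.parity))
        (.fun_add (ha.last _) (ha.last _))

/-- Vanishing on the degenerate pairs `x ∧ x`. -/
def IsPairAlternating (a : WordCochain g) : Prop :=
  ∀ (U V : List (g × g)) (x z : g), a (U ++ (x, x) :: V) z = 0

/-- Vanishing when the last argument also occurs in the last pair. -/
def IsLastAlternating (a : WordCochain g) : Prop :=
  ∀ (U : List (g × g)) (x z : g), a (U ++ [(z, x)]) z = 0 ∧ a (U ++ [(x, z)]) z = 0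

lemma IsPairAlternating.contract {a : WordCochain g} (ha : IsPairAlternating a) (X : g × g) :
    IsPairAlternating (contract X a) := fun U => ha (X :: U)

lemma IsPairAlternating.parity {a : WordCochain g} (ha : IsPairAlternating a) :
    IsPairAlternating (parity a) := fun U V x z => by
  rw [WordCochain.parity, ha, smul_zero]

lemma IsLastAlternating.contract {a : WordCochain g} (ha : IsLastAlternating a) (X : g × g) :
    IsLastAlternating (contract X a) := fun U => ha (X :: U)

lemma IsLastAlternating.parity {a : WordCochain g} (ha : IsLastAlternating a) :
    IsLastAlternating (parity a) := fun U x z => by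
  simp only [WordCochain.parity, ha U x z, smul_zero, and_self]

lemma isPairAlternating_circ {a b : WordCochain g} (ha : IsMultilinear K a)
    (ha' : IsPairAlternating a) (hb' : IsPairAlternating b) : IsPairAlternating (circ a b) := by
  intro U V x z
  induction U generalizing a b with
  | nil =>
    have h1 : contract (x, x) a = 0 := by
      funext W w
      exact ha' [] W x w
    have h2 : contract (x, x) b = 0 := by
      funext W w
      exact hb' [] W x w
    have h3 := ha' [] V (x + b [] x) z
    have h4 := fun y => (ha.fst [] V y z).map_add x (b [] x)
    have h5 := fun y => (ha.snd [] V y z).map_add x (b [] x)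
    have h6 := fun x => ha' [] V x z
    simp only [List.nil_append] at h3 h4 h5 h6
    simp only [h4, h5, h6, zero_add, add_zero] at h3
    simp only [List.nil_append, circ_cons, h1, h2, circ_zero_left, circ_zero_right ha,
      Pi.zero_apply, zero_add]
    rw [add_comm, h3]
  | cons X U ih =>
    rw [List.cons_append, circ_cons, ih ha ha' (hb'.contract X),
      ih (ha.contract X) (ha'.contract X) hb'.parity]
    simpa using by
      rw [← List.cons_append, ← List.cons_append, ha', ha', add_zero]

lemma isLastAlternating_circ {a b : WordCochain g} (ha : IsMultilinear K a)
    (ha' : IsLastAlternating a) (hb' : IsLastAlternating b) : IsLastAlternating (circ a b) := by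
  intro U x z
  induction U generalizing a b with
  | nil =>
    have h0 := (ha.last []).map_zero
    have h1 := (hb' [] x z).1
    have h2 := (hb' [] x z).2
    have h3 := fun t => (ha' [] x t).1
    have h4 := fun t => (ha' [] x t).2
    have h5 := fun t => (ha' [] t z).1
    have h6 := fun t => (ha' [] t z).2
    have h7 := fun t => (ha.fst [] [] x t).map_add z (b [] z)
    have h8 := fun t => (ha.snd [] [] x t).map_add z (b [] z)
    have h9 := fun X => (ha.last [X]).map_add z (b [] z)
    have h3' := h3 (z + b [] z)
    have h4' := h4 (z + b [] z)
    simp only [List.nil_append] at *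
    simp only [h7, h9, h3, zero_add, add_zero] at h3'
    simp only [h8, h9, h4, zero_add, add_zero] at h4'
    simp only [circ_cons, circ_nil, contract, parity_nil, h1, h2, h0, h5, h6, zero_add, add_zero]
    exact ⟨h3', h4'⟩
  | cons X U ih =>
    have h1 := ih ha ha' (hb'.contract X)
    have h2 := ih (ha.contract X) (ha'.contract X) hb'.parity
    have h3 := fun X => ha' (X :: U) x z
    simp only [List.cons_append] at h3 ⊢
    simp only [circ_cons, h1, h2, h3, add_zero, and_self]

/-- The associator of the circle product. -/
def assoc (a b c : WordCochain g) : WordCochain g := circ (circ a b) c - circ a (circ b c)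

lemma assoc_cons {a b : WordCochain g} (ha : IsMultilinear K a) (hb : IsMultilinear K b)
    (c : WordCochain g) (X : g × g) (W : List (g × g)) (z : g) :
    assoc a b c (X :: W) z =
      assoc a b (contract X c) W z + assoc a (contract X b) (parity c) W z
        + assoc (contract X a) (parity b) (parity c) W z
        + (circ (contract (b [] X.1, X.2) a + contract (X.1, b [] X.2) a) (parity c) W z
          + circ (contract (c [] X.1, X.2) a + contract (X.1, c [] X.2) a) (parity b) W z)
        + (a ((b [] X.1, c [] X.2) :: W) z + a ((c [] X.1, b [] X.2) :: W) z) := by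
  simp only [assoc, Pi.sub_apply, circ_cons, circ_nil, contract_circ, circ_add_left,
    circ_add_right ha, parity_circ hb, Pi.add_apply]
  abel

lemma parity_contract {b : WordCochain g} {q : ℕ} (hb : parity b = (-1 : ℤ) ^ q • b)
    (X : g × g) : parity (contract X b) = (-1 : ℤ) ^ (q + 1) • contract X b := by
  rw [← neg_neg (parity _), ← contract_parity, hb, pow_succ, mul_neg_one, neg_smul]
  rfl

lemma assoc_zsmul_right {a b : WordCochain g} (ha : IsMultilinear K a) (hb : IsMultilinear K b)
    (n : ℤ) (c : WordCochain g) : assoc a b (n • c) = n • assoc a b c := by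
  rw [assoc, circ_zsmul_right (isMultilinear_circ ha hb), circ_zsmul_right hb,
    circ_zsmul_right ha, assoc, smul_sub]

lemma assoc_zsmul_middle {a : WordCochain g} (ha : IsMultilinear K a) (n : ℤ)
    (b c : WordCochain g) : assoc a (n • b) c = n • assoc a b c := by
  rw [assoc, circ_zsmul_right ha, circ_zsmul_left, circ_zsmul_left, circ_zsmul_right ha, assoc,
    smul_sub]

variable (K) in
lemma nil_eq_zero_of_parity_eq_neg [CharZero K] {b : WordCochain g} (hb : parity b = -b) (z : g) :
    b [] z = 0 := by
  have h : b [] z = -b [] z := by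
    rw [← Pi.neg_apply, ← Pi.neg_apply, ← hb, parity_nil]
  have h2 : (2 : K) • b [] z = 0 := by
    rw [two_smul]
    nth_rewrite 1 [h]
    simp
  simpa using h2

/-- The circle product is graded pre-Lie. -/
theorem assoc_comm [CharZero K] {a b c : WordCochain g} {q r : ℕ} (ha : IsMultilinear K a)
    (hb : IsMultilinear K b) (hc : IsMultilinear K c)
    (hb' : parity b = (-1 : ℤ) ^ q • b) (hc' : parity c = (-1 : ℤ) ^ r • c) :
    assoc a b c = (-1 : ℤ) ^ (q * r) • assoc a c b := by
  funext W z
  induction W generalizing a b c q r with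
  | nil => simp [assoc, circ_nil]
  | cons X W ih =>
    have h1 := ih ha hb (hc.contract X) hb' (parity_contract hc' X)
    have h2 := ih ha (hb.contract X) hc (parity_contract hb' X) hc'
    have h3 := ih (ha.contract X) hb hc hb' hc'
    have h4 (t : g × g) (h : t.1 = 0 ∨ t.2 = 0) : contract t a = 0 := by
      funext V w
      obtain ⟨t₁, t₂⟩ := t
      rcases h with h | h <;> simp only at h <;> subst h
      · exact (ha.fst [] V t₂ w).map_zero
      · exact (ha.snd [] V t₁ w).map_zero
    have h5 (t : g × g) : a (t :: W) z = contract t a W z := rfl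
    rw [Pi.smul_apply, Pi.smul_apply] at h1 h2 h3 ⊢
    rw [assoc_cons ha hb, assoc_cons ha hc, hb', hc']
    simp only [assoc_zsmul_middle (ha.contract X),
      assoc_zsmul_right ha (hb.contract X), assoc_zsmul_right ha (hc.contract X),
      assoc_zsmul_right (ha.contract X) hb, assoc_zsmul_right (ha.contract X) hc, Pi.smul_apply,
      h1, h2, h3, h5]
    rcases Nat.even_or_odd q with hq | hq <;> rcases Nat.even_or_odd r with hr | hr
    · simp only [mul_add, add_mul, pow_add, pow_mul, hq.neg_one_pow, hr.neg_one_pow, one_pow,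
        mul_one, one_mul, one_smul]
      abel
    · simp only [mul_add, add_mul, pow_add, pow_mul, hq.neg_one_pow, hr.neg_one_pow, one_pow,
        mul_one, one_mul, one_smul]
      abel
    · simp only [mul_add, add_mul, pow_add, pow_mul, hq.neg_one_pow, hr.neg_one_pow, mul_one,
        one_mul, one_smul]
      abel
    · have hb0 := nil_eq_zero_of_parity_eq_neg K
        (b := b) (by rw [hb', hq.neg_one_pow, neg_one_zsmul])
      have hc0 := nil_eq_zero_of_parity_eq_neg K
        (b := c) (by rw [hc', hr.neg_one_pow, neg_one_zsmul])
      simp only [hb0, hc0, h4, true_or, or_true, circ_zero_left, add_zero, Pi.zero_apply]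
      simp only [mul_add, add_mul, pow_add, pow_mul, hq.neg_one_pow, hr.neg_one_pow, mul_one,
        one_mul]
      abel

/-- The graded commutator of word cochains of degrees `p` and `q`. -/
def bracket (p q : ℕ) (a b : WordCochain g) : WordCochain g :=
  circ a b - (-1 : ℤ) ^ (p * q) • circ b a

theorem bracket_jacobi [CharZero K] {a b c : WordCochain g} {p q r : ℕ}
    (ha : IsMultilinear K a) (hb : IsMultilinear K b) (hc : IsMultilinear K c)
    (ha' : parity a = (-1 : ℤ) ^ p • a) (hb' : parity b = (-1 : ℤ) ^ q • b)
    (hc' : parity c = (-1 : ℤ) ^ r • c) :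
    bracket p (q + r) a (bracket q r b c) =
      bracket (p + q) r (bracket p q a b) c
        + (-1 : ℤ) ^ (p * q) • bracket q (p + r) b (bracket p r a c) := by
  have h1 := assoc_comm ha hb hc hb' hc'
  have h2 := congrArg (fun x => (-1 : ℤ) ^ (p * q) • x) (assoc_comm hb ha hc ha' hc')
  have h3 := congrArg (fun x => ((-1 : ℤ) ^ (p * r) * (-1 : ℤ) ^ (q * r)) • x)
    (assoc_comm hc ha hb ha' hb')
  simp only [assoc] at h1 h2 h3
  simp only [bracket, circ_sub_right ha, circ_sub_right hb, circ_sub_right hc, circ_sub_left,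
    circ_zsmul_left, circ_zsmul_right ha, circ_zsmul_right hb, circ_zsmul_right hc, mul_add,
    add_mul, pow_add, mul_comm q p]
  rcases neg_one_pow_eq_or ℤ (p * q) with e1 | e1 <;>
    rcases neg_one_pow_eq_or ℤ (p * r) with e2 | e2 <;>
    rcases neg_one_pow_eq_or ℤ (q * r) with e3 | e3 <;>
    simp only [e1, e2, e3] at h1 h2 h3 ⊢ <;>
    linear_combination (norm := module) -h1 + h2 - h3

end WordCochain

section Unshuffle

variable {T M : Type*} [AddCommGroup M]

/-- Signed sum over all ways to split a word into two complementary subwords. -/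
def shuffleSum : List T → (List T → List T → M) → M
  | [], Φ => Φ [] []
  | X :: W, Φ =>
    shuffleSum W (fun A B => Φ (X :: A) B)
      + shuffleSum W (fun A B => (-1 : ℤ) ^ A.length • Φ A (X :: B))

lemma shuffleSum_congr {W : List T} {Φ Ψ : List T → List T → M}
    (h : ∀ A B, A.length + B.length = W.length → Φ A B = Ψ A B) :
    shuffleSum W Φ = shuffleSum W Ψ := by
  induction W generalizing Φ Ψ with
  | nil => exact h [] [] rfl
  | cons X W ih =>
    rw [shuffleSum, shuffleSum]
    congr 1
    · exact ih fun A B hAB => h _ _ (by simp; omega)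
    · exact ih fun A B hAB => by rw [h _ _ (by simp; omega)]

lemma shuffleSum_zero (W : List T) : shuffleSum W (fun _ _ => (0 : M)) = 0 := by
  induction W with
  | nil => rfl
  | cons X W ih => simp [shuffleSum, ih]

lemma shuffleSum_eq_zero {W : List T} {Φ : List T → List T → M}
    (h : ∀ A B, A.length + B.length = W.length → Φ A B = 0) : shuffleSum W Φ = 0 :=
  (shuffleSum_congr h).trans (shuffleSum_zero W)

/-- The permutation of `Fin (n + 1)` sending `j` to `0` and acting on the other indices as `τ`. -/
def insertZero {n : ℕ} (j : Fin (n + 1)) (τ : Equiv.Perm (Fin n)) : Equiv.Perm (Fin (n + 1)) :=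
  Equiv.Perm.decomposeFin.symm (0, τ) * j.cycleRange

lemma insertZero_self {n : ℕ} (j : Fin (n + 1)) (τ : Equiv.Perm (Fin n)) :
    insertZero j τ j = 0 := by
  simp [insertZero]

lemma insertZero_succAbove {n : ℕ} (j : Fin (n + 1)) (τ : Equiv.Perm (Fin n)) (i : Fin n) :
    insertZero j τ (j.succAbove i) = (τ i).succ := by
  simp [insertZero]

lemma sign_insertZero {n : ℕ} (j : Fin (n + 1)) (τ : Equiv.Perm (Fin n)) :
    (Equiv.Perm.sign (insertZero j τ) : ℤ) = (-1) ^ (j : ℕ) * Equiv.Perm.sign τ := by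
  simp [insertZero, mul_comm]

/-- Permutations of `Fin (n + 1)`, by the preimage of `0`. -/
def insertZeroEquiv (n : ℕ) : Fin (n + 1) × Equiv.Perm (Fin n) ≃ Equiv.Perm (Fin (n + 1)) where
  toFun x := insertZero x.1 x.2
  invFun σ := (σ.symm 0, (Equiv.Perm.decomposeFin (σ * (σ.symm 0).cycleRange⁻¹)).2)
  left_inv := by
    rintro ⟨j, τ⟩
    have h : (insertZero j τ).symm 0 = j := by rw [Equiv.symm_apply_eq, insertZero_self]
    simp only [h]
    simp [insertZero]
  right_inv σ := by
    obtain ⟨⟨i, τ⟩, h⟩ := Equiv.Perm.decomposeFin.symm.surjective (σ * (σ.symm 0).cycleRange⁻¹)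
    have hi : i = 0 := by
      rw [← Equiv.Perm.decomposeFin_symm_apply_zero i τ, h]
      simp [Equiv.Perm.inv_def]
    subst hi
    simp only [insertZero, ← h, Equiv.apply_symm_apply]
    rw [h, inv_mul_cancel_right]

lemma coe_succAbove {n : ℕ} (j : Fin (n + 1)) (i : Fin n) :
    (j.succAbove i : ℕ) = if (i : ℕ) < j then (i : ℕ) else i + 1 := by
  simp only [Fin.succAbove, Fin.lt_def, Fin.val_castSucc]
  split_ifs <;> rfl

lemma insertZero_zero_mem_unshuffles {n k m : ℕ} (τ : Equiv.Perm (Fin n)) :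
    insertZero 0 τ ∈ unshuffles (n + 1) (k + 1) (m + 1) ↔ τ ∈ unshuffles n k m := by
  have h0 := insertZero_self 0 τ
  have h1 (i : Fin n) : insertZero 0 τ i.succ = (τ i).succ := by
    simpa using insertZero_succAbove 0 τ i
  simp only [unshuffles, Finset.mem_filter, Finset.mem_univ, true_and]
  simp [Fin.forall_fin_succ, h0, h1]

lemma insertZero_mem_unshuffles {n k m : ℕ} (hk : k ≤ m) (j : Fin (n + 1)) (hj : (j : ℕ) = k)
    (τ : Equiv.Perm (Fin n)) :
    insertZero j τ ∈ unshuffles (n + 1) k (m + 1) ↔ τ ∈ unshuffles n k m := by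
  have h0 := insertZero_self j τ
  have h1 := insertZero_succAbove j τ
  have h2 := coe_succAbove j
  have h3 (i i' : Fin n) : τ i < τ i' ↔
      insertZero j τ (j.succAbove i) < insertZero j τ (j.succAbove i') := by
    rw [h1, h1, Fin.succ_lt_succ_iff]
  simp only [unshuffles, Finset.mem_filter, Finset.mem_univ, true_and]
  constructor
  · rintro ⟨ha, hb, hc⟩
    refine ⟨fun i hi => ?_, fun i i' hi hi' => ?_, fun i i' hi hi' hi'' => ?_⟩
    · have h4 := ha (j.succAbove i) (by rw [h2]; split_ifs <;> omega)
      have h5 := congrArg Fin.val h4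
      rw [h1, h2, if_neg (by omega)] at h5
      exact Fin.ext (by simpa using h5)
    · rw [h3]
      apply hb <;> rw [h2] <;> try rw [h2]
      all_goals split_ifs <;> omega
    · rw [h3]
      apply hc <;> rw [h2] <;> try rw [h2]
      all_goals split_ifs <;> omega
  · rintro ⟨ha, hb, hc⟩
    refine ⟨fun i hi => ?_, fun i i' hi hi' => ?_, fun i i' hi hi' hi'' => ?_⟩
    · rcases Fin.eq_self_or_eq_succAbove j i with rfl | ⟨t, rfl⟩
      · omega
      · rw [h2] at hi
        split_ifs at hi with h
        · omega
        · rw [h1, ha t (by omega)]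
          exact Fin.ext (by rw [h2, if_neg h]; rfl)
    · rcases Fin.eq_self_or_eq_succAbove j i with rfl | ⟨t, rfl⟩
      · omega
      rcases Fin.eq_self_or_eq_succAbove j i' with rfl | ⟨t', rfl⟩
      · omega
      rw [h2] at hi hi'
      rw [← h3]
      rw [h2] at hi
      apply hb <;> split_ifs at hi hi' <;> omega
    · rcases Fin.eq_self_or_eq_succAbove j i with rfl | ⟨t, rfl⟩
      · rcases Fin.eq_self_or_eq_succAbove i i' with rfl | ⟨t', rfl⟩
        · omega
        · rw [h0, h1]
          exact Fin.succ_pos _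
      rcases Fin.eq_self_or_eq_succAbove j i' with rfl | ⟨t', rfl⟩
      · omega
      rw [← h3]
      rw [h2] at hi hi' hi''
      rw [h2] at hi'
      apply hc <;> split_ifs at hi hi' hi'' <;> omega

lemma eq_of_insertZero_mem_unshuffles {n k m : ℕ} (hk : k ≤ m + 1) (hm : m ≤ n)
    {j : Fin (n + 1)} {τ : Equiv.Perm (Fin n)}
    (h : insertZero j τ ∈ unshuffles (n + 1) k (m + 1)) :
    (j = 0 ∧ 0 < k) ∨ ((j : ℕ) = k ∧ k ≤ m) := by
  have h0 := insertZero_self j τ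
  simp only [unshuffles, Finset.mem_filter, Finset.mem_univ, true_and] at h
  obtain ⟨ha, hb, hc⟩ := h
  have h1 : (j : ℕ) < m + 1 := by
    by_contra hj
    have := ha j (by omega)
    rw [h0] at this
    rw [← this] at hj
    simp at hj
  have h2 : ¬ (0 < (j : ℕ) ∧ (j : ℕ) < k) := fun h => by
    have := hb 0 j h.1 h.2
    rw [h0] at this
    exact Fin.not_lt_zero _ this
  have h3 : ¬ k < (j : ℕ) := fun h => by
    have := hc ⟨k, by omega⟩ j le_rfl h h1
    rw [h0] at this
    exact Fin.not_lt_zero _ this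
  rw [Fin.ext_iff, Fin.val_zero]
  omega

lemma unshuffles_zero (n : ℕ) : unshuffles n 0 0 = {1} := by
  ext σ
  simp only [unshuffles, Finset.mem_filter, Finset.mem_univ, true_and, Finset.mem_singleton]
  constructor
  · rintro ⟨h, -⟩
    exact Equiv.ext fun i => h i (Nat.zero_le _)
  · rintro rfl
    simp

/-- The signed sum over unshuffle permutations is the signed sum over splittings of the word. -/
theorem sum_unshuffles {n k q m : ℕ} (hm : k + q = m) (hmn : m ≤ n) (v : Fin n → T)
    (Φ : List T → List T → M) (hΦ : ∀ A B, A.length ≠ k → Φ A B = 0) :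
    ∑ σ ∈ unshuffles n k m, (Equiv.Perm.sign σ : ℤ) •
        Φ (List.ofFn fun i : Fin k => v (σ ⟨i, by omega⟩))
          (List.ofFn fun j : Fin q => v (σ ⟨k + j, by omega⟩))
      = shuffleSum (List.ofFn fun i : Fin m => v ⟨i, by omega⟩) Φ := by
  induction n generalizing k q m Φ with
  | zero =>
    obtain rfl : m = 0 := by omega
    obtain rfl : k = 0 := by omega
    obtain rfl : q = 0 := by omega
    simp [unshuffles_zero, shuffleSum]
  | succ n ih =>
    obtain _ | m := m
    · obtain rfl : k = 0 := by omega
      obtain rfl : q = 0 := by omega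
      simp [unshuffles_zero, shuffleSum]
    set f : Equiv.Perm (Fin (n + 1)) → M := fun σ => (Equiv.Perm.sign σ : ℤ) •
        Φ (List.ofFn fun i : Fin k => v (σ ⟨i, by omega⟩))
          (List.ofFn fun j : Fin q => v (σ ⟨k + j, by omega⟩)) with hf
    set W : List T := List.ofFn fun i : Fin m => v ⟨i + 1, by omega⟩ with hW
    have hcons : (List.ofFn fun i : Fin (m + 1) => v ⟨i, by omega⟩) = v 0 :: W := by
      simp [List.ofFn_succ, hW]
    have hlen : W.length = m := by simp [hW]
    set F : Fin (n + 1) → M := fun j => ∑ τ : Equiv.Perm (Fin n),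
      if insertZero j τ ∈ unshuffles (n + 1) k (m + 1) then f (insertZero j τ) else 0 with hF
    have hsum : ∑ σ ∈ unshuffles (n + 1) k (m + 1), f σ = ∑ j, F j := by
      rw [← Fintype.sum_ite_mem, ← (insertZeroEquiv n).sum_comp, Fintype.sum_prod_type]
      rfl
    have hF0 (j : Fin (n + 1)) (hj : ¬ (j = 0 ∧ 0 < k)) (hj' : ¬ ((j : ℕ) = k ∧ k ≤ m)) :
        F j = 0 := by
      refine Finset.sum_eq_zero fun τ _ => if_neg fun h => ?_
      exact (eq_of_insertZero_mem_unshuffles (by omega) (by omega) h).elim hj hj'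
    have hfst (hk : 0 < k) : F 0 = shuffleSum W fun A B => Φ (v 0 :: A) B := by
      obtain ⟨k, rfl⟩ : ∃ k', k = k' + 1 := ⟨k - 1, by omega⟩
      refine Eq.trans ?_ (ih (k := k) (q := q) (m := m) (by omega) (by omega) (fun i => v i.succ)
        (fun A B => Φ (v 0 :: A) B) fun A B hA => hΦ _ _ (by simpa using hA))
      simp only [hF, insertZero_zero_mem_unshuffles, Fintype.sum_ite_mem]
      refine Finset.sum_congr rfl fun τ _ => ?_
      have h0 : insertZero 0 τ ⟨0, by omega⟩ = 0 := insertZero_self 0 τ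
      have h1 (i : ℕ) (hi : i < n) : insertZero 0 τ ⟨i + 1, by omega⟩ = (τ ⟨i, hi⟩).succ := by
        simpa using insertZero_succAbove 0 τ ⟨i, hi⟩
      simp only [hf, sign_insertZero, Fin.val_zero, pow_zero, one_mul, List.ofFn_succ, Fin.val_succ,
        h0, fun i : Fin k => h1 i (by omega), fun i : Fin q => h1 (k + i) (by omega),
        add_right_comm k 1]
    have hsnd (j : Fin (n + 1)) (hj : (j : ℕ) = k) (hk : k ≤ m) :
        F j = shuffleSum W fun A B => (-1 : ℤ) ^ A.length • Φ A (v 0 :: B) := by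
      obtain ⟨q, rfl⟩ : ∃ q', q = q' + 1 := ⟨q - 1, by omega⟩
      refine Eq.trans ?_ (ih (k := k) (q := q) (m := m) (by omega) (by omega) (fun i => v i.succ)
        (fun A B => (-1 : ℤ) ^ A.length • Φ A (v 0 :: B)) fun A B hA => by
          rw [hΦ _ _ hA, smul_zero])
      simp only [hF, insertZero_mem_unshuffles hk j hj, Fintype.sum_ite_mem]
      refine Finset.sum_congr rfl fun τ _ => ?_
      have h0 : insertZero j τ ⟨k, by omega⟩ = 0 := by
        rw [← insertZero_self j τ]
        exact congrArg _ (Fin.ext hj.symm)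
      have h1 (i : ℕ) (hi : i < k) : insertZero j τ ⟨i, by omega⟩ = (τ ⟨i, by omega⟩).succ := by
        rw [← insertZero_succAbove j τ]
        exact congrArg _ (Fin.ext (by rw [coe_succAbove]; simp [hj, hi]))
      have h2 (i : ℕ) (hi : k + i < n) :
          insertZero j τ ⟨k + (i + 1), by omega⟩ = (τ ⟨k + i, hi⟩).succ := by
        rw [← insertZero_succAbove j τ]
        exact congrArg _ (Fin.ext (by rw [coe_succAbove]; simp [hj, add_assoc]))
      simp only [hf, sign_insertZero, List.ofFn_succ, Fin.val_zero, Fin.val_succ, add_zero, h0, h1,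
        fun i : Fin q => h2 i (by omega), Fin.is_lt, List.length_ofFn, hj, smul_smul, mul_comm]
    rw [hcons, shuffleSum, hsum]
    rcases Nat.eq_zero_or_pos k with hk | hk
    · subst hk
      rw [shuffleSum_eq_zero (fun A B _ => hΦ _ _ (by simp)), zero_add,
        ← hsnd 0 rfl (Nat.zero_le _)]
      exact Fintype.sum_eq_single _ fun j hj =>
        hF0 j (by simp) fun h => hj (Fin.ext (by simpa using h.1))
    · by_cases hkm : k ≤ m
      · rw [← hfst hk, ← hsnd ⟨k, by omega⟩ rfl hkm]
        refine Fintype.sum_eq_add _ _ (by rw [Ne, Fin.ext_iff]; simp; omega) fun j hj => ?_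
        exact hF0 j (fun h => hj.1 h.1) fun h => hj.2 (Fin.ext h.1)
      · rw [shuffleSum_eq_zero (Φ := fun A B => (-1 : ℤ) ^ A.length • Φ A (v 0 :: B))
          (fun A B hAB => by rw [hΦ _ _ (by omega), smul_zero]), add_zero, ← hfst hk]
        exact Fintype.sum_eq_single _ fun j hj => hF0 j (fun h => hj h.1) fun h => hkm h.2

end Unshuffle

namespace WordCochain

variable {g : Type*} [AddCommGroup g] {K : Type*} [Field K] [Module K g]

lemma IsMultilinear.fst_zsmul {a : WordCochain g} (ha : IsMultilinear K a) (U V : List (g × g))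
    (n : ℤ) (x y z : g) : a (U ++ (n • x, y) :: V) z = n • a (U ++ (x, y) :: V) z :=
  map_zsmul (ha.fst U V y z).mk' n x

lemma IsMultilinear.snd_zsmul {a : WordCochain g} (ha : IsMultilinear K a) (U V : List (g × g))
    (n : ℤ) (x y z : g) : a (U ++ (x, n • y) :: V) z = n • a (U ++ (x, y) :: V) z :=
  map_zsmul (ha.snd U V x z).mk' n y

lemma IsMultilinear.last_zsmul {a : WordCochain g} (ha : IsMultilinear K a) (W : List (g × g))
    (n : ℤ) (z : g) : a W (n • z) = n • a W z :=
  map_zsmul (ha.last W).mk' n z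

/-- The circle product as a sum over the pair (or last argument) into which `b` is inserted, and
over the distributions of the preceding pairs to `a` and `b`. -/
lemma circ_eq_sum {a : WordCochain g} (ha : IsMultilinear K a) (b : WordCochain g)
    (W : List (g × g)) (z : g) :
    circ a b W z =
      ∑ h ∈ Finset.range W.length, shuffleSum (W.take h) (fun A B =>
          (-1 : ℤ) ^ (A.length * B.length) •
            (a (A ++ (b B (W.getD h 0).1, (W.getD h 0).2) :: W.drop (h + 1)) z
              + a (A ++ ((W.getD h 0).1, b B (W.getD h 0).2) :: W.drop (h + 1)) z))
        + shuffleSum W (fun A B => (-1 : ℤ) ^ (A.length * B.length) • a A (b B z)) := by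
  induction W generalizing a b with
  | nil => simp [circ_nil, shuffleSum]
  | cons X W ih =>
    have hsgn (m n : ℕ) : (-1 : ℤ) ^ m * (-1) ^ (m * (n + 1)) = (-1) ^ (m * n) := by
      rw [mul_add, pow_add, mul_one, mul_left_comm, ← mul_pow]
      simp
    have hsgn' (m n : ℕ) : (-1 : ℤ) ^ ((m + 1) * n) = (-1) ^ (m * n) * (-1) ^ n := by
      rw [add_mul, pow_add, one_mul]
    rw [circ_cons, ih ha, ih (ha.contract X), List.length_cons, Finset.sum_range_succ']
    simp only [contract, parity, List.take_succ_cons, List.getD_cons_succ, List.drop_succ_cons,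
      List.take_zero, List.getD_cons_zero, List.drop_zero, zero_add, shuffleSum, List.length_cons,
      List.length_nil, smul_smul, hsgn, hsgn', List.cons_append, List.nil_append, zero_mul,
      pow_zero, one_smul, Finset.sum_add_distrib, ha.last_zsmul]
    simp only [← List.cons_append, ha.fst_zsmul, ha.snd_zsmul, ← smul_add, smul_smul]
    abel

/-- Concentration in degree `p`. -/
def IsHomogeneous (p : ℕ) (a : WordCochain g) : Prop := ∀ W z, W.length ≠ p → a W z = 0

lemma IsHomogeneous.parity_eq {p : ℕ} {a : WordCochain g} (ha : IsHomogeneous p a) :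
    parity a = (-1 : ℤ) ^ p • a := by
  funext W z
  by_cases h : W.length = p
  · simp [parity, h]
  · simp [parity, ha W z h]

lemma IsMultilinear.fst_zero {a : WordCochain g} (ha : IsMultilinear K a) (U V : List (g × g))
    (y z : g) : a (U ++ (0, y) :: V) z = 0 := (ha.fst U V y z).map_zero

lemma IsMultilinear.snd_zero {a : WordCochain g} (ha : IsMultilinear K a) (U V : List (g × g))
    (x z : g) : a (U ++ (x, 0) :: V) z = 0 := (ha.snd U V x z).map_zero

lemma IsMultilinear.last_zero {a : WordCochain g} (ha : IsMultilinear K a) (W : List (g × g)) :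
    a W 0 = 0 := (ha.last W).map_zero

lemma isHomogeneous_circ {p q : ℕ} {a b : WordCochain g} (ha : IsMultilinear K a)
    (ha' : IsHomogeneous p a) (hb' : IsHomogeneous q b) : IsHomogeneous (p + q) (circ a b) := by
  intro W z hW
  rw [circ_eq_sum ha, Finset.sum_eq_zero, zero_add]
  · refine shuffleSum_eq_zero fun A B hAB => ?_
    by_cases hB : B.length = q
    · rw [ha' A _ (by omega), smul_zero]
    · rw [hb' B _ hB, ha.last_zero, smul_zero]
  · intro h hh
    rw [Finset.mem_range] at hh
    refine shuffleSum_eq_zero fun A B hAB => ?_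
    rw [List.length_take] at hAB
    by_cases hB : B.length = q
    · rw [ha' _ _ (by simp; omega), ha' _ _ (by simp; omega), add_zero, smul_zero]
    · rw [hb' B _ hB, hb' B _ hB, ha.fst_zero, ha.snd_zero, add_zero, smul_zero]

/-- A cochain of degree `p`, extended by zero to words of other lengths. -/
def ofCochain {p : ℕ} (f : Cochain g p) : WordCochain g := fun W z =>
  if W.length = p then f (fun i => (W.getD i 0).1) (fun i => (W.getD i 0).2) z else 0

lemma isHomogeneous_ofCochain {p : ℕ} (f : Cochain g p) : IsHomogeneous p (ofCochain f) :=
  fun _ _ h => if_neg h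

lemma ofCochain_of_eq {p : ℕ} (f : Cochain g p) {W : List (g × g)} {xs ys : Fin p → g} (z : g)
    (hW : W.length = p) (hxs : ∀ i : Fin p, (W.getD i 0).1 = xs i)
    (hys : ∀ i : Fin p, (W.getD i 0).2 = ys i) : ofCochain f W z = f xs ys z := by
  rw [ofCochain, if_pos hW, funext hxs, funext hys]

lemma ofCochain_ofFn {p : ℕ} (f : Cochain g p) (xs ys : Fin p → g) (z : g) :
    ofCochain f (List.ofFn fun i => (xs i, ys i)) z = f xs ys z :=
  ofCochain_of_eq f z (by simp) (by simp) (by simp)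

lemma eq_ofFn_getD {p : ℕ} {W : List (g × g)} (h : W.length = p) :
    W = List.ofFn fun i : Fin p => ((W.getD i 0).1, (W.getD i 0).2) := by
  refine List.ext_getElem (by simpa) fun i hi _ => ?_
  simp [hi]

lemma ofCochain_eq {p : ℕ} {f : Cochain g p} {a : WordCochain g} (ha : IsHomogeneous p a)
    (h : ∀ xs ys z, f xs ys z = a (List.ofFn fun i => (xs i, ys i)) z) : ofCochain f = a := by
  funext W z
  by_cases hW : W.length = p
  · rw [ofCochain, if_pos hW, h, ← eq_ofFn_getD hW]
  · rw [ofCochain, if_neg hW, ha W z hW]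

lemma getD_append_cons {T : Type*} (U V : List T) (X Y : T) (d : T) (i : ℕ) :
    (U ++ X :: V).getD i d = if i = U.length then X else (U ++ Y :: V).getD i d := by
  rcases lt_trichotomy i U.length with h | rfl | h
  · simp [List.getElem?_append, h, h.ne]
  · simp
  · obtain ⟨j, rfl⟩ := Nat.exists_eq_add_of_lt h
    simp [List.getElem?_append, add_assoc]

lemma isMultilinear_ofCochain {p : ℕ} {f : Cochain g p} (hf : IsCochain K p f) :
    IsMultilinear K (ofCochain f) := by
  obtain ⟨h1, h2, h3, h4, h5, h6, -, -⟩ := hf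
  have hzero : IsLinearMap K fun _ : g => (0 : g) := ⟨by simp, by simp⟩
  refine ⟨fun U V y z => ?_, fun U V x z => ?_, fun W => ?_⟩
  · by_cases hp : U.length + V.length + 1 = p
    · have h (x : g) : ofCochain f (U ++ (x, y) :: V) z =
          f (Function.update (fun i : Fin p => ((U ++ 0 :: V).getD i 0).1)
              ⟨U.length, by omega⟩ x) (fun i => ((U ++ (0, y) :: V).getD i 0).2) z := by
        refine ofCochain_of_eq f z (by simp; omega) (fun i => ?_) fun i => ?_
        · rw [getD_append_cons U V _ 0, Function.update_apply]
          simp only [Fin.ext_iff]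
          split_ifs <;> rfl
        · rw [getD_append_cons U V _ (0, y)]
          split_ifs with hi <;> simp [hi]
      simp only [h]
      exact ⟨h1 _ _ _ _, h2 _ _ _ _⟩
    · have h (x : g) : ofCochain f (U ++ (x, y) :: V) z = 0 :=
        isHomogeneous_ofCochain f _ _ (by simp; omega)
      simpa only [h]
  · by_cases hp : U.length + V.length + 1 = p
    · have h (y : g) : ofCochain f (U ++ (x, y) :: V) z =
          f (fun i => ((U ++ (x, 0) :: V).getD i 0).1)
            (Function.update (fun i : Fin p => ((U ++ 0 :: V).getD i 0).2)
              ⟨U.length, by omega⟩ y) z := by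
        refine ofCochain_of_eq f z (by simp; omega) (fun i => ?_) fun i => ?_
        · rw [getD_append_cons U V _ (x, 0)]
          split_ifs with hi <;> simp [hi]
        · rw [getD_append_cons U V _ 0, Function.update_apply]
          simp only [Fin.ext_iff]
          split_ifs <;> rfl
      simp only [h]
      exact ⟨h3 _ _ _ _, h4 _ _ _ _⟩
    · have h (y : g) : ofCochain f (U ++ (x, y) :: V) z = 0 :=
        isHomogeneous_ofCochain f _ _ (by simp; omega)
      simpa only [h]
  · by_cases hp : W.length = p
    · simp only [ofCochain, if_pos hp]
      exact ⟨h5 _ _, h6 _ _⟩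
    · simpa only [ofCochain, if_neg hp]

lemma isPairAlternating_ofCochain {p : ℕ} {f : Cochain g p} (hf : IsCochain K p f) :
    IsPairAlternating (ofCochain f) := by
  intro U V x z
  by_cases hp : U.length + V.length + 1 = p
  · rw [ofCochain, if_pos (by simp; omega)]
    exact hf.2.2.2.2.2.2.1 _ _ _ ⟨U.length, by omega⟩ (by simp)
  · exact isHomogeneous_ofCochain f _ _ (by simp; omega)

lemma isLastAlternating_ofCochain {p : ℕ} {f : Cochain g p} (hf : IsCochain K p f) :
    IsLastAlternating (ofCochain f) := by
  intro U x z
  by_cases hp : U.length + 1 = p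
  · rw [ofCochain, if_pos (by simpa), ofCochain, if_pos (by simpa)]
    exact ⟨hf.2.2.2.2.2.2.2 _ _ _ ⟨U.length, by omega⟩ hp (by simp),
      hf.2.2.2.2.2.2.2 _ _ _ ⟨U.length, by omega⟩ hp (by simp)⟩
  · exact ⟨isHomogeneous_ofCochain f _ _ (by simpa), isHomogeneous_ofCochain f _ _ (by simpa)⟩

lemma ofFn_update {T : Type*} {n : ℕ} (v : Fin n → T) (i : Fin n) (X : T) :
    List.ofFn (Function.update v i X) =
      (List.ofFn v).take i ++ X :: (List.ofFn v).drop (i + 1) := by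
  refine List.ext_getElem (by simp; omega) fun j hj _ => ?_
  simp only [List.length_ofFn] at hj
  rcases lt_trichotomy j i with h | rfl | h
  · simp [h, Fin.ext_iff, h.ne]
  · simp
  · obtain ⟨k, rfl⟩ := Nat.exists_eq_add_of_lt h
    have h2 : i + k + 1 - (i : ℕ) = k + 1 := by omega
    have h3 : (i : ℕ) + 1 + k = i + k + 1 := by omega
    have h4 : ¬ i + k + 1 < (i : ℕ) := by omega
    have h5 : i + k + 1 ≠ (i : ℕ) := by omega
    simp [List.getElem_append, Fin.ext_iff, h2, h3, h4, h5]

lemma isCochain_of_word {p : ℕ} {f : Cochain g p} {a : WordCochain g}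
    (h : ∀ xs ys z, f xs ys z = a (List.ofFn fun i => (xs i, ys i)) z)
    (ha : IsMultilinear K a) (ha' : IsPairAlternating a) (ha'' : IsLastAlternating a) :
    IsCochain K p f := by
  have hpair (xs ys : Fin p → g) (i : Fin p) (x y : g) :
      (List.ofFn fun j => (Function.update xs i x j, Function.update ys i y j)) =
        (List.ofFn fun j => (xs j, ys j)).take i ++
          (x, y) :: (List.ofFn fun j => (xs j, ys j)).drop (i + 1) := by
    rw [← ofFn_update]
    congr 1
    funext j
    by_cases hj : j = i
    · subst hj; simp
    · simp [hj]
  have hfst (xs ys : Fin p → g) (i : Fin p) (x z : g) := by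
    simpa only [Function.update_eq_self, ← h] using congrArg (a · z) (hpair xs ys i x (ys i))
  have hsnd (xs ys : Fin p → g) (i : Fin p) (y z : g) := by
    simpa only [Function.update_eq_self, ← h] using congrArg (a · z) (hpair xs ys i (xs i) y)
  have hself (xs ys : Fin p → g) (i : Fin p) (z : g) := by
    simpa only [Function.update_eq_self, ← h] using congrArg (a · z) (hpair xs ys i (xs i) (ys i))
  refine ⟨fun xs ys z i u v => ?_, fun xs ys z i t u => ?_, fun xs ys z i u v => ?_,
    fun xs ys z i t u => ?_, fun xs ys u v => ?_, fun xs ys t u => ?_, fun xs ys z i hi => ?_,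
    fun xs ys z i hi hz => ?_⟩
  · simp only [hfst]
    exact (ha.fst _ _ _ _).map_add _ _
  · simp only [hfst]
    exact (ha.fst _ _ _ _).map_smul _ _
  · simp only [hsnd]
    exact (ha.snd _ _ _ _).map_add _ _
  · simp only [hsnd]
    exact (ha.snd _ _ _ _).map_smul _ _
  · simp only [h]
    exact (ha.last _).map_add _ _
  · simp only [h]
    exact (ha.last _).map_smul _ _
  · rw [hself xs ys i, hi]
    exact ha' _ _ _ _
  · rw [hself xs ys i, List.drop_eq_nil_of_le (by simp; omega)]
    rcases hz with rfl | rfl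
    · exact (ha'' _ _ _).1
    · exact (ha'' _ _ _).2

lemma circProd_eq {p q : ℕ} {α : Cochain g p} (hα : IsCochain K p α) (β : Cochain g q)
    (xs ys : Fin (p + q) → g) (z : g) :
    circProd p q α β xs ys z =
      circ (ofCochain α) (ofCochain β) (List.ofFn fun i => (xs i, ys i)) z := by
  have hα' := isMultilinear_ofCochain hα
  set v : Fin (p + q) → g × g := fun i => (xs i, ys i) with hv
  have hget (i : ℕ) (hi : i < p + q) : (List.ofFn v).getD i 0 = v ⟨i, hi⟩ := by
    simp [hi]
  rw [circ_eq_sum hα', List.length_ofFn, circProd]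
  congr 1
  · have hsplit (F : ℕ → g) : ∑ h ∈ Finset.range (p + q), F h =
        ∑ h ∈ Finset.range q, F h + ∑ k : Fin p, F (q + k) := by
      rw [add_comm p q, Finset.sum_range_add, Finset.sum_range fun k => F (q + k)]
    rw [hsplit, Finset.sum_eq_zero (s := Finset.range q), zero_add]
    · refine Finset.sum_congr rfl fun k _ => ?_
      have htake : (List.ofFn v).take (q + k) =
          List.ofFn fun i : Fin (k + q) => v ⟨i, by omega⟩ :=
        List.ext_getElem (by simp; omega) fun i _ _ => by simp
      rw [htake, ← sum_unshuffles (k := k) (q := q) rfl (by omega), Finset.smul_sum]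
      · refine Finset.sum_congr rfl fun σ _ => ?_
        have hword (X : g × g) (i : Fin p) :
            ((List.ofFn fun j : Fin k => v (σ ⟨j, by omega⟩)) ++
                X :: (List.ofFn v).drop (q + k + 1)).getD i 0 =
              if (i : ℕ) < k then v (σ (Fin.castLE (Nat.le_add_right p q) i))
              else if (i : ℕ) = k then X else v ⟨i + q, by omega⟩ := by
          rcases lt_trichotomy (i : ℕ) k with h | h | h
          · simp [List.getElem?_append, h, Fin.castLE]
          · simp [h]
          · obtain ⟨j, hj⟩ := Nat.exists_eq_add_of_lt h
            have h1 : (i : ℕ) - k = j + 1 := by omega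
            have h2 : q + k + 1 + j = i + q := by omega
            simp [List.getElem?_append, h.not_gt, h.ne', h1, h2]
        rw [List.length_ofFn, List.length_ofFn, smul_comm, hget _ (by omega), ofCochain_ofFn,
          ofCochain_ofFn]
        congr 3
        · refine (ofCochain_of_eq α z (by simp; omega) (fun i => ?_) fun i => ?_).symm <;>
          · rw [hword]
            split_ifs <;> simp [hv, add_comm]
        · refine (ofCochain_of_eq α z (by simp; omega) (fun i => ?_) fun i => ?_).symm <;>
          · rw [hword]
            split_ifs <;> simp [hv, add_comm]
      · intro A B hA
        rw [isHomogeneous_ofCochain, isHomogeneous_ofCochain, add_zero, smul_zero] <;>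
          simp <;> omega
    · intro h hh
      rw [Finset.mem_range] at hh
      refine shuffleSum_eq_zero fun A B hAB => ?_
      rw [List.length_take] at hAB
      rw [isHomogeneous_ofCochain β B _ (by omega), isHomogeneous_ofCochain β B _ (by omega),
        hα'.fst_zero, hα'.snd_zero, add_zero, smul_zero]
  · refine Eq.trans ?_ (sum_unshuffles (k := p) (q := q) rfl le_rfl v _ ?_)
    · rw [Finset.smul_sum]
      refine Finset.sum_congr rfl fun σ _ => ?_
      rw [List.length_ofFn, List.length_ofFn, smul_comm, ofCochain_ofFn, ofCochain_ofFn]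
      rfl
    · intro A B hA
      rw [isHomogeneous_ofCochain α A _ hA, smul_zero]

lemma isMultilinear_bracket (p q : ℕ) {a b : WordCochain g} (ha : IsMultilinear K a)
    (hb : IsMultilinear K b) : IsMultilinear K (bracket p q a b) := by
  have h1 := isMultilinear_circ ha hb
  have h2 := isMultilinear_circ hb ha
  simp only [bracket, sub_eq_add_neg, ← neg_zsmul]
  exact ⟨fun U V y z => (h1.fst U V y z).fun_add ((h2.fst U V y z).const_zsmul _),
    fun U V x z => (h1.snd U V x z).fun_add ((h2.snd U V x z).const_zsmul _),
    fun W => (h1.last W).fun_add ((h2.last W).const_zsmul _)⟩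

lemma isPairAlternating_bracket (p q : ℕ) {a b : WordCochain g} (ha : IsMultilinear K a)
    (hb : IsMultilinear K b) (ha' : IsPairAlternating a) (hb' : IsPairAlternating b) :
    IsPairAlternating (bracket p q a b) := fun U V x z => by
  rw [bracket, Pi.sub_apply, Pi.sub_apply, Pi.smul_apply, Pi.smul_apply,
    isPairAlternating_circ ha ha' hb', isPairAlternating_circ hb hb' ha', smul_zero, sub_zero]

lemma isLastAlternating_bracket (p q : ℕ) {a b : WordCochain g} (ha : IsMultilinear K a)
    (hb : IsMultilinear K b) (ha' : IsLastAlternating a) (hb' : IsLastAlternating b) :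
    IsLastAlternating (bracket p q a b) := fun U x z => by
  simp only [bracket, Pi.sub_apply, Pi.smul_apply, isLastAlternating_circ ha ha' hb' U x z,
    isLastAlternating_circ hb hb' ha' U x z, smul_zero, sub_zero, and_self]

lemma isHomogeneous_bracket {p q : ℕ} {a b : WordCochain g} (ha : IsMultilinear K a)
    (hb : IsMultilinear K b) (ha' : IsHomogeneous p a) (hb' : IsHomogeneous q b) :
    IsHomogeneous (p + q) (bracket p q a b) := fun W z hW => by
  rw [bracket, Pi.sub_apply, Pi.sub_apply, Pi.smul_apply, Pi.smul_apply,
    isHomogeneous_circ ha ha' hb' W z hW,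
    isHomogeneous_circ hb hb' ha' W z (by rwa [add_comm]), smul_zero, sub_zero]

lemma nrBracket_eq {p q : ℕ} {α : Cochain g p} {β : Cochain g q} (hα : IsCochain K p α)
    (hβ : IsCochain K q β) (xs ys : Fin (p + q) → g) (z : g) :
    nrBracket p q α β xs ys z =
      bracket p q (ofCochain α) (ofCochain β) (List.ofFn fun i => (xs i, ys i)) z := by
  rw [nrBracket, circProd_eq hα, circProd_eq hβ,
    ← List.ofFn_congr (Nat.add_comm p q) fun i => (xs i, ys i)]
  rfl

lemma isCochain_nrBracket {p q : ℕ} {α : Cochain g p} {β : Cochain g q} (hα : IsCochain K p α)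
    (hβ : IsCochain K q β) : IsCochain K (p + q) (nrBracket p q α β) :=
  have ha := isMultilinear_ofCochain hα
  have hb := isMultilinear_ofCochain hβ
  isCochain_of_word (nrBracket_eq hα hβ) (isMultilinear_bracket p q ha hb)
    (isPairAlternating_bracket p q ha hb (isPairAlternating_ofCochain hα)
      (isPairAlternating_ofCochain hβ))
    (isLastAlternating_bracket p q ha hb (isLastAlternating_ofCochain hα)
      (isLastAlternating_ofCochain hβ))

lemma ofCochain_nrBracket {p q : ℕ} {α : Cochain g p} {β : Cochain g q} (hα : IsCochain K p α)
    (hβ : IsCochain K q β) :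
    ofCochain (nrBracket p q α β) = bracket p q (ofCochain α) (ofCochain β) :=
  ofCochain_eq (isHomogeneous_bracket (isMultilinear_ofCochain hα) (isMultilinear_ofCochain hβ)
    (isHomogeneous_ofCochain α) (isHomogeneous_ofCochain β)) (nrBracket_eq hα hβ)

end WordCochain

/-- the bracket `⟦·,·⟧` maps `C^p × C^q` to `C^{p+q}`, is graded
skew-symmetric, and satisfies the graded Jacobi identity; hence
`(⊕ₚ C^p(g,g), ⟦·,·⟧)` is a graded Lie algebra. -/
theorem nrBracket_gradedLie {K : Type*} [Field K] [CharZero K]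
    {g : Type*} [AddCommGroup g] [Module K g] (p q r : ℕ)
    (α : Cochain g p) (β : Cochain g q) (γ : Cochain g r)
    (hα : IsCochain K p α) (hβ : IsCochain K q β) (hγ : IsCochain K r γ) :
    IsCochain K (p + q) (nrBracket p q α β) ∧
    (∀ (xs ys : Fin (p + q) → g) (z : g),
      nrBracket p q α β xs ys z
        = - (((-1 : ℤ) ^ (p * q)) •
            nrBracket q p β α (fun i => xs (Fin.cast (Nat.add_comm q p) i))
              (fun i => ys (Fin.cast (Nat.add_comm q p) i)) z)) ∧
    (∀ (xs ys : Fin (p + q + r) → g) (z : g),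
      nrBracket p (q + r) α (nrBracket q r β γ)
          (fun i => xs (Fin.cast (by omega) i)) (fun i => ys (Fin.cast (by omega) i)) z
        = nrBracket (p + q) r (nrBracket p q α β) γ xs ys z
          + ((-1 : ℤ) ^ (p * q)) •
              nrBracket q (p + r) β (nrBracket p r α γ)
                (fun i => xs (Fin.cast (by omega) i))
                (fun i => ys (Fin.cast (by omega) i)) z) := by
  refine ⟨WordCochain.isCochain_nrBracket hα hβ, fun xs ys z => ?_, fun xs ys z => ?_⟩
  · simp only [nrBracket, Fin.cast_cast, Fin.cast_eq_self, mul_comm q p, smul_sub, smul_smul,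
      ← mul_pow, neg_one_mul, neg_neg, one_pow, one_smul, neg_sub]
  · rw [WordCochain.nrBracket_eq hα (WordCochain.isCochain_nrBracket hβ hγ),
      WordCochain.nrBracket_eq (WordCochain.isCochain_nrBracket hα hβ) hγ,
      WordCochain.nrBracket_eq hβ (WordCochain.isCochain_nrBracket hα hγ),
      WordCochain.ofCochain_nrBracket hβ hγ, WordCochain.ofCochain_nrBracket hα hβ,
      WordCochain.ofCochain_nrBracket hα hγ,
      ← List.ofFn_congr (by omega : p + q + r = p + (q + r)) fun i => (xs i, ys i),
      ← List.ofFn_congr (by omega : p + q + r = q + (p + r)) fun i => (xs i, ys i),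
      WordCochain.bracket_jacobi (K := K) (WordCochain.isMultilinear_ofCochain hα)
        (WordCochain.isMultilinear_ofCochain hβ) (WordCochain.isMultilinear_ofCochain hγ)
        (WordCochain.isHomogeneous_ofCochain α).parity_eq
        (WordCochain.isHomogeneous_ofCochain β).parity_eq
        (WordCochain.isHomogeneous_ofCochain γ).parity_eq]
    rfl
end

section
/- Let (g,[·,·,·]_g) be a 3-Lie algebra over a field K of characteristic 0 with structure map μ ∈ C¹(g,g), μ(x∧y,z) = [x,y,z]_g. Define δ̄: C^p(g,g) → C^{p+1}(g,g) by δ̄α = ⟦μ,α⟧. Then δ̄∘δ̄ = 0 and δ̄ is a degree-1 graded derivation of the bracket: δ̄⟦α,β⟧ = ⟦δ̄α,β⟧ + (−1)^p ⟦α,δ̄β⟧ for all α ∈ C^p(g,g), β ∈ C^q(g,g); hence (⊕_p C^p(g,g), ⟦·,·⟧, δ̄) is a differential graded Lie algebra. -/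
/-- A trilinear bracket on `g` viewed as a degree-1 cochain in `C¹(g,g)`. -/
def toC1 {K : Type*} [Field K] {g : Type*} [AddCommGroup g] [Module K g]
    (b : g →ₗ[K] g →ₗ[K] g →ₗ[K] g) : Cochain g 1 :=
  fun xs ys z => b (xs 0) (ys 0) z

/-- Inhomogeneous cochains: functions of a list of pairs and a final argument. -/
abbrev ListCochain (g : Type*) : Type _ := List (g × g) → g → g

namespace ListCochain

variable {g : Type*} [AddCommGroup g]

/-- Contraction of a cochain with a pair inserted in the first slot. -/
def contract {g : Type*} (X : g × g) (F : ListCochain g) : ListCochain g := fun l => F (X :: l)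

/-- The sign involution, multiplication by `(-1)^p` in degree `p`. -/
def signTwist (F : ListCochain g) : ListCochain g := fun l => (-1 : ℤ) ^ l.length • F l

/-- Contraction with the image of `X` under the derivation induced by `f` on pairs. -/
def contractDer (f : g → g) (X : g × g) (F : ListCochain g) : ListCochain g :=
  contract (f X.1, X.2) F + contract (X.1, f X.2) F

/-- The circle product, defined through its contractions. -/
def circ : ListCochain g → ListCochain g → ListCochain g
  | F, G, [] => fun z => F [] (G [] z)
  | F, G, X :: l =>
      circ (contract X F) (signTwist G) l + circ F (contract X G) l + contractDer (G []) X F l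

/-- Additivity in every argument. -/
structure IsMultiadditive (F : ListCochain g) : Prop where
  fst : ∀ a b x x' y z, F (a ++ (x + x', y) :: b) z = F (a ++ (x, y) :: b) z + F (a ++ (x', y) :: b) z
  snd : ∀ a b x y y' z, F (a ++ (x, y + y') :: b) z = F (a ++ (x, y) :: b) z + F (a ++ (x, y') :: b) z
  last : ∀ l z z', F l (z + z') = F l z + F l z'

/-- `F` vanishes in all degrees whose parity differs from that of `p`. -/
def HasParity (p : ℕ) (F : ListCochain g) : Prop := ∀ l, ¬ Even (l.length + p) → F l = 0

/-- `F` is concentrated in degree `p`. -/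
def HasDegree (p : ℕ) (F : ListCochain g) : Prop := ∀ l, l.length ≠ p → F l = 0

lemma contract_apply {g : Type*} (X : g × g) (F : ListCochain g) (l : List (g × g)) :
    contract X F l = F (X :: l) := rfl

lemma contract_add (X : g × g) (F G : ListCochain g) :
    contract X (F + G) = contract X F + contract X G := rfl

lemma signTwist_add (F G : ListCochain g) : signTwist (F + G) = signTwist F + signTwist G := by
  funext l; simp [signTwist, smul_add]

lemma circ_nil (F G : ListCochain g) (z : g) : circ F G [] z = F [] (G [] z) := rfl

lemma contract_circ (X : g × g) (F G : ListCochain g) :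
    contract X (circ F G) =
      circ (contract X F) (signTwist G) + circ F (contract X G) + contractDer (G []) X F := by
  funext l; simp [contract, circ]

namespace IsMultiadditive

variable {F G : ListCochain g}

lemma contract (hF : F.IsMultiadditive) (X : g × g) : (F.contract X).IsMultiadditive where
  fst a := hF.fst (X :: a)
  snd a := hF.snd (X :: a)
  last l := hF.last (X :: l)

lemma add (hF : F.IsMultiadditive) (hG : G.IsMultiadditive) : (F + G).IsMultiadditive where
  fst a b x x' y z := by simp only [Pi.add_apply, hF.fst, hG.fst]; abel
  snd a b x y y' z := by simp only [Pi.add_apply, hF.snd, hG.snd]; abel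
  last l z z' := by simp only [Pi.add_apply, hF.last, hG.last]; abel

lemma smul (hF : F.IsMultiadditive) (c : ℤ) : (c • F).IsMultiadditive where
  fst a b x x' y z := by simp only [Pi.smul_apply, hF.fst, smul_add]
  snd a b x y y' z := by simp only [Pi.smul_apply, hF.snd, smul_add]
  last l z z' := by simp only [Pi.smul_apply, hF.last, smul_add]

lemma signTwist (hF : F.IsMultiadditive) : F.signTwist.IsMultiadditive where
  fst a b x x' y z := by
    simp [ListCochain.signTwist, hF.fst, smul_add]
  snd a b x y y' z := by
    simp [ListCochain.signTwist, hF.snd, smul_add]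
  last l z z' := by
    simp [ListCochain.signTwist, hF.last, smul_add]

lemma apply_zero (hF : F.IsMultiadditive) (l : List (g × g)) : F l 0 = 0 := by
  simpa using hF.last l 0 0

lemma contractDer_add (hF : F.IsMultiadditive) (f f' : g → g) (X : g × g) :
    contractDer (f + f') X F = contractDer f X F + contractDer f' X F := by
  funext l z
  have h₁ := hF.fst [] l (f X.1) (f' X.1) X.2 z
  have h₂ := hF.snd [] l X.1 (f X.2) (f' X.2) z
  simp only [List.nil_append] at h₁ h₂
  simp only [contractDer, ListCochain.contract, Pi.add_apply, h₁, h₂]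
  abel

lemma contractDer_zero (hF : F.IsMultiadditive) (X : g × g) : contractDer 0 X F = 0 := by
  simpa using hF.contractDer_add 0 0 X

end IsMultiadditive

lemma circ_add_left (F F' G : ListCochain g) : circ (F + F') G = circ F G + circ F' G := by
  suffices h : ∀ l F F' G, circ (F + F') G l = circ F G l + circ F' G l by
    funext l; exact h l F F' G
  intro l
  induction l with
  | nil => intros; rfl
  | cons X l ih =>
    intro F F' G
    simp only [circ, contract_add, ih, contractDer, Pi.add_apply]
    abel

lemma circ_smul_left (c : ℤ) (F G : ListCochain g) : circ (c • F) G = c • circ F G :=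
  (AddMonoidHom.mk' (fun F => circ F G) fun F F' => circ_add_left F F' G).map_zsmul c F |>.trans rfl

lemma circ_zero_left (G : ListCochain g) : circ 0 G = 0 :=
  (AddMonoidHom.mk' (fun F => circ F G) fun F F' => circ_add_left F F' G).map_zero

namespace IsMultiadditive

variable {F G : ListCochain g}

lemma circ_add (hF : F.IsMultiadditive) (G G' : ListCochain g) :
    circ F (G + G') = circ F G + circ F G' := by
  suffices h : ∀ l F G G', IsMultiadditive F → circ F (G + G') l = circ F G l + circ F G' l by
    funext l; exact h l F G G' hF
  intro l
  induction l with
  | nil => intro F G G' hF; funext z; exact hF.last _ _ _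
  | cons X l ih =>
    intro F G G' hF
    simp only [ListCochain.circ, contract_add, signTwist_add, ih _ _ _ hF, ih _ _ _ (hF.contract X),
      Pi.add_apply, hF.contractDer_add]
    abel

lemma circ_smul (hF : F.IsMultiadditive) (c : ℤ) (G : ListCochain g) :
    circ F (c • G) = c • circ F G :=
  (AddMonoidHom.mk' (circ F) hF.circ_add).map_zsmul c G

lemma circ_zero (hF : F.IsMultiadditive) : circ F 0 = 0 :=
  (AddMonoidHom.mk' (circ F) hF.circ_add).map_zero

lemma circ (hF : F.IsMultiadditive) (hG : G.IsMultiadditive) :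
    (ListCochain.circ F G).IsMultiadditive := by
  refine ⟨fun a => ?_, fun a => ?_, fun l => ?_⟩
  · induction a generalizing F G with
    | nil =>
      intro b x x' y z
      have h (H : ListCochain g) (hH : H.IsMultiadditive) :
          ListCochain.contract (x + x', y) H =
            ListCochain.contract (x, y) H + ListCochain.contract (x', y) H := by
        funext l z; exact hH.fst [] l x x' y z
      have h₁ := hF.fst [] b (G [] x) (G [] x') y z
      have h₂ := hF.fst [] b x x' (G [] y) z
      simp only [List.nil_append] at h₁ h₂
      simp only [List.nil_append, ListCochain.circ, h F hF, h G hG, circ_add_left, hF.circ_add,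
        Pi.add_apply, contractDer, contract_apply, hG.last, h₁, h₂]
      abel
    | cons X a ih =>
      intro b x x' y z
      have h₁ := hF.fst ((G [] X.1, X.2) :: a) b x x' y z
      have h₂ := hF.fst ((X.1, G [] X.2) :: a) b x x' y z
      simp only [List.cons_append] at h₁ h₂
      simp only [List.cons_append, ListCochain.circ, Pi.add_apply, contractDer, contract_apply,
        ih (hF.contract X) hG.signTwist, ih hF (hG.contract X), h₁, h₂]
      abel
  · induction a generalizing F G with
    | nil =>
      intro b x y y' z
      have h (H : ListCochain g) (hH : H.IsMultiadditive) :
          ListCochain.contract (x, y + y') H =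
            ListCochain.contract (x, y) H + ListCochain.contract (x, y') H := by
        funext l z; exact hH.snd [] l x y y' z
      have h₁ := hF.snd [] b (G [] x) y y' z
      have h₂ := hF.snd [] b x (G [] y) (G [] y') z
      simp only [List.nil_append] at h₁ h₂
      simp only [List.nil_append, ListCochain.circ, h F hF, h G hG, circ_add_left, hF.circ_add,
        Pi.add_apply, contractDer, contract_apply, hG.last, h₁, h₂]
      abel
    | cons X a ih =>
      intro b x y y' z
      have h₁ := hF.snd ((G [] X.1, X.2) :: a) b x y y' z
      have h₂ := hF.snd ((X.1, G [] X.2) :: a) b x y y' z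
      simp only [List.cons_append] at h₁ h₂
      simp only [List.cons_append, ListCochain.circ, Pi.add_apply, contractDer, contract_apply,
        ih (hF.contract X) hG.signTwist, ih hF (hG.contract X), h₁, h₂]
      abel
  · induction l generalizing F G with
    | nil => intro z z'; simp only [ListCochain.circ, hG.last, hF.last]
    | cons X l ih =>
      intro z z'
      simp only [ListCochain.circ, Pi.add_apply, contractDer, contract_apply,
        ih (hF.contract X) hG.signTwist, ih hF (hG.contract X), hF.last]
      abel

end IsMultiadditive

lemma HasParity.contract {p : ℕ} {F : ListCochain g} (hF : F.HasParity p) (X : g × g) :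
    (F.contract X).HasParity (p + 1) := fun l hl =>
  hF (X :: l) (by rwa [List.length_cons, add_right_comm, add_assoc])

lemma HasParity.signTwist_eq {p : ℕ} {F : ListCochain g} (hF : F.HasParity p) :
    F.signTwist = (-1 : ℤ) ^ p • F := by
  funext l
  by_cases h : Even (l.length + p)
  · have : (-1 : ℤ) ^ l.length = (-1 : ℤ) ^ p := by
      rcases Nat.even_or_odd p with hp | hp
      · rw [hp.neg_one_pow, ((Nat.even_add.mp h).mpr hp).neg_one_pow]
      · rw [hp.neg_one_pow, Odd.neg_one_pow]
        exact Nat.not_even_iff_odd.mp fun hl =>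
          Nat.not_even_iff_odd.mpr hp ((Nat.even_add.mp h).mp hl)
    simp [signTwist, this]
  · simp [signTwist, hF l h]

lemma HasParity.smul {p : ℕ} {F : ListCochain g} (hF : F.HasParity p) (c : ℤ) :
    (c • F).HasParity p := fun l hl => by
  simp [hF l hl]

lemma HasParity.circ {p q : ℕ} {F G : ListCochain g} (hF : F.HasParity p) (hG : G.HasParity q)
    (hF' : F.IsMultiadditive) : (circ F G).HasParity (p + q) := by
  intro l
  induction l generalizing p q F G with
  | nil =>
    intro h
    funext z
    rw [circ_nil]
    by_cases hq : Even q
    · have hp : ¬ Even p := fun hp => h (by simpa using hp.add hq)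
      rw [hF [] (by simpa using hp)]; rfl
    · rw [hG [] (by simpa using hq)]; exact hF'.apply_zero _
  | cons X l ih =>
    intro h
    rw [ListCochain.circ, hG.signTwist_eq,
      ih (hF.contract X) (hG.smul _) (hF'.contract X) (by convert h using 2; simp; ring),
      ih hF (hG.contract X) hF' (by convert h using 2; simp; ring)]
    by_cases hq : Even q
    · have hp : ¬ Even (l.length + 1 + p) := fun hp => h (by simpa [add_assoc] using hp.add hq)
      funext z
      have := fun Y : g × g => congrFun (hF (Y :: l) (by simpa using hp)) z
      simp [contractDer, contract_apply, this]
    · simp [hG [] (by simpa using hq), hF'.contractDer_zero]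

lemma HasDegree.hasParity {p : ℕ} {F : ListCochain g} (hF : F.HasDegree p) : F.HasParity p :=
  fun l hl => hF l fun h => hl (by rw [h]; exact Even.add_self p)

/-- The associator of the circle product. -/
def associator (F G H : ListCochain g) : ListCochain g := circ (circ F G) H - circ F (circ G H)

lemma contract_associator {q r : ℕ} {F G H : ListCochain g} (hF : F.IsMultiadditive)
    (hG' : G.IsMultiadditive) (hG : G.HasParity q) (hH : H.HasParity r) (X : g × g) :
    contract X (associator F G H) =
      ((-1 : ℤ) ^ (q + r) • associator (contract X F) G H +
        (-1 : ℤ) ^ r • associator F (contract X G) H + associator F G (contract X H)) +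
      ((-1 : ℤ) ^ r • circ (contractDer (G []) X F) H +
        (-1 : ℤ) ^ q • circ (contractDer (H []) X F) G +
        (contract (G [] X.1, H [] X.2) F + contract (H [] X.1, G [] X.2) F)) := by
  have hGH : (circ G H).HasParity (q + r) := hG.circ hH hG'
  have hsub : contract X (associator F G H) =
    contract X (circ (circ F G) H) - contract X (circ F (circ G H)) := rfl
  have hc : ∀ Y, contract Y (circ F G) =
      (-1 : ℤ) ^ q • circ (contract Y F) G + circ F (contract Y G) + contractDer (G []) Y F := by
    intro Y
    rw [contract_circ, hG.signTwist_eq, (hF.contract Y).circ_smul]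
  have hd : contractDer (H []) X (circ F G) =
      (-1 : ℤ) ^ q • circ (contractDer (H []) X F) G + circ F (contractDer (H []) X G) +
        (contractDer (G []) (H [] X.1, X.2) F + contractDer (G []) (X.1, H [] X.2) F) := by
    rw [contractDer, hc, hc, contractDer.eq_1 (H []) X F, contractDer.eq_1 (H []) X G,
      circ_add_left, hF.circ_add, smul_add]
    abel
  have he : contractDer (circ G H []) X F =
      contract (G [] (H [] X.1), X.2) F + contract (X.1, G [] (H [] X.2)) F := rfl
  rw [hsub, contract_circ, contract_circ X F (circ G H), hH.signTwist_eq, hGH.signTwist_eq,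
    contract_circ X G H, hH.signTwist_eq, ((hF.circ hG').contract X).circ_smul, hF.circ_add,
    hF.circ_add, (hF.contract X).circ_smul, (hG'.contract X).circ_smul, hF.circ_smul, hc X,
    hd, he]
  simp only [contractDer, circ_add_left, circ_smul_left, hF.circ_add, associator, smul_add, smul_sub, smul_smul, ← pow_add,
    add_comm r q]
  abel

/-- The circle product is graded right-symmetric. -/
theorem associator_swap {q r : ℕ} {F G H : ListCochain g} (hF : F.IsMultiadditive)
    (hG' : G.IsMultiadditive) (hH' : H.IsMultiadditive) (hG : G.HasParity q) (hH : H.HasParity r) :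
    associator F G H = (-1 : ℤ) ^ (q * r) • associator F H G := by
  funext l
  induction l generalizing q r F G H with
  | nil =>
    funext z
    simp [associator, circ_nil]
  | cons X l ih =>
    have e₁ := congrFun (contract_associator hF hG' hG hH X) l
    have e₂ := congrFun (contract_associator hF hH' hH hG X) l
    rw [contract_apply] at e₁ e₂
    have i₁ := ih (hF.contract X) hG' hH' hG hH
    have i₂ := ih hF (hG'.contract X) hH' (hG.contract X) hH
    have i₃ := ih hF hG' (hH'.contract X) hG (hH.contract X)
    simp only [Pi.smul_apply, Pi.add_apply] at e₁ e₂ i₁ i₂ i₃ ⊢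
    rw [e₁, e₂, i₁, i₂, i₃]
    have hz : ∀ y z, F ((0, y) :: l) z = 0 := fun y z => by
      simpa using hF.fst [] l 0 0 y z
    have hz' : ∀ x z, F ((x, 0) :: l) z = 0 := fun x z => by
      simpa using hF.snd [] l x 0 0 z
    rcases Nat.even_or_odd q with hq | hq <;> rcases Nat.even_or_odd r with hr | hr
    · simp only [pow_add, hq.neg_one_pow, hr.neg_one_pow, (hq.mul_right r).neg_one_pow,
        (hq.mul_right (r + 1)).neg_one_pow, (hr.mul_left (q + 1)).neg_one_pow]
      module
    · have h0 : H [] = 0 := hH [] (by simpa using hr)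
      simp only [pow_add, hq.neg_one_pow, hr.neg_one_pow, (hq.mul_right r).neg_one_pow,
        (hq.mul_right (r + 1)).neg_one_pow, (hq.add_one.mul hr).neg_one_pow, h0,
        hF.contractDer_zero, circ_zero_left]
      funext z
      simp only [Pi.add_apply, Pi.smul_apply, Pi.zero_apply, contract_apply, hz, hz']
      module
    · have h0 : G [] = 0 := hG [] (by simpa using hq)
      simp only [pow_add, hq.neg_one_pow, hr.neg_one_pow, (hr.mul_left q).neg_one_pow,
        (hq.mul hr.add_one).neg_one_pow, (hr.mul_left (q + 1)).neg_one_pow, h0,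
        hF.contractDer_zero, circ_zero_left]
      funext z
      simp only [Pi.add_apply, Pi.smul_apply, Pi.zero_apply, contract_apply, hz, hz']
      module
    · have h0 : G [] = 0 := hG [] (by simpa using hq)
      have h0' : H [] = 0 := hH [] (by simpa using hr)
      simp only [pow_add, hq.neg_one_pow, hr.neg_one_pow, (hq.mul hr).neg_one_pow,
        (hr.add_one.mul_left q).neg_one_pow, (hq.add_one.mul_right r).neg_one_pow, h0, h0',
        hF.contractDer_zero, circ_zero_left]
      funext z
      simp only [Pi.add_apply, Pi.smul_apply, Pi.zero_apply, contract_apply, hz]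
      module

end ListCochain

namespace ListCochain

/-- The sum over `(k, q)`-unshuffles of the first `k + q` entries of a list. -/
def shuffleSum {W A : Type*} [AddCommGroup A] :
    ℕ → ℕ → (List W → List W → List W → A) → List W → A
  | 0, 0, Φ, l => Φ [] [] l
  | _ + 1, _, _, [] => 0
  | _, _ + 1, _, [] => 0
  | k + 1, 0, Φ, X :: l => shuffleSum k 0 (fun a => Φ (X :: a)) l
  | 0, q + 1, Φ, X :: l => shuffleSum 0 q (fun a b => Φ a (X :: b)) l
  | k + 1, q + 1, Φ, X :: l =>
      shuffleSum k (q + 1) (fun a => Φ (X :: a)) l +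
        (-1 : ℤ) ^ (k + 1) • shuffleSum (k + 1) q (fun a b => Φ a (X :: b)) l

variable {g : Type*} [AddCommGroup g]

/-- Insertion of `G`, acting as a derivation on pairs, into a pair slot of `F`. -/
def insertPair (F G : ListCochain g) : List (g × g) → List (g × g) → List (g × g) → g → g
  | _, _, [] => 0
  | a, b, Y :: c => F (a ++ (G b Y.1, Y.2) :: c) + F (a ++ (Y.1, G b Y.2) :: c)

/-- Insertion of `G` into the last slot of `F`. -/
def insertLast (F G : ListCochain g) (a b _ : List (g × g)) : g → g := fun z => F a (G b z)

lemma HasDegree.contract {p : ℕ} {F : ListCochain g} (hF : F.HasDegree (p + 1)) (X : g × g) :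
    (F.contract X).HasDegree p := fun l hl => hF (X :: l) (by simpa using hl)

lemma HasDegree.contract_eq_zero {F : ListCochain g} (hF : F.HasDegree 0) (X : g × g) :
    F.contract X = 0 := funext fun l => hF (X :: l) (by simp)

lemma HasDegree.circ {p q : ℕ} {F G : ListCochain g} (hF : F.HasDegree p) (hG : G.HasDegree q)
    (hF' : F.IsMultiadditive) : (circ F G).HasDegree (p + q) := by
  intro l
  induction l generalizing p q F G with
  | nil =>
    intro h
    funext z
    rw [circ_nil]
    by_cases hq : q = 0
    · rw [hF [] (by simp at h ⊢; omega)]; rfl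
    · rw [hG [] (by simpa [eq_comm] using hq)]; exact hF'.apply_zero _
  | cons X l ih =>
    intro h
    simp only [List.length_cons] at h
    have h₁ : ListCochain.circ (ListCochain.contract X F) (signTwist G) l = 0 := by
      rcases p with _ | p
      · rw [hF.contract_eq_zero, circ_zero_left]; rfl
      · exact ih (p := p) (q := q) (hF.contract X) (fun m hm => by simp [signTwist, hG m hm]) (hF'.contract X)
          (by omega)
    have h₂ : ListCochain.circ F (ListCochain.contract X G) l = 0 := by
      rcases q with _ | q
      · rw [hG.contract_eq_zero, hF'.circ_zero]; rfl
      · exact ih hF (hG.contract X) hF' (by omega)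
    rw [ListCochain.circ, h₁, h₂]
    rcases q with _ | q
    · have := fun Y : g × g => hF (Y :: l) (by simpa using h)
      simp [contractDer, contract_apply, this]
    · simp [hG [] (by simp), hF'.contractDer_zero]

/-- The graded commutator of the circle product. -/
def bracket (p q : ℕ) (F G : ListCochain g) : ListCochain g :=
  circ F G - (-1 : ℤ) ^ (p * q) • circ G F

lemma HasDegree.bracket {p q : ℕ} {F G : ListCochain g} (hF : F.HasDegree p) (hG : G.HasDegree q)
    (hF' : F.IsMultiadditive) (hG' : G.IsMultiadditive) :
    (bracket p q F G).HasDegree (p + q) := fun l hl => by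
  simp [ListCochain.bracket, hF.circ hG hF' l hl, hG.circ hF hG' l (by omega)]

lemma IsMultiadditive.bracket {F G : ListCochain g} (hF : F.IsMultiadditive)
    (hG : G.IsMultiadditive) (p q : ℕ) : (bracket p q F G).IsMultiadditive := by
  rw [ListCochain.bracket, sub_eq_add_neg, ← neg_smul]
  exact (hF.circ hG).add ((hG.circ hF).smul _)

lemma circ_sub_left (F F' G : ListCochain g) : circ (F - F') G = circ F G - circ F' G :=
  (AddMonoidHom.mk' (fun F => circ F G) fun F F' => circ_add_left F F' G).map_sub F F'

lemma IsMultiadditive.circ_sub {F : ListCochain g} (hF : F.IsMultiadditive)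
    (G G' : ListCochain g) :
    ListCochain.circ F (G - G') = ListCochain.circ F G - ListCochain.circ F G' :=
  (AddMonoidHom.mk' (ListCochain.circ F) hF.circ_add).map_sub G G'

/-- The graded Jacobi identity, for a first argument of degree one. -/
theorem bracket_bracket {p q : ℕ} {M F G : ListCochain g} (hM : M.HasDegree 1)
    (hF : F.HasDegree p) (hG : G.HasDegree q) (hM' : M.IsMultiadditive) (hF' : F.IsMultiadditive)
    (hG' : G.IsMultiadditive) :
    bracket 1 (p + q) M (bracket p q F G) =
      bracket (1 + p) q (bracket 1 p M F) G +
        (-1 : ℤ) ^ p • bracket p (1 + q) F (bracket 1 q M G) := by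
  have h₁ := associator_swap hM' hF' hG' hF.hasParity hG.hasParity
  have h₂ := associator_swap hF' hM' hG' hM.hasParity hG.hasParity
  have h₃ := associator_swap hG' hM' hF' hM.hasParity hF.hasParity
  simp only [bracket, circ_sub_left, hM'.circ_sub, hF'.circ_sub, hG'.circ_sub, circ_smul_left,
    hM'.circ_smul, hF'.circ_smul, hG'.circ_smul, add_mul, mul_add, pow_add, one_mul, mul_one]
  simp only [associator, one_mul] at h₁ h₂ h₃
  rw [sub_eq_iff_eq_add] at h₁ h₂ h₃
  rw [h₁, h₂, h₃]
  rcases neg_one_pow_eq_or ℤ p with hp | hp <;> rcases neg_one_pow_eq_or ℤ q with hq | hq <;>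
    rcases neg_one_pow_eq_or ℤ (p * q) with hpq | hpq <;> rw [hp, hq, hpq] <;> module

/-- A multiadditive cochain of degree one and square zero defines a differential. -/
theorem bracket_bracket_self {p : ℕ} {M F : ListCochain g} (hg : ∀ x : g, (2 : ℤ) • x = 0 → x = 0)
    (hM : M.HasDegree 1) (hF : F.HasDegree p) (hM' : M.IsMultiadditive)
    (hF' : F.IsMultiadditive) (h : circ M M = 0) : bracket 1 (1 + p) M (bracket 1 p M F) = 0 := by
  have h₁ := associator_swap hM' hM' hF' hM.hasParity hF.hasParity
  have h₂ := associator_swap hF' hM' hM' hM.hasParity hM.hasParity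
  have h₃ : circ (circ F M) M = 0 := by
    simp only [associator, h, hF'.circ_zero, sub_zero, mul_one, pow_one, neg_smul, one_smul] at h₂
    funext l z
    refine hg _ ?_
    rw [two_smul]
    nth_rewrite 1 [h₂]
    simp
  simp only [associator, h, circ_zero_left, one_mul, zero_sub] at h₁
  simp only [bracket, circ_sub_left, hM'.circ_sub, circ_smul_left, hM'.circ_smul, h₃, mul_add,
    pow_add, one_mul, mul_one]
  rw [neg_eq_iff_eq_neg] at h₁
  rw [h₁]
  rcases neg_one_pow_eq_or ℤ p with hp | hp <;> rw [hp] <;> module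

theorem circ_eq_sum_shuffleSum {p q : ℕ} {F G : ListCochain g} (hF : F.HasDegree p)
    (hG : G.HasDegree q) (hF' : F.IsMultiadditive) (l : List (g × g)) (hl : l.length = p + q) :
    circ F G l = ∑ k ∈ Finset.range p, (-1 : ℤ) ^ (k * q) • shuffleSum k q (insertPair F G) l +
      (-1 : ℤ) ^ (p * q) • shuffleSum p q (insertLast F G) l := by
  induction l generalizing p q F G with
  | nil =>
    simp only [List.length_nil] at hl
    obtain ⟨rfl, rfl⟩ : p = 0 ∧ q = 0 := by omega
    simp only [circ, shuffleSum, Finset.range_zero, Finset.sum_empty, zero_mul, pow_zero, one_smul,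
      zero_add]
    rfl
  | cons X l ih =>
    rw [circ, hG.hasParity.signTwist_eq, (hF'.contract X).circ_smul]
    simp only [List.length_cons] at hl
    have e₁ : (fun a => insertPair F G (X :: a)) = insertPair (contract X F) G := by
      funext a b c; cases c <;> rfl
    rcases p with _ | p <;> rcases q with _ | q
    · omega
    · rw [hF.contract_eq_zero, circ_zero_left, ih hF (hG.contract X) hF' (by omega), hG [] (by simp),
        hF'.contractDer_zero]
      simp only [Finset.range_zero, Finset.sum_empty, shuffleSum, zero_mul, Pi.zero_apply,
        smul_zero, zero_add, add_zero, Pi.smul_apply]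
      rfl
    · rw [hG.contract_eq_zero, hF'.circ_zero, Pi.smul_apply,
        ih (hF.contract X) hG (hF'.contract X) (by omega), Finset.sum_range_succ']
      simp only [shuffleSum, mul_zero, pow_zero, one_smul, Pi.zero_apply, add_zero]
      simp only [e₁]
      rw [add_right_comm]
      rfl
    · rw [Pi.smul_apply, ih (hF.contract X) hG (hF'.contract X) (by omega),
        ih hF (hG.contract X) hF' (by omega), hG [] (by simp), hF'.contractDer_zero,
        Finset.sum_range_succ', Finset.sum_range_succ']
      have e₂ : (fun a b => insertPair F G a (X :: b)) = insertPair F (contract X G) := by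
        funext a b c; cases c <;> rfl
      have e₃ : (fun a => insertLast F G (X :: a)) = insertLast (contract X F) G := rfl
      have e₄ : (fun a b => insertLast F G a (X :: b)) = insertLast F (contract X G) := rfl
      have hs : ∀ k : ℕ, (-1 : ℤ) ^ ((k + 1) * (q + 1)) * (-1) ^ (k + 1) = (-1) ^ ((k + 1) * q) := by
        intro k
        rw [← pow_add, show (k + 1) * (q + 1) + (k + 1) = (k + 1) * q + 2 * (k + 1) by ring, pow_add,
          pow_mul _ 2]
        simp
      have hs' : ∀ k : ℕ, (-1 : ℤ) ^ ((k + 1) * (q + 1)) = (-1) ^ (q + 1) * (-1) ^ (k * (q + 1)) :=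
        fun k => by rw [← pow_add]; congr 1; ring
      simp only [shuffleSum, e₁, e₂, e₃, e₄, smul_add, smul_smul, hs, Finset.sum_add_distrib,
        Finset.smul_sum, zero_mul, pow_zero, one_smul, Pi.zero_apply, add_zero]
      simp only [hs']
      abel

end ListCochain

/-- The permutation of `Fin (n + 1)` sending `j` to `0` and restricting to `σ` on the complements. -/
def liftPerm {n : ℕ} (j : Fin (n + 1)) (σ : Equiv.Perm (Fin n)) : Equiv.Perm (Fin (n + 1)) :=
  Equiv.Perm.decomposeFin.symm (0, σ) * j.cycleRange

section liftPerm

variable {n : ℕ}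

lemma liftPerm_self (j : Fin (n + 1)) (σ : Equiv.Perm (Fin n)) : liftPerm j σ j = 0 := by
  simp [liftPerm]

lemma liftPerm_succAbove (j : Fin (n + 1)) (σ : Equiv.Perm (Fin n)) (i : Fin n) :
    liftPerm j σ (j.succAbove i) = (σ i).succ := by
  simp [liftPerm]

lemma sign_liftPerm (j : Fin (n + 1)) (σ : Equiv.Perm (Fin n)) :
    ((liftPerm j σ).sign : ℤ) = (-1) ^ (j : ℕ) * (σ.sign : ℤ) := by
  simp [liftPerm, Fin.sign_cycleRange, mul_comm]

lemma liftPerm_injective (j : Fin (n + 1)) : Function.Injective (liftPerm j) := by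
  intro σ τ h
  simpa using Equiv.Perm.decomposeFin.symm.injective (mul_right_cancel h)

lemma exists_liftPerm_eq {j : Fin (n + 1)} {σ : Equiv.Perm (Fin (n + 1))} (h : σ j = 0) :
    ∃ τ, liftPerm j τ = σ := by
  set ρ := σ * j.cycleRange⁻¹ with hρ
  have h0 : (Equiv.Perm.decomposeFin ρ).1 = 0 := by
    have : j.cycleRange⁻¹ 0 = j := by
      rw [Equiv.Perm.inv_eq_iff_eq, Fin.cycleRange_self]
    have hz : ρ 0 = 0 := by rw [hρ, Equiv.Perm.mul_apply, this, h]
    rw [← Equiv.Perm.decomposeFin.symm_apply_apply ρ,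
      ← Prod.mk.eta (p := Equiv.Perm.decomposeFin ρ),
      Equiv.Perm.decomposeFin_symm_apply_zero] at hz
    exact hz
  refine ⟨(Equiv.Perm.decomposeFin ρ).2, ?_⟩
  rw [liftPerm, ← h0, Prod.mk.eta, Equiv.symm_apply_apply, hρ, inv_mul_cancel_right]

lemma mem_unshuffles {k m : ℕ} {σ : Equiv.Perm (Fin n)} : σ ∈ unshuffles n k m ↔
    (∀ i : Fin n, m ≤ (i : ℕ) → σ i = i) ∧
    (∀ i j : Fin n, (i : ℕ) < (j : ℕ) → (j : ℕ) < k → σ i < σ j) ∧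
    (∀ i j : Fin n, k ≤ (i : ℕ) → (i : ℕ) < (j : ℕ) → (j : ℕ) < m → σ i < σ j) := by
  simp [unshuffles]

lemma liftPerm_zero_mem_unshuffles {k m : ℕ} {σ : Equiv.Perm (Fin n)} :
    liftPerm 0 σ ∈ unshuffles (n + 1) (k + 1) (m + 1) ↔ σ ∈ unshuffles n k m := by
  have h0 := liftPerm_self 0 σ
  have hs := liftPerm_succAbove 0 σ
  simp only [Fin.succAbove_zero] at hs
  simp [mem_unshuffles, Fin.forall_fin_succ, h0, hs]

lemma val_succAbove (j : Fin (n + 1)) (i : Fin n) :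
    (j.succAbove i : ℕ) = if (i : ℕ) < j then (i : ℕ) else i + 1 := by
  simp only [Fin.succAbove, Fin.lt_def, Fin.val_castSucc]
  split_ifs <;> rfl

lemma liftPerm_mem_unshuffles {m : ℕ} {j : Fin (n + 1)} (hj : (j : ℕ) ≤ m)
    {σ : Equiv.Perm (Fin n)} :
    liftPerm j σ ∈ unshuffles (n + 1) j (m + 1) ↔ σ ∈ unshuffles n j m := by
  have hv := val_succAbove j
  have e₁ : ∀ i : Fin n, (m + 1 ≤ (j.succAbove i : ℕ) → (σ i).succ = j.succAbove i) ↔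
      (m ≤ (i : ℕ) → σ i = i) := by
    intro i
    rw [Fin.ext_iff, Fin.ext_iff, Fin.val_succ, hv]
    split_ifs <;> omega
  have e₂ : ∀ (i i' : Fin n) (P : Prop), ((j.succAbove i : ℕ) < j.succAbove i' →
      (j.succAbove i' : ℕ) < j → P) ↔ ((i : ℕ) < i' → (i' : ℕ) < j → P) := by
    intro i i' P
    rw [hv, hv]
    split_ifs <;> refine ⟨fun h a b => ?_, fun h a b => ?_⟩ <;>
      exact h (by omega) (by omega)
  have e₃ : ∀ (i i' : Fin n) (P : Prop), ((j : ℕ) ≤ j.succAbove i →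
      (j.succAbove i : ℕ) < j.succAbove i' → (j.succAbove i' : ℕ) < m + 1 → P) ↔
      ((j : ℕ) ≤ i → (i : ℕ) < i' → (i' : ℕ) < m → P) := by
    intro i i' P
    rw [hv, hv]
    split_ifs <;> refine ⟨fun h a b c => ?_, fun h a b c => ?_⟩ <;>
      exact h (by omega) (by omega) (by omega)
  have e₄ : ∀ (a : ℕ) (P : Prop), ((j : ℕ) ≤ a → a < j → P) ↔ True :=
    fun a P => ⟨fun _ => trivial, fun _ h h' => absurd h' (not_lt.mpr h)⟩
  have e₅ : ¬ m + 1 ≤ (j : ℕ) := by omega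
  rw [mem_unshuffles, mem_unshuffles]
  simp only [Fin.forall_iff_succAbove j, liftPerm_self, liftPerm_succAbove, Fin.succ_lt_succ_iff,
    e₁, e₂, e₃, e₄, e₅, Fin.succ_pos, lt_irrefl, false_imp_iff, imp_true_iff, true_and]

lemma apply_eq_zero_of_mem_unshuffles {k m : ℕ} {σ : Equiv.Perm (Fin (n + 1))}
    (h : σ ∈ unshuffles (n + 1) k (m + 1)) :
    (0 < k ∧ σ 0 = 0) ∨ ∃ j : Fin (n + 1), (j : ℕ) = k ∧ k ≤ m ∧ σ j = 0 := by
  rw [mem_unshuffles] at h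
  obtain ⟨h₁, h₂, h₃⟩ := h
  obtain ⟨j, hj⟩ := σ.surjective 0
  have hjm : (j : ℕ) ≤ m := by
    by_contra hc
    have := h₁ j (by omega)
    rw [hj] at this
    simp [← this] at hc
  rcases lt_trichotomy (j : ℕ) k with hk | hk | hk
  · left
    refine ⟨by omega, ?_⟩
    by_cases h0 : (j : ℕ) = 0
    · obtain rfl : j = 0 := Fin.ext h0
      exact hj
    · have := h₂ 0 j (by simpa using Nat.pos_of_ne_zero h0) hk
      simp [hj] at this
  · exact Or.inr ⟨j, hk, by omega, hj⟩
  · have := h₃ ⟨k, by omega⟩ j le_rfl hk (by omega)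
    simp [hj] at this

end liftPerm

section unshuffleSum

variable {W A : Type*} [AddCommGroup A]

/-- The signed sum of `Ψ` over all `(k, m - k)`-unshuffles of the first `m` entries of `X`. -/
noncomputable def unshuffleSum {n : ℕ} (k m : ℕ) (Ψ : List W → A) (X : Fin n → W) : A :=
  ∑ σ ∈ unshuffles n k m, (Equiv.Perm.sign σ : ℤ) • Ψ (List.ofFn fun i => X (σ i))

lemma unshuffleSum_zero {n : ℕ} (Ψ : List W → A) (X : Fin n → W) :
    unshuffleSum 0 0 Ψ X = Ψ (List.ofFn X) := by
  have : unshuffles n 0 0 = {1} := by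
    ext σ
    simp [mem_unshuffles, Equiv.ext_iff]
  simp [unshuffleSum, this]

lemma ofFn_eq_take_append_cons_drop {n : ℕ} (j : Fin (n + 1)) (Y : Fin (n + 1) → W) :
    List.ofFn Y = (List.ofFn fun i => Y (j.succAbove i)).take j ++
      Y j :: (List.ofFn fun i => Y (j.succAbove i)).drop j := by
  have hj := j.isLt
  apply List.ext_getElem
  · simp; omega
  · intro i h₁ h₂
    simp only [List.length_ofFn] at h₁
    rw [List.getElem_append]
    simp only [List.length_take, List.length_ofFn, List.getElem_ofFn, List.getElem_take]
    split_ifs with h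
    · congr 1; ext; rw [val_succAbove, if_pos (by simpa using by omega)]
    · rw [List.getElem_cons]
      split_ifs with h'
      · congr 1; ext; simp; omega
      · simp only [List.getElem_drop, List.getElem_ofFn]
        congr 1; ext; rw [val_succAbove]; simp only; rw [if_neg (by omega)]; omega

lemma sum_liftPerm {n : ℕ} (j : Fin (n + 1)) (k m : ℕ) (Ψ : List W → A) (X : Fin (n + 1) → W) :
    ∑ σ ∈ (unshuffles n k m).image (liftPerm j),
        (Equiv.Perm.sign σ : ℤ) • Ψ (List.ofFn fun i => X (σ i)) =
      (-1 : ℤ) ^ (j : ℕ) • unshuffleSum k m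
        (fun l => Ψ (l.take j ++ X 0 :: l.drop j)) (fun i => X i.succ) := by
  rw [Finset.sum_image fun _ _ _ _ h => liftPerm_injective j h, unshuffleSum, Finset.smul_sum]
  refine Finset.sum_congr rfl fun σ _ => ?_
  rw [ofFn_eq_take_append_cons_drop j, sign_liftPerm, smul_smul]
  simp only [liftPerm_self, liftPerm_succAbove]

lemma unshuffleSum_zero_left {n m : ℕ} (Ψ : List W → A) (X : Fin (n + 1) → W) :
    unshuffleSum 0 (m + 1) Ψ X =
      unshuffleSum 0 m (fun l => Ψ (X 0 :: l)) (fun i => X i.succ) := by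
  have : unshuffles (n + 1) 0 (m + 1) = (unshuffles n 0 m).image (liftPerm 0) := by
    ext σ
    rw [Finset.mem_image]
    constructor
    · intro h
      rcases apply_eq_zero_of_mem_unshuffles h with ⟨h', -⟩ | ⟨j, hj, -, h0⟩
      · omega
      · obtain rfl : j = 0 := Fin.ext hj
        obtain ⟨τ, rfl⟩ := exists_liftPerm_eq h0
        exact ⟨τ, (liftPerm_mem_unshuffles (j := 0) (by simp)).mp h, rfl⟩
    · rintro ⟨τ, h, rfl⟩
      exact (liftPerm_mem_unshuffles (j := 0) (by simp)).mpr h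
  rw [unshuffleSum, this, sum_liftPerm]
  simp

lemma unshuffleSum_self {n m : ℕ} (Ψ : List W → A) (X : Fin (n + 1) → W) :
    unshuffleSum (m + 1) (m + 1) Ψ X =
      unshuffleSum m m (fun l => Ψ (X 0 :: l)) (fun i => X i.succ) := by
  have : unshuffles (n + 1) (m + 1) (m + 1) = (unshuffles n m m).image (liftPerm 0) := by
    ext σ
    rw [Finset.mem_image]
    constructor
    · intro h
      rcases apply_eq_zero_of_mem_unshuffles h with ⟨-, h0⟩ | ⟨j, -, hm, -⟩
      · obtain ⟨τ, rfl⟩ := exists_liftPerm_eq h0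
        exact ⟨τ, liftPerm_zero_mem_unshuffles.mp h, rfl⟩
      · omega
    · rintro ⟨τ, h, rfl⟩
      exact liftPerm_zero_mem_unshuffles.mpr h
  rw [unshuffleSum, this, sum_liftPerm]
  simp

lemma unshuffleSum_succ {n k m : ℕ} (hk : k + 1 ≤ m) (hm : m ≤ n) (Ψ : List W → A)
    (X : Fin (n + 1) → W) :
    unshuffleSum (k + 1) (m + 1) Ψ X =
      unshuffleSum k m (fun l => Ψ (X 0 :: l)) (fun i => X i.succ) +
        (-1 : ℤ) ^ (k + 1) • unshuffleSum (k + 1) m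
          (fun l => Ψ (l.take (k + 1) ++ X 0 :: l.drop (k + 1))) (fun i => X i.succ) := by
  classical
  set j : Fin (n + 1) := ⟨k + 1, by omega⟩ with hj
  have hu : unshuffles (n + 1) (k + 1) (m + 1) =
      (unshuffles n k m).image (liftPerm 0) ∪ (unshuffles n (k + 1) m).image (liftPerm j) := by
    ext σ
    rw [Finset.mem_union, Finset.mem_image, Finset.mem_image]
    constructor
    · intro h
      rcases apply_eq_zero_of_mem_unshuffles h with ⟨-, h0⟩ | ⟨i, hi, -, h0⟩
      · obtain ⟨τ, rfl⟩ := exists_liftPerm_eq h0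
        exact Or.inl ⟨τ, liftPerm_zero_mem_unshuffles.mp h, rfl⟩
      · obtain rfl : i = j := Fin.ext hi
        obtain ⟨τ, rfl⟩ := exists_liftPerm_eq h0
        exact Or.inr ⟨τ, (liftPerm_mem_unshuffles (j := j) hk).mp h, rfl⟩
    · rintro (⟨τ, h, rfl⟩ | ⟨τ, h, rfl⟩)
      · exact liftPerm_zero_mem_unshuffles.mpr h
      · exact (liftPerm_mem_unshuffles (j := j) hk).mpr h
  have hd : Disjoint ((unshuffles n k m).image (liftPerm 0))
      ((unshuffles n (k + 1) m).image (liftPerm j)) := by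
    rw [Finset.disjoint_left]
    intro σ h h'
    obtain ⟨τ, -, rfl⟩ := Finset.mem_image.mp h
    obtain ⟨τ', -, e⟩ := Finset.mem_image.mp h'
    have h0 : liftPerm 0 τ j = liftPerm 0 τ 0 := by rw [liftPerm_self, ← e, liftPerm_self]
    simpa [hj, Fin.ext_iff] using (liftPerm 0 τ).injective h0
  rw [unshuffleSum, hu, Finset.sum_union hd, sum_liftPerm, sum_liftPerm]
  simp [hj]

lemma unshuffleSum_eq_shuffleSum {n k q : ℕ} (h : k + q ≤ n)
    (Φ : List W → List W → List W → A) (X : Fin n → W) :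
    unshuffleSum k (k + q) (fun l => Φ (l.take k) ((l.drop k).take q) (l.drop (k + q))) X =
      ListCochain.shuffleSum k q Φ (List.ofFn X) := by
  induction n generalizing k q Φ with
  | zero =>
    obtain ⟨rfl, rfl⟩ : k = 0 ∧ q = 0 := by omega
    simp [unshuffleSum_zero, ListCochain.shuffleSum]
  | succ n ih =>
    rcases k with _ | k <;> rcases q with _ | q
    · simp [unshuffleSum_zero, ListCochain.shuffleSum]
    · rw [List.ofFn_succ, ListCochain.shuffleSum, ← ih (by omega), ← add_assoc,
        unshuffleSum_zero_left]
      simp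
    · rw [List.ofFn_succ, ListCochain.shuffleSum, ← ih (by omega), add_zero, unshuffleSum_self]
      simp
    · rw [List.ofFn_succ, ListCochain.shuffleSum, ← ih (by omega), ← ih (by omega),
        ← add_assoc (k + 1), unshuffleSum_succ (by omega) (by omega)]
      congr 1
      · rw [add_right_comm, add_assoc]
        simp [← add_assoc]
      · congr 1
        refine Finset.sum_congr rfl fun σ _ => ?_
        set l := List.ofFn fun i : Fin n => X (σ i).succ with hl
        have hlen : (l.take (k + 1)).length = k + 1 := by simp [hl]; omega
        have hdrop : (l.take (k + 1) ++ X 0 :: l.drop (k + 1)).drop (k + 1) =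
            X 0 :: l.drop (k + 1) := List.drop_left' hlen
        beta_reduce
        rw [List.take_left' hlen, add_assoc (k + 1), ← List.drop_drop (i := q + 1) (j := k + 1), hdrop]
        simp

end unshuffleSum

section ofCochain

open ListCochain

variable {g : Type*} [AddCommGroup g]

/-- A homogeneous cochain, extended by zero to lists of arbitrary length. -/
noncomputable def ofCochain (p : ℕ) (α : Cochain g p) : ListCochain g := fun l z =>
  if l.length = p then α (fun i => (l.getD i 0).1) (fun i => (l.getD i 0).2) z else 0

lemma hasDegree_ofCochain (p : ℕ) (α : Cochain g p) : (ofCochain p α).HasDegree p :=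
  fun l hl => by funext z; simp [ofCochain, hl]

lemma ofCochain_of_length {p : ℕ} (α : Cochain g p) {l : List (g × g)} (hl : l.length = p) (z : g) :
    ofCochain p α l z = α (fun i => (l.getD i 0).1) (fun i => (l.getD i 0).2) z := if_pos hl

lemma getD_ofFn {W : Type*} {n : ℕ} (X : Fin n → W) (i : ℕ) (h : i < n) (d : W) :
    (List.ofFn X).getD i d = X ⟨i, h⟩ := by
  rw [List.getD_eq_getElem _ _ (by simpa using h), List.getElem_ofFn]

lemma getD_append_cons {W : Type*} (a b : List W) (w d : W) (i : ℕ) :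
    (a ++ w :: b).getD i d = if i = a.length then w else (a ++ d :: b).getD i d := by
  simp only [List.getD_eq_getElem?_getD, List.getElem?_append, List.getElem?_cons]
  split_ifs <;> first | rfl | omega

lemma isMultiadditive_ofCochain {K : Type*} [Field K] [Module K g] {p : ℕ} {α : Cochain g p}
    (hα : IsCochain K p α) : (ofCochain p α).IsMultiadditive := by
  obtain ⟨h₁, -, h₂, -, h₃, -⟩ := hα
  have key (a b : List (g × g)) (x y : g) (h : a.length < p) :
      (fun i : Fin p => ((a ++ (x, y) :: b).getD i 0).1) =
        Function.update (fun i : Fin p => ((a ++ 0 :: b).getD i 0).1) ⟨a.length, h⟩ x ∧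
      (fun i : Fin p => ((a ++ (x, y) :: b).getD i 0).2) =
        Function.update (fun i : Fin p => ((a ++ 0 :: b).getD i 0).2) ⟨a.length, h⟩ y := by
    constructor <;> funext i <;> rw [getD_append_cons] <;>
      simp only [Function.update_apply, Fin.ext_iff] <;> split_ifs <;> rfl
  refine ⟨fun a b x x' y z => ?_, fun a b x y y' z => ?_, fun l z z' => ?_⟩
  · by_cases hl : a.length + (b.length + 1) = p
    · have h : a.length < p := by omega
      rw [ofCochain_of_length _ (by simpa using hl), ofCochain_of_length _ (by simpa using hl),
        ofCochain_of_length _ (by simpa using hl)]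
      rw [(key a b (x + x') y h).1, (key a b (x + x') y h).2, (key a b x y h).1,
        (key a b x y h).2, (key a b x' y h).1, (key a b x' y h).2, h₁]
    · simp [ofCochain, hl]
  · by_cases hl : a.length + (b.length + 1) = p
    · have h : a.length < p := by omega
      rw [ofCochain_of_length _ (by simpa using hl), ofCochain_of_length _ (by simpa using hl),
        ofCochain_of_length _ (by simpa using hl)]
      rw [(key a b x (y + y') h).1, (key a b x (y + y') h).2, (key a b x y h).1,
        (key a b x y h).2, (key a b x y' h).1, (key a b x y' h).2, h₂]
    · simp [ofCochain, hl]
  · by_cases hl : l.length = p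
    · simp only [ofCochain, hl, if_true, h₃]
    · simp [ofCochain, hl]

lemma getD_take_append_cons_drop {W : Type*} (l : List W) (k q : ℕ) (w d : W) (i : ℕ)
    (hk : k ≤ l.length) :
    (l.take k ++ w :: l.drop (k + q + 1)).getD i d =
      if i < k then l.getD i d else if i = k then w else l.getD (i + q) d := by
  simp only [List.getD_eq_getElem?_getD, List.getElem?_append, List.length_take, min_eq_left hk,
    List.getElem?_take, List.getElem?_cons, List.getElem?_drop]
  split_ifs with h₁ h₂ h₃ h₃
  · rfl
  · rfl
  · omega
  · omega
  · congr 2; omega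

lemma getD_take {W : Type*} (l : List W) (k i : ℕ) (d : W) (h : i < k) :
    (l.take k).getD i d = l.getD i d := by
  simp only [List.getD_eq_getElem?_getD, List.getElem?_take, if_pos h]

lemma getD_take_drop {W : Type*} (l : List W) (k q i : ℕ) (d : W) (h : i < q) :
    ((l.drop k).take q).getD i d = l.getD (k + i) d := by
  rw [getD_take _ _ _ _ h, List.getD_eq_getElem?_getD, List.getElem?_drop,
    List.getD_eq_getElem?_getD]

lemma circProd_eq_circ {p q : ℕ} {α : Cochain g p} (β : Cochain g q)
    (hα : (ofCochain p α).IsMultiadditive) (xs ys : Fin (p + q) → g) (z : g) :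
    circProd p q α β xs ys z =
      circ (ofCochain p α) (ofCochain q β) (List.ofFn fun i => (xs i, ys i)) z := by
  set X : Fin (p + q) → g × g := fun i => (xs i, ys i) with hX
  rw [circ_eq_sum_shuffleSum (hasDegree_ofCochain p α) (hasDegree_ofCochain q β) hα _ (by simp),
    Pi.add_apply, Finset.sum_range, Finset.sum_apply, circProd]
  congr 1
  · refine Finset.sum_congr rfl fun k _ => ?_
    have hk := k.isLt
    rw [Pi.smul_apply, ← unshuffleSum_eq_shuffleSum (by omega), unshuffleSum, Finset.sum_apply]
    congr 1
    refine Finset.sum_congr rfl fun σ hσ => ?_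
    have hfix := (mem_unshuffles.mp hσ).1 ⟨k + q, by omega⟩ le_rfl
    set l := List.ofFn fun i => X (σ i) with hl
    have hlen : l.length = p + q := by simp [hl]
    have hget : ∀ i (h : i < p + q), l.getD i 0 = X (σ ⟨i, h⟩) := fun i h => getD_ofFn _ i h 0
    have hdrop : l.drop (k + q) = X ⟨k + q, by omega⟩ :: l.drop (k + q + 1) := by
      rw [List.drop_eq_getElem_cons (by omega)]
      simp [hl, hfix]
    have hβ : ∀ u, ofCochain q β ((l.drop k).take q) u =
        β (fun j => xs (σ ⟨k + j, by omega⟩)) (fun j => ys (σ ⟨k + j, by omega⟩)) u := by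
      intro u
      rw [ofCochain_of_length _ (by simp [hlen]; omega)]
      congr 1 <;> funext j <;> rw [getD_take_drop _ _ _ _ _ j.isLt, hget _ (by omega)]
    have hα' : ∀ w, ofCochain p α (l.take k ++ w :: l.drop (k + q + 1)) z =
        α (fun i => if (i : ℕ) < k then xs (σ ⟨i, by omega⟩) else if (i : ℕ) = k then w.1
            else xs ⟨i + q, by omega⟩)
          (fun i => if (i : ℕ) < k then ys (σ ⟨i, by omega⟩) else if (i : ℕ) = k then w.2
            else ys ⟨i + q, by omega⟩) z := by
      intro w
      rw [ofCochain_of_length _ (by simp [hlen]; omega)]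
      congr 1 <;> funext i <;>
        rw [getD_take_append_cons_drop _ _ _ _ _ _ (by omega)] <;> split_ifs with h₁ h₂
      · rw [hget _ (by omega)]
      · rfl
      · rw [hget _ (by omega), (mem_unshuffles.mp hσ).1 _ (by simp only; omega)]
      · rw [hget _ (by omega)]
      · rfl
      · rw [hget _ (by omega), (mem_unshuffles.mp hσ).1 _ (by simp only; omega)]
    rw [Pi.smul_apply, hdrop, insertPair, Pi.add_apply, hα', hα', hβ, hβ]
    rfl
  · rw [Pi.smul_apply, ← unshuffleSum_eq_shuffleSum le_rfl, unshuffleSum, Finset.sum_apply]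
    congr 1
    refine Finset.sum_congr rfl fun σ _ => ?_
    set l := List.ofFn fun i => X (σ i) with hl
    have hlen : l.length = p + q := by simp [hl]
    have hget : ∀ i (h : i < p + q), l.getD i 0 = X (σ ⟨i, h⟩) := fun i h => getD_ofFn _ i h 0
    rw [Pi.smul_apply, insertLast, ofCochain_of_length _ (by simp [hlen]),
      ofCochain_of_length _ (by simp [hlen])]
    congr 2
    · funext i; rw [getD_take _ _ _ _ i.isLt, hget _ (by omega)]; rfl
    · funext i; rw [getD_take _ _ _ _ i.isLt, hget _ (by omega)]; rfl
    · congr 1 <;> funext j <;> rw [getD_take_drop _ _ _ _ _ j.isLt, hget _ (by omega)]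

lemma nrBracket_eq_bracket {p q : ℕ} {α : Cochain g p} {β : Cochain g q}
    (hα : (ofCochain p α).IsMultiadditive) (hβ : (ofCochain q β).IsMultiadditive)
    (xs ys : Fin (p + q) → g) (z : g) :
    nrBracket p q α β xs ys z =
      bracket p q (ofCochain p α) (ofCochain q β) (List.ofFn fun i => (xs i, ys i)) z := by
  rw [nrBracket, circProd_eq_circ β hα, circProd_eq_circ α hβ,
    List.ofFn_congr (Nat.add_comm p q) fun i => (xs i, ys i)]
  rfl

lemma ofCochain_nrBracket {p q : ℕ} {α : Cochain g p} {β : Cochain g q}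
    (hα : (ofCochain p α).IsMultiadditive) (hβ : (ofCochain q β).IsMultiadditive) :
    ofCochain (p + q) (nrBracket p q α β) = bracket p q (ofCochain p α) (ofCochain q β) := by
  funext l z
  by_cases hl : l.length = p + q
  · rw [ofCochain_of_length _ hl, nrBracket_eq_bracket hα hβ]
    congr 1
    refine List.ext_getElem (by simp [hl]) fun i h₁ h₂ => ?_
    simp [h₂]
  · rw [hasDegree_ofCochain _ _ l hl,
      (hasDegree_ofCochain p α).bracket (hasDegree_ofCochain q β) hα hβ l hl]

lemma isCochain_toC1 {K : Type*} [Field K] [Module K g] {b : g →ₗ[K] g →ₗ[K] g →ₗ[K] g}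
    (halt : ∀ x y z : g, x = y ∨ y = z ∨ x = z → b x y z = 0) : IsCochain K 1 (toC1 b) := by
  refine ⟨?_, ?_, ?_, ?_, ?_, ?_, ?_, ?_⟩ <;> intros <;> simp_all [toC1, Fin.fin_one_eq_zero]
  rename_i xs ys z _ h
  exact halt _ _ _ (h.elim (Or.inr ∘ Or.inr) (Or.inr ∘ Or.inl))

lemma circ_toC1_self {K : Type*} [Field K] [Module K g] {b : g →ₗ[K] g →ₗ[K] g →ₗ[K] g}
    (hb : (ofCochain 1 (toC1 b)).IsMultiadditive)
    (hfi : ∀ x1 x2 x3 x4 x5 : g,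
      b x1 x2 (b x3 x4 x5)
        = b (b x1 x2 x3) x4 x5 + b x3 (b x1 x2 x4) x5 + b x3 x4 (b x1 x2 x5)) :
    circ (ofCochain 1 (toC1 b)) (ofCochain 1 (toC1 b)) = 0 := by
  funext l z
  by_cases hl : l.length = 2
  · obtain ⟨X, Y, rfl⟩ := List.length_eq_two.mp hl
    simp [circ, ofCochain, toC1, contract, contractDer, signTwist, hfi X.1]
    abel
  · rw [(hasDegree_ofCochain _ _).circ (hasDegree_ofCochain _ _) hb l hl]
    rfl

end ofCochain

/-- for a 3-Lie algebra `(g, μ)`, the operator `δ̄ = ⟦μ, ·⟧` squares to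
zero and is a degree-1 graded derivation of `⟦·,·⟧`; hence `(⊕ₚ C^p(g,g), ⟦·,·⟧, δ̄)`
is a differential graded Lie algebra. -/
theorem nrDifferential_dgla {K : Type*} [Field K] [CharZero K]
    {g : Type*} [AddCommGroup g] [Module K g]
    (b : g →ₗ[K] g →ₗ[K] g →ₗ[K] g)
    (halt : ∀ x y z : g, x = y ∨ y = z ∨ x = z → b x y z = 0)
    (hfi : ∀ x1 x2 x3 x4 x5 : g,
      b x1 x2 (b x3 x4 x5)
        = b (b x1 x2 x3) x4 x5 + b x3 (b x1 x2 x4) x5 + b x3 x4 (b x1 x2 x5))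
    (p q : ℕ) (α : Cochain g p) (β : Cochain g q)
    (hα : IsCochain K p α) (hβ : IsCochain K q β) :
    (∀ (xs ys : Fin (1 + (1 + p)) → g) (z : g),
      nrBracket 1 (1 + p) (toC1 b) (nrBracket 1 p (toC1 b) α) xs ys z = 0) ∧
    (∀ (xs ys : Fin (1 + (p + q)) → g) (z : g),
      nrBracket 1 (p + q) (toC1 b) (nrBracket p q α β) xs ys z
        = nrBracket (1 + p) q (nrBracket 1 p (toC1 b) α) β
            (fun i => xs (Fin.cast (by omega) i)) (fun i => ys (Fin.cast (by omega) i)) z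
          + ((-1 : ℤ) ^ p) •
              nrBracket p (1 + q) α (nrBracket 1 q (toC1 b) β)
                (fun i => xs (Fin.cast (by omega) i))
                (fun i => ys (Fin.cast (by omega) i)) z) := by
  have hM := isMultiadditive_ofCochain (isCochain_toC1 halt)
  have hα' := isMultiadditive_ofCochain hα
  have hβ' := isMultiadditive_ofCochain hβ
  have dM := hasDegree_ofCochain 1 (toC1 b)
  have dα := hasDegree_ofCochain p α
  have dβ := hasDegree_ofCochain q β
  have hMα := ofCochain_nrBracket hM hα'
  have hMβ := ofCochain_nrBracket hM hβ'
  have hαβ := ofCochain_nrBracket hα' hβ'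
  refine ⟨fun xs ys z => ?_, fun xs ys z => ?_⟩
  · have hg : ∀ x : g, (2 : ℤ) • x = 0 → x = 0 := fun x hx => by
      rw [← Int.cast_smul_eq_zsmul K] at hx
      exact (smul_eq_zero.mp hx).resolve_left (by norm_num)
    rw [nrBracket_eq_bracket hM (hMα ▸ hM.bracket hα' 1 p), hMα,
      ListCochain.bracket_bracket_self hg dM dα hM hα' (circ_toC1_self hM hfi)]
    rfl
  · rw [nrBracket_eq_bracket hM (hαβ ▸ hα'.bracket hβ' p q),
      nrBracket_eq_bracket (hMα ▸ hM.bracket hα' 1 p) hβ',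
      nrBracket_eq_bracket hα' (hMβ ▸ hM.bracket hβ' 1 q), hMα, hMβ, hαβ,
      ListCochain.bracket_bracket dM dα dβ hM hα' hβ',
      ← List.ofFn_congr (show 1 + (p + q) = 1 + p + q by omega) fun i => (xs i, ys i),
      ← List.ofFn_congr (show 1 + (p + q) = p + (1 + q) by omega) fun i => (xs i, ys i)]
    rfl
end
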